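/- For each n ≥ 1 let 𝒫_n be chosen uniformly at random from the set of isomorphism classes of rooted labeled trees on n vertices (equivalently, a uniformly random Pólya tree of size n), and let L(𝒫_n) = n!/|Aut(T)|, where T is any representative of the class, be the number of labelings of 𝒫_n. Then there exist constants μ ∈ ℝ (μ ≈ 0.137342), σ² > 0 (σ² ≈ 0.196770) and C > 0 such that |E[log L(𝒫_n)] − (n·log n − (μ+1)n + (1/2)·log n)| ≤ C and |Var[log L(𝒫_n)] − σ²n| ≤ C for all n ≥ 1, and (log L(𝒫_n) − E[log L(𝒫_n)])/√n converges in distribution to the normal distribution N(0, σ²) as n → ∞. -/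

import Mathlib

open scoped Classical BigOperators

/-- A rooted labeled tree on `n` vertices: a simple graph on `Fin n` that is a
tree, together with a distinguished root vertex. -/
structure RTree (n : ℕ) where
  graph : SimpleGraph (Fin n)
  isTree : graph.IsTree
  root : Fin n

namespace RTree

/-- Two rooted labeled trees are isomorphic if there is a graph isomorphism
mapping root to root. -/
def Isom {n : ℕ} (T₁ T₂ : RTree n) : Prop :=
  ∃ φ : T₁.graph ≃g T₂.graph, φ T₁.root = T₂.root

/-- The out-degree (number of children) of a vertex: its degree if it is the
root and its degree minus one otherwise. -/
noncomputable def outdeg {n : ℕ} (T : RTree n) (v : Fin n) : ℕ :=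
  if v = T.root then (T.graph.neighborSet v).ncard
  else (T.graph.neighborSet v).ncard - 1

/-- The number of root-fixing graph automorphisms. -/
noncomputable def autCard {n : ℕ} (T : RTree n) : ℕ :=
  Nat.card {φ : T.graph ≃g T.graph // φ T.root = T.root}

instance finite {n : ℕ} : Finite (RTree n) := by
  have h : Function.Injective (fun T : RTree n => (T.graph, T.root)) := by
    rintro ⟨g₁, h₁, r₁⟩ ⟨g₂, h₂, r₂⟩ h
    simp_all
  exact Finite.of_injective _ h

noncomputable instance fintype {n : ℕ} : Fintype (RTree n) := Fintype.ofFinite _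

end RTree

open MeasureTheory ProbabilityTheory

/-- The isomorphism classes of rooted labeled trees on `n` vertices; these are
in bijection with the Pólya trees of size `n`. -/
def Polya (n : ℕ) : Type :=
  Quot (fun T₁ T₂ : RTree n => T₁.Isom T₂)

instance (n : ℕ) : Finite (Polya n) :=
  Finite.of_surjective (Quot.mk _) Quot.exists_rep

noncomputable instance (n : ℕ) : Fintype (Polya n) := Fintype.ofFinite _

set_option linter.all false

structure PF (V : Type) where
  p : V → V
  r : V
  hr : p r = r
  ht : ∀ v, ∃ k, p^[k] v = r

namespace PF

variable {V W U : Type}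

theorem it_r (A : PF V) (k : ℕ) : A.p^[k] A.r = A.r := Function.iterate_fixed A.hr k

theorem fix (A : PF V) {v : V} (h : A.p v = v) : v = A.r := by
  obtain ⟨k, hk⟩ := A.ht v
  rw [Function.iterate_fixed h k] at hk
  exact hk

theorem two (A : PF V) {v : V} (h : A.p (A.p v) = v) : v = A.r := by
  obtain ⟨k, hk⟩ := A.ht v
  have h2 : ∀ k, A.p^[k] v = v ∨ A.p^[k] v = A.p v := by
    intro k
    induction k with
    | zero => simp
    | succ k ih =>
      rw [Function.iterate_succ_apply']
      rcases ih with ih | ih <;> rw [ih]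
      · right; rfl
      · left; exact h
  rcases h2 k with h3 | h3
  · rw [← h3, hk]
  · rw [h3] at hk
    rw [hk, A.hr] at h
    exact h.symm

def Iso (A : PF V) (B : PF W) : Type := {e : V ≃ W // ∀ v, e (A.p v) = B.p (e v)}

theorem Iso.root {A : PF V} {B : PF W} (e : Iso A B) : e.1 A.r = B.r := by
  apply B.fix
  rw [← e.2, A.hr]

def Iso.refl (A : PF V) : Iso A A := ⟨Equiv.refl _, fun _ => rfl⟩
def Iso.symm {A : PF V} {B : PF W} (e : Iso A B) : Iso B A :=
  ⟨e.1.symm, fun v => by rw [Equiv.symm_apply_eq, e.2]; simp⟩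
def Iso.trans {A : PF V} {B : PF W} {C : PF U} (e : Iso A B) (f : Iso B C) : Iso A C :=
  ⟨e.1.trans f.1, fun v => by simp [e.2, f.2]⟩

def map (A : PF V) (e : V ≃ W) : PF W where
  p := fun w => e (A.p (e.symm w))
  r := e A.r
  hr := by simp [A.hr]
  ht := fun w => by
    obtain ⟨k, hk⟩ := A.ht (e.symm w)
    refine ⟨k, ?_⟩
    rw [← hk]
    have : ∀ k, (fun w => e (A.p (e.symm w)))^[k] w = e (A.p^[k] (e.symm w)) := by
      intro k
      induction k with
      | zero => simp
      | succ k ih => rw [Function.iterate_succ_apply', ih, Function.iterate_succ_apply']; simp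
    exact this k

def mapIso (A : PF V) (e : V ≃ W) : Iso A (A.map e) := ⟨e, fun v => by simp [map]⟩

/-- the graph -/
def gr (A : PF V) : SimpleGraph V where
  Adj u v := u ≠ v ∧ (A.p u = v ∨ A.p v = u)
  symm := ⟨fun u v h => ⟨h.1.symm, h.2.symm⟩⟩
  loopless := ⟨fun u h => h.1 rfl⟩

theorem gr_reach (A : PF V) (k : ℕ) : ∀ v, A.p^[k] v = A.r → A.gr.Reachable v A.r := by
  induction k with
  | zero => intro v h; simp at h; rw [h]
  | succ k ih =>
    intro v h
    rw [Function.iterate_succ_apply] at h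
    by_cases hv : A.p v = v
    · rw [hv] at h; exact ih _ h
    · have h1 : A.gr.Adj v (A.p v) := ⟨fun h => hv h.symm, Or.inl rfl⟩
      exact h1.reachable.trans (ih _ h)

theorem gr_conn (A : PF V) : A.gr.Connected := by
  haveI : Nonempty V := ⟨A.r⟩
  refine ⟨fun u v => ?_⟩
  obtain ⟨k, hk⟩ := A.ht u
  obtain ⟨l, hl⟩ := A.ht v
  exact (A.gr_reach k u hk).trans (A.gr_reach l v hl).symm

theorem gr_tree [Finite V] (A : PF V) : A.gr.IsTree := by
  rw [SimpleGraph.isTree_iff_connected_and_card]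
  refine ⟨A.gr_conn, ?_⟩
  have h1 := A.gr_conn.card_vert_le_card_edgeSet_add_one
  have h2 : Nat.card A.gr.edgeSet ≤ Nat.card {v : V // v ≠ A.r} := by
    let f : {v : V // v ≠ A.r} → A.gr.edgeSet := fun v =>
      ⟨s(v.1, A.p v.1), ⟨fun h => v.2 (A.fix h.symm), Or.inl rfl⟩⟩
    refine Nat.card_le_card_of_surjective f ?_
    rintro ⟨x, hx⟩
    induction x using Sym2.ind with
    | _ a b =>
      have hx' : a ≠ b ∧ (A.p a = b ∨ A.p b = a) := hx
      rcases hx'.2 with h | h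
      · refine ⟨⟨a, fun h' => hx'.1 ?_⟩, ?_⟩
        · rw [← h, h', A.hr]
        · simp [f, h]
      · refine ⟨⟨b, fun h' => hx'.1 ?_⟩, ?_⟩
        · rw [← h, h', A.hr]
        · simp [f, h, Sym2.eq_swap]
  have h3 : Nat.card {v : V // v ≠ A.r} + 1 = Nat.card V := by
    rw [← Finite.card_option]
    exact Nat.card_congr (Equiv.optionSubtypeNe A.r)
  omega

theorem exists_of_tree [Finite V] (G : SimpleGraph V) (hG : G.IsTree) (r : V) :
    ∃ A : PF V, A.gr = G ∧ A.r = r := by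
  have hc := hG.connected
  have h1 : ∀ v, ∃ w, (v = r → w = r) ∧ (v ≠ r → G.Adj v w ∧ G.dist w r + 1 = G.dist v r) := by
    intro v
    by_cases hv : v = r
    · exact ⟨r, fun _ => rfl, fun h => absurd hv h⟩
    · obtain ⟨q, hq⟩ := hc.exists_walk_length_eq_dist v r
      cases q with
      | nil => exact absurd rfl hv
      | @cons _ w _ h q =>
        refine ⟨w, fun h => absurd h hv, fun _ => ⟨h, ?_⟩⟩
        have h2 : G.dist w r ≤ q.length := SimpleGraph.dist_le q
        have h3 : G.dist v r ≤ G.dist v w + G.dist w r := hc.dist_triangle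
        rw [SimpleGraph.dist_eq_one_iff_adj.mpr h] at h3
        simp at hq
        omega
  choose p hp1 hp2 using h1
  have ht : ∀ n, ∀ v, G.dist v r = n → p^[n] v = r := by
    intro n
    induction n with
    | zero => intro v hv; simpa using (hc.dist_eq_zero_iff).mp hv
    | succ n ih =>
      intro v hv
      rw [Function.iterate_succ_apply]
      apply ih
      have : v ≠ r := by rintro rfl; simp at hv
      have := (hp2 v this).2
      omega
  let A : PF V := ⟨p, r, hp1 r rfl, fun v => ⟨_, ht _ v rfl⟩⟩
  refine ⟨A, ?_, rfl⟩
  have hle : A.gr ≤ G := by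
    intro a b h
    have h' : a ≠ b ∧ (p a = b ∨ p b = a) := h
    rcases h'.2 with h2 | h2
    · have : a ≠ r := fun ha => h'.1 (by rw [← h2, hp1 a ha, ha])
      rw [← h2]; exact (hp2 a this).1
    · have : b ≠ r := fun ha => h'.1 (by rw [← h2, hp1 b ha, ha])
      rw [← h2]; exact (hp2 b this).1.symm
  have hm := (SimpleGraph.isTree_iff_minimal_connected.mp hG)
  exact le_antisymm hle (hm.2 A.gr_conn hle)

theorem gr_comm {A : PF V} {B : PF W} (φ : A.gr ≃g B.gr) (h : φ A.r = B.r) (v : V) :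
    φ (A.p v) = B.p (φ v) := by
  have : ∀ k, ∀ v, A.p^[k] v = A.r → φ (A.p v) = B.p (φ v) := by
    intro k
    induction k with
    | zero => intro v hv; simp at hv; rw [hv, A.hr, h, B.hr]
    | succ k ih =>
      intro v hv
      rw [Function.iterate_succ_apply] at hv
      by_cases hvr : v = A.r
      · rw [hvr, A.hr, h, B.hr]
      have h1 : A.gr.Adj v (A.p v) := ⟨fun h => hvr (A.fix h.symm), Or.inl rfl⟩
      have h2 : B.gr.Adj (φ v) (φ (A.p v)) := φ.map_adj_iff.mpr h1
      rcases h2.2 with h3 | h3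
      · exact h3.symm
      · rw [← ih _ hv] at h3
        exact absurd (A.two (φ.injective h3)) hvr
  obtain ⟨k, hk⟩ := A.ht v
  exact this k v hk

def grEquiv (A : PF V) (B : PF W) : {φ : A.gr ≃g B.gr // φ A.r = B.r} ≃ Iso A B where
  toFun φ := ⟨φ.1.toEquiv, fun v => gr_comm φ.1 φ.2 v⟩
  invFun e := ⟨⟨e.1, by
    intro a b
    show (e.1 a ≠ e.1 b ∧ (B.p (e.1 a) = e.1 b ∨ B.p (e.1 b) = e.1 a)) ↔ (a ≠ b ∧ (A.p a = b ∨ A.p b = a))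
    rw [← e.2, ← e.2]; simp⟩, e.root⟩
  left_inv φ := by ext; rfl
  right_inv e := rfl

/-! joins -/
section join
variable {I J : Type} {F : I → Type} {K : J → Type}

noncomputable def jp (A : ∀ i, PF (F i)) : Option (Σ i, F i) → Option (Σ i, F i)
  | none => none
  | some ⟨i, v⟩ => if v = (A i).r then none else some ⟨i, (A i).p v⟩

theorem jp_it (A : ∀ i, PF (F i)) (i : I) (k : ℕ) : ∀ v, (A i).p^[k] v = (A i).r →
    ∃ l, (jp A)^[l] (some ⟨i, v⟩) = none := by
  induction k with
  | zero => intro v hv; simp at hv; exact ⟨1, by simp [jp, hv]⟩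
  | succ k ih =>
    intro v hv
    by_cases h : v = (A i).r
    · exact ⟨1, by simp [jp, h]⟩
    · obtain ⟨l, hl⟩ := ih _ hv
      exact ⟨l + 1, by rw [Function.iterate_succ_apply]; simpa [jp, h] using hl⟩

noncomputable def join (A : ∀ i, PF (F i)) : PF (Option (Σ i, F i)) where
  p := jp A
  r := none
  hr := rfl
  ht := by
    rintro (_ | ⟨i, v⟩)
    · exact ⟨0, rfl⟩
    · obtain ⟨k, hk⟩ := (A i).ht v
      exact jp_it A i k v hk

theorem sc_apply (e : I ≃ J) (f : ∀ i, F i ≃ K (e i)) (i : I) (v : F i) :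
    (e.sigmaCongr f) ⟨i, v⟩ = ⟨e i, f i v⟩ := rfl

noncomputable def joinMap (A : ∀ i, PF (F i)) (B : ∀ j, PF (K j)) :
    (Σ e : I ≃ J, ∀ i, Iso (A i) (B (e i))) → Iso (join A) (join B) := fun x =>
  ⟨Equiv.optionCongr (Equiv.sigmaCongr x.1 (fun i => (x.2 i).1)), by
    rintro (_ | ⟨i, v⟩)
    · rfl
    · have h : (x.2 i).1 v = (B (x.1 i)).r ↔ v = (A i).r := by
        rw [← (x.2 i).root]; simp
      by_cases hv : v = (A i).r
      · simp [join, jp, hv, sc_apply, (x.2 i).root]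
      · simp [join, jp, hv, sc_apply, h, (x.2 i).2]⟩

theorem joinMap_bij (A : ∀ i, PF (F i)) (B : ∀ j, PF (K j)) :
    Function.Bijective (joinMap A B) := by
  constructor
  · rintro ⟨e, f⟩ ⟨e', f'⟩ h
    have h0 : ∀ i v, (⟨e i, (f i).1 v⟩ : Σ j, K j) = ⟨e' i, (f' i).1 v⟩ := by
      intro i v
      have := congrArg (fun z => z.1 (some ⟨i, v⟩)) h
      simpa [joinMap, sc_apply] using this
    have he : e = e' := by
      ext i
      exact congrArg Sigma.fst (h0 i (A i).r)
    subst he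
    congr 1
    funext i
    apply Subtype.ext
    ext v
    have := h0 i v
    simpa using this
  · intro φ
    have h1 : ∀ i, ∃ j, φ.1 (some ⟨i, (A i).r⟩) = some ⟨j, (B j).r⟩ := by
      intro i
      have h := φ.2 (some ⟨i, (A i).r⟩)
      have h2 : (join A).p (some ⟨i, (A i).r⟩) = none := by simp [join, jp]
      rw [h2] at h
      have h3 : φ.1 none = none := φ.root
      rw [h3] at h
      rcases hx : φ.1 (some ⟨i, (A i).r⟩) with _ | ⟨j, w⟩
      · rw [← h3] at hx
        simpa using φ.1.injective hx
      · rw [hx] at h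
        refine ⟨j, ?_⟩
        by_cases hw : w = (B j).r
        · rw [hw]
        · simp [join, jp, hw] at h
    choose e he using h1
    have h2 : ∀ i, ∀ k v, (A i).p^[k] v = (A i).r → ∃ w, φ.1 (some ⟨i, v⟩) = some ⟨e i, w⟩ := by
      intro i k
      induction k with
      | zero => intro v hv; simp at hv; exact ⟨_, by rw [hv, he]⟩
      | succ k ih =>
        intro v hv
        by_cases h : v = (A i).r
        · exact ⟨_, by rw [h, he]⟩
        · obtain ⟨w, hw⟩ := ih _ hv
          have h3 := φ.2 (some ⟨i, v⟩)
          have h4 : (join A).p (some ⟨i, v⟩) = some ⟨i, (A i).p v⟩ := by simp [join, jp, h]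
          rw [h4, hw] at h3
          rcases hx : φ.1 (some ⟨i, v⟩) with _ | ⟨j, u⟩
          · rw [hx] at h3; simp [join, jp] at h3
          · rw [hx] at h3
            by_cases hu : u = (B j).r
            · simp [join, jp, hu] at h3
            · simp [join, jp, hu] at h3
              obtain ⟨h5, _⟩ := h3
              subst h5
              exact ⟨u, rfl⟩
    have h3 : ∀ i v, ∃ w, φ.1 (some ⟨i, v⟩) = some ⟨e i, w⟩ := by
      intro i v
      obtain ⟨k, hk⟩ := (A i).ht v
      exact h2 i k v hk
    choose g hg using h3
    have hne : ∀ y, φ.1.symm (some y) ≠ none := by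
      intro y hy
      rw [Equiv.symm_apply_eq] at hy
      rw [show φ.1 none = none from φ.root] at hy
      simp at hy
    have einj : Function.Injective e := by
      intro i i' h
      have h1 := he i
      rw [h, ← he i'] at h1
      have := φ.1.injective h1
      simp at this
      exact this.1
    have esurj : Function.Surjective e := by
      intro j
      rcases hx : φ.1.symm (some ⟨j, (B j).r⟩) with _ | ⟨i, v⟩
      · exact absurd hx (hne _)
      · rw [Equiv.symm_apply_eq, hg] at hx
        simp at hx
        exact ⟨i, hx.1.symm⟩
    have gbij : ∀ i, Function.Bijective (g i) := by
      intro i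
      constructor
      · intro v v' h
        have h1 := hg i v
        rw [h, ← hg i v'] at h1
        simpa using φ.1.injective h1
      · intro w
        rcases hx : φ.1.symm (some ⟨e i, w⟩) with _ | ⟨i', v⟩
        · exact absurd hx (hne _)
        · rw [Equiv.symm_apply_eq, hg] at hx
          simp at hx
          have := einj hx.1
          subst this
          exact ⟨v, by simpa using hx.2.symm⟩
    have groot : ∀ i, g i (A i).r = (B (e i)).r := by
      intro i
      have := hg i (A i).r
      rw [he] at this
      simpa using this.symm
    refine ⟨⟨Equiv.ofBijective e ⟨einj, esurj⟩, fun i => ⟨Equiv.ofBijective (g i) (gbij i), ?_⟩⟩, ?_⟩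
    · intro v
      show g i ((A i).p v) = (B (e i)).p (g i v)
      by_cases h : v = (A i).r
      · rw [h, (A i).hr]
        have := groot i
        rw [this]
        exact ((B (e i)).hr).symm
      · have h1 := φ.2 (some ⟨i, v⟩)
        have h4 : (join A).p (some ⟨i, v⟩) = some ⟨i, (A i).p v⟩ := by simp [join, jp, h]
        rw [h4, hg, hg] at h1
        have h5 : g i v ≠ (B (e i)).r := by
          rw [← groot]
          exact fun h' => h ((gbij i).1 h')
        simp [join, jp, h5] at h1
        exact h1
    · apply Subtype.ext
      ext1 x
      rcases x with _ | ⟨i, v⟩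
      · exact (φ.root).symm
      · rw [hg]; rfl
end join

/-! branches -/
theorem br_unique (A : PF V) {i j v : V} (hi : i ≠ A.r) (hj : j ≠ A.r) (pi : A.p i = A.r)
    (pj : A.p j = A.r) {k l : ℕ} (h1 : A.p^[k] v = i) (h2 : A.p^[l] v = j) : i = j := by
  have key : ∀ {i j : V} {k l : ℕ}, j ≠ A.r → A.p i = A.r → A.p^[k] v = i → A.p^[l] v = j → ¬ k < l := by
    intro i j k l hj pi h1 h2 hkl
    obtain ⟨d, rfl⟩ := Nat.exists_eq_add_of_lt hkl
    rw [show k + d + 1 = d + (1 + k) by ring, Function.iterate_add_apply, Function.iterate_add_apply, h1] at h2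
    simp at h2
    rw [pi, A.it_r] at h2
    exact hj h2.symm
  have hkl : k = l := le_antisymm (not_lt.mp (key hi pj h2 h1)) (not_lt.mp (key hj pi h1 h2))
  subst hkl
  rw [← h1, h2]

abbrev Ch (A : PF V) : Type := {v : V // v ≠ A.r ∧ A.p v = A.r}
abbrev Bt (A : PF V) (i : A.Ch) : Type := {v : V // ∃ k, A.p^[k] v = i.1}

theorem Bt_ne (A : PF V) (i : A.Ch) (v : A.Bt i) : v.1 ≠ A.r := by
  intro h
  obtain ⟨k, hk⟩ := v.2
  rw [h, A.it_r] at hk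
  exact i.2.1 hk.symm

noncomputable def bp (A : PF V) (i : A.Ch) (v : A.Bt i) : A.Bt i :=
  if h : v.1 = i.1 then v else ⟨A.p v.1, by
    obtain ⟨k, hk⟩ := v.2
    cases k with
    | zero => exact absurd hk h
    | succ k => exact ⟨k, hk⟩⟩

noncomputable def br (A : PF V) (i : A.Ch) : PF (A.Bt i) where
  p := A.bp i
  r := ⟨i.1, 0, rfl⟩
  hr := by simp [bp]
  ht := by
    have : ∀ k, ∀ v : A.Bt i, A.p^[k] v.1 = i.1 → ∃ l, (A.bp i)^[l] v = ⟨i.1, 0, rfl⟩ := by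
      intro k
      induction k with
      | zero => intro v hv; exact ⟨0, Subtype.ext hv⟩
      | succ k ih =>
        intro v hv
        by_cases h : v.1 = i.1
        · exact ⟨0, Subtype.ext h⟩
        · have h1 : (A.bp i v).1 = A.p v.1 := by simp [bp, h]
          obtain ⟨l, hl⟩ := ih (A.bp i v) (by rw [h1]; exact hv)
          exact ⟨l + 1, hl⟩
    intro v
    obtain ⟨k, hk⟩ := v.2
    exact this k v hk

theorem join_br (A : PF V) : Nonempty (Iso (join A.br) A) := by
  let f : Option (Σ i, A.Bt i) → V := fun x => match x with
    | none => A.r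
    | some ⟨_, v⟩ => v.1
  have hf : Function.Bijective f := by
    constructor
    · rintro (_ | ⟨i, v⟩) (_ | ⟨j, w⟩) h
      · rfl
      · exact absurd h.symm (A.Bt_ne j w)
      · exact absurd h (A.Bt_ne i v)
      · have h' : v.1 = w.1 := h
        obtain ⟨k, hk⟩ := v.2
        obtain ⟨l, hl⟩ := w.2
        rw [← h'] at hl
        have hij : i = j := Subtype.ext (A.br_unique i.2.1 j.2.1 i.2.2 j.2.2 hk hl)
        subst hij
        rw [Subtype.ext h']
    · intro v
      by_cases h : v = A.r
      · exact ⟨none, h.symm⟩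
      · have hex := A.ht v
        rcases hN : Nat.find hex with _ | n
        · have := Nat.find_spec hex
          rw [hN] at this
          exact absurd this h
        · have h1 := Nat.find_spec hex
          have h2 := Nat.find_min hex (m := n) (by omega)
          rw [hN, Function.iterate_succ_apply'] at h1
          exact ⟨some ⟨⟨A.p^[n] v, h2, h1⟩, ⟨v, n, rfl⟩⟩, rfl⟩
  refine ⟨⟨Equiv.ofBijective f hf, ?_⟩⟩
  rintro (_ | ⟨i, v⟩)
  · exact A.hr.symm
  · show f ((join A.br).p (some ⟨i, v⟩)) = A.p v.1
    by_cases h : v.1 = i.1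
    · have : v = (A.br i).r := Subtype.ext h
      simp only [join, jp, this, if_true, f]
      exact i.2.2.symm
    · have : v ≠ (A.br i).r := fun h' => h (congrArg Subtype.val h')
      simp only [join, jp, this, if_false, f]
      simp [br, bp, h]

end PF

structure PSys (𝒯 : Type) where
  sz : 𝒯 → ℕ
  F : 𝒯 → ℝ
  e : 𝒯 ≃ (𝒯 →₀ ℕ)
  lvl : ℕ → Finset 𝒯
  mem_lvl : ∀ n T, T ∈ lvl n ↔ sz T = n
  sz_eq : ∀ T, sz T = 1 + (e T).sum (fun t m => m * sz t)
  F_eq : ∀ T, F T = (e T).sum (fun t m => Real.log (m.factorial : ℝ) + m * F t)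

abbrev PT : Type := Σ n, Polya n

namespace PF
variable {V W : Type}

theorem isom_eqv (n : ℕ) : Equivalence (fun T₁ T₂ : RTree n => T₁.Isom T₂) where
  refl T := ⟨SimpleGraph.Iso.refl, rfl⟩
  symm := fun ⟨φ, h⟩ => ⟨φ.symm, by rw [← h]; simp⟩
  trans := fun ⟨φ, h⟩ ⟨ψ, h'⟩ => ⟨φ.trans ψ, by simp [h, h']⟩

def toR {n : ℕ} (A : PF (Fin n)) : RTree n := ⟨A.gr, A.gr_tree, A.r⟩

theorem toR_isom {n : ℕ} (A B : PF (Fin n)) : (toR A).Isom (toR B) ↔ Nonempty (Iso A B) := by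
  constructor
  · rintro ⟨φ, h⟩
    exact ⟨grEquiv A B ⟨φ, h⟩⟩
  · rintro ⟨e⟩
    exact ⟨((grEquiv A B).symm e).1, ((grEquiv A B).symm e).2⟩

def mk0 {n : ℕ} (A : PF (Fin n)) : PT := ⟨n, Quot.mk _ (toR A)⟩

theorem mk0_eq {n m : ℕ} (A : PF (Fin n)) (B : PF (Fin m)) : mk0 A = mk0 B ↔ Nonempty (Iso A B) := by
  constructor
  · intro h
    have h1 : n = m := congrArg Sigma.fst h
    subst h1
    have h2 := eq_of_heq (Sigma.mk.inj h).2
    have h3 := (Equivalence.quot_mk_eq_iff (isom_eqv n) _ _).mp h2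
    exact (toR_isom A B).mp h3
  · rintro ⟨e⟩
    have h1 : n = m := by simpa using Nat.card_congr e.1
    subst h1
    unfold mk0
    congr 1
    exact Quot.sound ((toR_isom A B).mpr ⟨e⟩)

noncomputable def mkT [Finite V] (A : PF V) : PT := mk0 (A.map (Finite.equivFin V))

theorem mkT_eq [Finite V] [Finite W] (A : PF V) (B : PF W) : mkT A = mkT B ↔ Nonempty (Iso A B) := by
  unfold mkT
  rw [mk0_eq]
  constructor
  · rintro ⟨e⟩
    exact ⟨((A.mapIso _).trans e).trans (B.mapIso _).symm⟩
  · rintro ⟨e⟩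
    exact ⟨((A.mapIso _).symm.trans e).trans (B.mapIso _)⟩

theorem mkT_fin {n : ℕ} (A : PF (Fin n)) : mkT A = mk0 A := by
  unfold mkT
  rw [mk0_eq]
  exact ⟨(A.mapIso _).symm⟩

theorem mkT_fst [Finite V] (A : PF V) : (mkT A).1 = Nat.card V := rfl

theorem toR_surj {n : ℕ} (t : RTree n) : ∃ A : PF (Fin n), toR A = t := by
  obtain ⟨A, h1, h2⟩ := exists_of_tree t.graph t.isTree t.root
  refine ⟨A, ?_⟩
  cases t
  simp_all [toR]

theorem exists_rep (T : PT) : ∃ A : PF (Fin T.1), mkT A = T := by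
  obtain ⟨n, q⟩ := T
  induction q using Quot.ind with
  | mk t =>
    obtain ⟨A, hA⟩ := toR_surj t
    refine ⟨A, ?_⟩
    rw [mkT_fin, mk0, hA]

noncomputable def rep (T : PT) : PF (Fin T.1) := (exists_rep T).choose
theorem mkT_rep (T : PT) : mkT (rep T) = T := (exists_rep T).choose_spec

noncomputable def aut (T : PT) : ℕ := Nat.card (Iso (rep T) (rep T))

def isoCongr {V V' W W' : Type} {A : PF V} {A' : PF V'} {B : PF W} {B' : PF W'} (a : Iso A A') (b : Iso B B') :
    Iso A B ≃ Iso A' B' where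
  toFun e := (a.symm.trans e).trans b
  invFun e := (a.trans e).trans b.symm
  left_inv e := by apply Subtype.ext; ext x; simp [Iso.trans, Iso.symm]
  right_inv e := by apply Subtype.ext; ext x; simp [Iso.trans, Iso.symm]

theorem aut_mkT [Finite V] (A : PF V) : aut (mkT A) = Nat.card (Iso A A) := by
  have h := mkT_rep (mkT A)
  rw [mkT_eq] at h
  obtain ⟨a⟩ := h
  exact Nat.card_congr (isoCongr a a)

instance [Finite V] [Finite W] (A : PF V) (B : PF W) : Finite (Iso A B) := by
  unfold Iso; infer_instance

theorem aut_pos (T : PT) : 0 < aut T := by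
  haveI : Nonempty (Iso (rep T) (rep T)) := ⟨Iso.refl _⟩
  exact Nat.card_pos

theorem autCard_eq {n : ℕ} (t : RTree n) : t.autCard = aut ⟨n, Quot.mk _ t⟩ := by
  obtain ⟨A, rfl⟩ := toR_surj t
  have : (⟨n, Quot.mk _ (toR A)⟩ : PT) = mkT A := by rw [mkT_fin]; rfl
  rw [this, aut_mkT]
  exact Nat.card_congr (grEquiv A A)

section
variable {I J : Type} [Finite I] [Finite J] {F : I → Type} {K : J → Type} [∀ i, Finite (F i)] [∀ j, Finite (K j)]

theorem join_cls (A : ∀ i, PF (F i)) (B : ∀ j, PF (K j)) :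
    mkT (join A) = mkT (join B) ↔ ∃ e : I ≃ J, ∀ i, mkT (A i) = mkT (B (e i)) := by
  rw [mkT_eq]
  constructor
  · rintro ⟨φ⟩
    obtain ⟨x, -⟩ := (joinMap_bij A B).2 φ
    exact ⟨x.1, fun i => (mkT_eq _ _).mpr ⟨x.2 i⟩⟩
  · rintro ⟨e, h⟩
    exact ⟨joinMap A B ⟨e, fun i => ((mkT_eq _ _).mp (h i)).some⟩⟩
end

noncomputable def dec (T : PT) : PT →₀ ℕ := 
  haveI : Fintype (rep T).Ch := Fintype.ofFinite _
  ∑ i : (rep T).Ch, Finsupp.single (mkT ((rep T).br i)) 1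

theorem sum_single_apply {I X : Type} [Fintype I] (c : I → X) (t : X) :
    (∑ i, Finsupp.single (c i) 1 : X →₀ ℕ) t = Nat.card {i // c i = t} := by
  rw [Nat.card_eq_fintype_card, Finsupp.finset_sum_apply, Fintype.card_subtype]
  rw [Finset.card_filter]
  simp only [Finsupp.single_apply]

theorem exists_equiv_iff {I J X : Type} [Fintype I] [Fintype J] (c : I → X) (d : J → X) :
    (∃ e : I ≃ J, ∀ i, c i = d (e i)) ↔
      (∑ i, Finsupp.single (c i) 1 : X →₀ ℕ) = ∑ j, Finsupp.single (d j) 1 := by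
  constructor
  · rintro ⟨e, h⟩
    rw [← Equiv.sum_comp e]
    simp [h]
  · intro h
    have h1 : ∀ t, Nonempty ({i // c i = t} ≃ {j // d j = t}) := by
      intro t
      have := DFunLike.congr_fun h t
      rw [sum_single_apply, sum_single_apply] at this
      exact ⟨(Finite.equivFin _).trans ((finCongr this).trans (Finite.equivFin _).symm)⟩
    let f := fun t => (h1 t).some
    refine ⟨(Equiv.sigmaFiberEquiv c).symm.trans ((Equiv.sigmaCongrRight (fun t => f t)).trans (Equiv.sigmaFiberEquiv d)), ?_⟩
    intro i
    have := ((f (c i)) ⟨i, rfl⟩).2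
    simp [Equiv.sigmaFiberEquiv]
    exact this.symm

theorem dec_join {I : Type} [Fintype I] {F : I → Type} [∀ i, Finite (F i)] (A : ∀ i, PF (F i)) :
    dec (mkT (join A)) = ∑ i, Finsupp.single (mkT (A i)) 1 := by
  unfold dec
  letI : Fintype (rep (mkT (join A))).Ch := Fintype.ofFinite _
  rw [← exists_equiv_iff, ← join_cls, ← mkT_rep (mkT (join A))]
  rw [mkT_eq, mkT_rep]
  exact join_br _

theorem dec_inj : Function.Injective dec := by
  intro S T h
  unfold dec at h
  letI : Fintype (rep S).Ch := Fintype.ofFinite _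
  letI : Fintype (rep T).Ch := Fintype.ofFinite _
  rw [← exists_equiv_iff, ← join_cls] at h
  rw [← mkT_rep S, ← mkT_rep T, ← (mkT_eq _ _).mpr (join_br (rep S)), ← (mkT_eq _ _).mpr (join_br (rep T))]
  exact h

abbrev fI (m : PT →₀ ℕ) : Type := Σ t : m.support, Fin (m t.1)

theorem fI_sum (m : PT →₀ ℕ) : (∑ i : fI m, Finsupp.single i.1.1 1 : PT →₀ ℕ) = m := by
  rw [Fintype.sum_sigma]
  simp
  exact Finsupp.sum_single m

theorem dec_mk (m : PT →₀ ℕ) : dec (mkT (join (fun i : fI m => rep i.1.1))) = m := by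
  rw [dec_join]
  simp only [mkT_rep]
  exact fI_sum m

noncomputable def decE : PT ≃ (PT →₀ ℕ) := Equiv.ofBijective dec ⟨dec_inj, fun m => ⟨_, dec_mk m⟩⟩

theorem prod_fI (m : PT →₀ ℕ) {M : Type} [CommMonoid M] (g : PT → M) :
    ∏ i : fI m, g i.1.1 = m.prod (fun t k => g t ^ k) := by
  rw [Fintype.prod_sigma]
  simp
  rw [Finset.prod_attach m.support (fun x => g x ^ m x)]
  rfl

theorem aut_join {I : Type} [Fintype I] {F : I → Type} [∀ i, Finite (F i)] (A : ∀ i, PF (F i)) :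
    aut (mkT (join A)) = (∏ t ∈ Finset.univ.image (fun i => mkT (A i)), (Fintype.card {i // mkT (A i) = t}).factorial) *
      ∏ i, aut (mkT (A i)) := by
  rw [aut_mkT, ← Nat.card_congr (Equiv.ofBijective _ (joinMap_bij A A))]
  let c : I → PT := fun i => mkT (A i)
  have h1 : (∑ e : Equiv.Perm I, ∏ i, Nat.card (Iso (A i) (A (e i)))) = ∑ e : Equiv.Perm I, if c ∘ e = c then ∏ i, aut (c i) else 0 := by
    apply Finset.sum_congr rfl
    intro e _
    split_ifs with h
    · apply Finset.prod_congr rfl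
      intro i _
      have := congrFun h i
      simp only [Function.comp, c] at this
      rw [mkT_eq] at this
      obtain ⟨a⟩ := this
      simp only [c]
      rw [aut_mkT]
      exact Nat.card_congr (isoCongr (Iso.refl _) a)
    · have : ∃ i, ¬ c (e i) = c i := by
        by_contra h'
        push Not at h'
        exact h (funext h')
      obtain ⟨i, hi⟩ := this
      apply Finset.prod_eq_zero (Finset.mem_univ i)
      have : IsEmpty (Iso (A i) (A (e i))) := by
        rw [← not_nonempty_iff, ← mkT_eq]
        exact fun h => hi h.symm
      exact Nat.card_of_isEmpty
  rw [Nat.card_sigma]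
  simp only [Nat.card_pi]
  rw [h1, ← Finset.sum_filter, Finset.sum_const, smul_eq_mul]
  congr 1
  rw [← DomMulAct.stabilizer_card' c, Fintype.card_subtype]

noncomputable def sys : PSys PT where
  sz T := T.1
  F T := Real.log (aut T)
  e := decE
  lvl n := Finset.univ.map ⟨fun q : Polya n => (⟨n, q⟩ : PT), sigma_mk_injective⟩
  mem_lvl n T := by
    obtain ⟨k, q⟩ := T
    simp
    constructor
    · rintro ⟨h, a⟩; exact h.symm
    · rintro rfl; exact ⟨rfl, q, HEq.rfl⟩
  sz_eq T := by
    obtain ⟨m, rfl⟩ := decE.symm.surjective T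
    rw [Equiv.apply_symm_apply]
    have h : decE.symm m = mkT (join (fun i : fI m => rep i.1.1)) := by
      rw [Equiv.symm_apply_eq]; exact (dec_mk m).symm
    rw [h, mkT_fst, Finite.card_option, Nat.card_sigma]
    have := prod_fI m (M := Multiplicative ℕ) (fun t => Multiplicative.ofAdd t.1)
    have h2 := congrArg Multiplicative.toAdd this
    simp [Finsupp.prod, toAdd_prod] at h2
    simp [Finsupp.sum]
    rw [add_comm]
    congr 1
  F_eq T := by
    obtain ⟨m, rfl⟩ := decE.symm.surjective T
    rw [Equiv.apply_symm_apply]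
    have h : decE.symm m = mkT (join (fun i : fI m => rep i.1.1)) := by
      rw [Equiv.symm_apply_eq]; exact (dec_mk m).symm
    rw [h, aut_join]
    simp only [mkT_rep]
    rw [prod_fI m aut]
    have h3 : ∀ t, Nat.card {i : fI m // i.1.1 = t} = m t := by
      intro t
      rw [← sum_single_apply (fun i : fI m => i.1.1), fI_sum]
    simp only [Fintype.card_eq_nat_card, h3]
    have h4 : Finset.univ.image (fun i : fI m => i.1.1) = m.support := by
      ext t
      simp only [Finset.mem_image, Finset.mem_univ, true_and, Finsupp.mem_support_iff]
      rw [← h3 t]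
      constructor
      · rintro ⟨i, hi⟩
        haveI : Nonempty {i : fI m // i.1.1 = t} := ⟨⟨i, hi⟩⟩
        exact Nat.card_pos.ne'
      · intro hne
        obtain ⟨i⟩ := (Nat.card_pos_iff.mp (Nat.pos_of_ne_zero hne)).1
        exact ⟨i.1, i.2⟩
    rw [h4]
    push_cast
    rw [Finsupp.prod, Real.log_mul, Real.log_prod, Real.log_prod, Finsupp.sum, ← Finset.sum_add_distrib]
    · simp
    · intro t _; have := aut_pos t; positivity
    · intro t _; positivity
    · exact Finset.prod_ne_zero_iff.mpr fun t _ => by positivity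
    · exact Finset.prod_ne_zero_iff.mpr fun t _ => by have := aut_pos t; positivity

theorem sys_sum (logL : ∀ n : ℕ, Polya n → ℝ)
    (hlogL : ∀ (n : ℕ) (T : RTree n),
      logL n (Quot.mk _ T) = Real.log ((n.factorial : ℝ) / (T.autCard : ℝ)))
    (n : ℕ) {M : Type} [AddCommMonoid M] (g : ℝ → M) :
    ∑ q : Polya n, g (logL n q) = ∑ T ∈ sys.lvl n, g (Real.log n.factorial - sys.F T) := by
  unfold sys
  rw [Finset.sum_map]
  apply Finset.sum_congr rfl
  intro q _
  congr 1
  induction q using Quot.ind with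
  | mk t =>
    rw [hlogL, autCard_eq]
    simp
    rw [Real.log_div (by positivity) (by have := aut_pos ⟨n, Quot.mk _ t⟩; positivity)]

theorem sys_card (n : ℕ) : (sys.lvl n).card = Nat.card (Polya n) := by
  simp [sys]

end PF

namespace TF
open PowerSeries

theorem abel_zero (n : ℕ) :
    ∑ k ∈ Finset.range (n + 2), ((n + 1).choose k : ℝ) * (((k : ℝ) + 1) ^ k / (k + 1)) *
      (-((k : ℝ) + 1)) ^ (n + 1 - k) = 0 := by
  have h := congrFun (fwdDiff_iter_pow_eq_zero_of_lt (R := ℝ) (show n < n + 1 by omega)) 1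
  rw [fwdDiff_iter_eq_sum_shift] at h
  simp only [Pi.zero_apply] at h
  rw [← h]
  apply Finset.sum_congr rfl
  intro k hk
  have hk' : k ≤ n + 1 := by simp at hk; omega
  have h0 : ((k : ℝ) + 1) ≠ 0 := by positivity
  have h2 : ((k : ℝ) + 1) ^ k * (k + 1) ^ (n + 1 - k) = (k + 1) ^ n * (k + 1) := by
    rw [← pow_add, ← pow_succ]; congr 1; omega
  rw [neg_eq_neg_one_mul ((k : ℝ) + 1), mul_pow]
  simp
  rw [add_comm (1 : ℝ) (k : ℝ), eq_comm, ← mul_left_inj' h0]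
  rw [show ((n + 1).choose k : ℝ) * (((k : ℝ) + 1) ^ k / (k + 1)) * ((-1) ^ (n + 1 - k) * ((k : ℝ) + 1) ^ (n + 1 - k)) * (k + 1) = ((n + 1).choose k : ℝ) * ((k : ℝ) + 1) ^ k * ((-1) ^ (n + 1 - k) * ((k : ℝ) + 1) ^ (n + 1 - k)) by field_simp]
  linear_combination (-1 : ℝ) *  (n + 1).choose k * (-1 : ℝ) ^ (n + 1 - k) * h2

noncomputable def ab (n : ℕ) (y : ℝ) : ℝ :=
  ∑ k ∈ Finset.range (n + 1), (n.choose k : ℝ) * (((k : ℝ) + 1) ^ k / (k + 1)) * (y + (n - k : ℕ)) ^ (n - k)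

theorem abel (n : ℕ) : ∀ y : ℝ, ab n y = (y + n + 1) ^ n := by
  induction n with
  | zero => intro y; simp [ab]
  | succ n ih =>
    have hd : ∀ y, HasDerivAt (ab (n + 1)) ((n + 1) * ab n (y + 1)) y := by
      intro y
      unfold ab
      have : ∀ k ∈ Finset.range (n + 2), HasDerivAt (fun y : ℝ => ((n + 1).choose k : ℝ) * (((k : ℝ) + 1) ^ k / (k + 1)) * (y + (n + 1 - k : ℕ)) ^ (n + 1 - k))
        (((n + 1).choose k : ℝ) * (((k : ℝ) + 1) ^ k / (k + 1)) * ((n + 1 - k : ℕ) * (y + (n + 1 - k : ℕ)) ^ (n + 1 - k - 1))) y := by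
        intro k _
        have h1 : HasDerivAt (fun y : ℝ => y + (n + 1 - k : ℕ)) 1 y := (hasDerivAt_id y).add_const _
        have h2 := (h1.pow (n + 1 - k)).const_mul (((n + 1).choose k : ℝ) * (((k : ℝ) + 1) ^ k / (k + 1)))
        simpa using h2
      have h3 := HasDerivAt.fun_sum this
      refine h3.congr_deriv ?_
      symm
      rw [Finset.sum_range_succ _ (n + 1)]
      simp only [Nat.sub_self, Nat.cast_zero, zero_mul, mul_zero, add_zero]
      rw [Finset.mul_sum]
      apply Finset.sum_congr rfl
      intro k hk
      have hk' : k ≤ n := by simp at hk; omega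
      have h4 : ((n + 1).choose k : ℝ) * (n + 1 - k : ℕ) = (n + 1) * n.choose k := by
        have := Nat.choose_mul_succ_eq n k
        have h5 : ((n.choose k * (n + 1) : ℕ) : ℝ) = ((n + 1).choose k * (n + 1 - k) : ℕ) := by rw [this]
        push_cast at h5
        linarith
      have e1 : n + 1 - k - 1 = n - k := by omega
      have e2 : y + ((n + 1 - k : ℕ) : ℝ) = y + 1 + (n - k : ℕ) := by
        rw [show n + 1 - k = (n - k) + 1 by omega]; push_cast; ring
      rw [e1, e2]
      linear_combination -(((k : ℝ) + 1) ^ k / (k + 1)) * (y + 1 + ((n - k : ℕ) : ℝ)) ^ (n - k) * h4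
    have hd2 : ∀ y, HasDerivAt (fun y => ab (n + 1) y - (y + (n + 1 : ℕ) + 1) ^ (n + 1)) 0 y := by
      intro y
      have h1 : HasDerivAt (fun y : ℝ => y + (n + 1 : ℕ) + 1) 1 y := ((hasDerivAt_id y).add_const _).add_const _
      refine ((hd y).sub (h1.pow (n + 1))).congr_deriv ?_
      rw [ih]
      push_cast
      simp
      ring
    have hc := is_const_of_deriv_eq_zero (fun y => (hd2 y).differentiableAt) (fun y => (hd2 y).deriv)
    intro y
    have h0 := hc y (-(n + 2))
    have h1 : ab (n + 1) (-(n + 2)) = 0 := by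
      rw [← abel_zero n]
      unfold ab
      apply Finset.sum_congr rfl
      intro k hk
      have hk' : k ≤ n + 1 := by simp at hk; omega
      congr 2
      rw [Nat.cast_sub hk']
      push_cast; ring
    rw [h1] at h0
    have h2 : (-((n : ℝ) + 2) + ((n + 1 : ℕ) : ℝ) + 1) = 0 := by push_cast; ring
    rw [h2] at h0
    simp at h0
    push_cast
    linarith

/-- coefficients of the tree function -/
noncomputable def tc (k : ℕ) : ℝ := (k : ℝ) ^ k / (k * k.factorial)
noncomputable def ec (k : ℕ) : ℝ := ((k : ℝ) + 1) ^ k / ((k + 1) * k.factorial)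

theorem tc_zero : tc 0 = 0 := by simp [tc]
theorem tc_succ (k : ℕ) : tc (k + 1) = ec k := by
  unfold tc ec
  have : ((k + 1).factorial : ℝ) = (k + 1) * k.factorial := by rw [Nat.factorial_succ]; push_cast; ring
  rw [this]
  push_cast
  rw [pow_succ]
  have h : (k : ℝ) + 1 ≠ 0 := by positivity
  field_simp

theorem ec_rec (n : ℕ) : (n + 1) * ec (n + 1) =
    ∑ k ∈ Finset.range (n + 1), ec k * (((n - k : ℕ) + 1) * tc (n - k + 1)) := by
  have h := abel n 1
  unfold ab at h
  have hf : ((n + 1).factorial : ℝ) = (n + 1) * n.factorial := by rw [Nat.factorial_succ]; push_cast; ring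
  have h1 : (n + 1) * ec (n + 1) = (1 + (n : ℝ) + 1) ^ n / n.factorial := by
    unfold ec
    rw [hf]
    push_cast
    have : (n : ℝ) + 1 + 1 ≠ 0 := by positivity
    have : (n : ℝ) + 1 ≠ 0 := by positivity
    field_simp
    ring
  rw [h1, ← h, Finset.sum_div]
  apply Finset.sum_congr rfl
  intro k hk
  have hk' : k ≤ n := by simp at hk; omega
  rw [tc_succ]
  unfold ec
  have h5 := Nat.choose_mul_factorial_mul_factorial hk'
  have h6 : (n.choose k : ℝ) = n.factorial / (k.factorial * (n - k).factorial) := by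
    rw [← h5]; push_cast; field_simp
  rw [h6]
  have : (k : ℝ) + 1 ≠ 0 := by positivity
  have : ((n - k : ℕ) : ℝ) + 1 ≠ 0 := by positivity
  field_simp
  ring

noncomputable def tauS (R : Type) [CommRing R] [Algebra ℝ R] : R⟦X⟧ := mk fun k => algebraMap ℝ R (tc k)
noncomputable def epsS (R : Type) [CommRing R] [Algebra ℝ R] : R⟦X⟧ := mk fun k => algebraMap ℝ R (ec k)

variable {R : Type} [CommRing R] [Algebra ℝ R]

theorem tau_eq : tauS R = X * epsS R := by
  ext n
  cases n with
  | zero => simp [tauS, tc_zero]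
  | succ n => simp [tauS, epsS, coeff_succ_X_mul, tc_succ]

theorem eps_der : d⁄dX R (epsS R) = epsS R * d⁄dX R (tauS R) := by
  ext n
  rw [coeff_mul, coeff_derivative, Finset.Nat.sum_antidiagonal_eq_sum_range_succ_mk]
  simp only [coeff_derivative, epsS, tauS, coeff_mk]
  have := congrArg (algebraMap ℝ R) (ec_rec n)
  simp only [map_mul, map_sum, map_add, map_one, map_natCast] at this
  rw [mul_comm, this]
  apply Finset.sum_congr rfl
  intro k _
  ring

theorem nat_cancel (n : ℕ) {a b : R} (h : a * ((n : R) + 1) = b * (n + 1)) : a = b := by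
  have hu : ((n : R) + 1) * algebraMap ℝ R (((n : ℝ) + 1)⁻¹) = 1 := by
    have : ((n : R) + 1) = algebraMap ℝ R ((n : ℝ) + 1) := by simp
    rw [this, ← map_mul, mul_inv_cancel₀ (by positivity), map_one]
  calc a = a * ((n : R) + 1) * algebraMap ℝ R (((n : ℝ) + 1)⁻¹) := by rw [mul_assoc, hu, mul_one]
    _ = b := by rw [h, mul_assoc, hu, mul_one]

theorem ode_unique {Z D P Q : R⟦X⟧} (hZ0 : constantCoeff Z = 1) (hD0 : constantCoeff D = 1)
    (hZ : d⁄dX R Z = Z * d⁄dX R P) (hD : d⁄dX R D = D * d⁄dX R Q) (n : ℕ)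
    (h : ∀ m ≤ n, coeff m P = coeff m Q) : ∀ m ≤ n, coeff m Z = coeff m D := by
  intro m
  induction m using Nat.strong_induction_on with
  | _ m ih =>
    intro hm
    cases m with
    | zero => simpa [hZ0] using hD0.symm
    | succ m =>
      apply nat_cancel m
      rw [← coeff_derivative, ← coeff_derivative, hZ, hD, coeff_mul, coeff_mul]
      apply Finset.sum_congr rfl
      rintro ⟨i, j⟩ hij
      simp at hij
      simp only [coeff_derivative]
      rw [ih i (by omega) (by omega), h (j + 1) (by omega)]

theorem tree_unique {ψ Z P : R⟦X⟧} (N : ℕ) (hψ : constantCoeff ψ = 0) (hZ0 : constantCoeff Z = 1)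
    (hZ : d⁄dX R Z = Z * d⁄dX R P) (h : ∀ n ≤ N, coeff n P = coeff n (ψ * Z)) (n : ℕ) (hn : n ≤ N) :
    coeff n P = ∑ k ∈ Finset.range (n + 1), algebraMap ℝ R (tc k) * coeff n (ψ ^ k) := by
  have hs : HasSubst ψ := HasSubst.of_constantCoeff_zero' hψ
  set Q := (tauS R).subst ψ with hQ
  set D := (epsS R).subst ψ with hD
  have h1 : Q = ψ * D := by
    rw [hQ, tau_eq, subst_mul hs, subst_X hs]
  have h2 : d⁄dX R D = D * d⁄dX R Q := by
    rw [hD, hQ, derivative_subst hs, derivative_subst hs, eps_der, subst_mul hs, mul_assoc]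
  have hz : ∀ k n, n < k → coeff n (ψ ^ k) = 0 := by
    intro k n hnk
    apply coeff_of_lt_order
    refine lt_of_lt_of_le ?_ (le_order_pow_of_constantCoeff_eq_zero k hψ)
    exact_mod_cast hnk
  have cs : ∀ (f : R⟦X⟧) n, coeff n (f.subst ψ) = ∑ k ∈ Finset.range (n + 1), coeff k f * coeff n (ψ ^ k) := by
    intro f n
    rw [coeff_subst' hs]
    rw [finsum_eq_sum_of_support_subset (s := Finset.range (n + 1))]
    · simp only [smul_eq_mul]
    · intro k hk
      by_contra hk'
      simp at hk'
      apply hk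
      simp [hz k n (by omega)]
  have hD0 : constantCoeff D = 1 := by
    have := cs (epsS R) 0
    simp [epsS, ec] at this
    exact this
  have hPQ : ∀ n ≤ N, coeff n P = coeff n Q := by
    intro n
    induction n using Nat.strong_induction_on with
    | _ n ih =>
      intro hn
      rw [h n hn, h1, coeff_mul, coeff_mul]
      apply Finset.sum_congr rfl
      rintro ⟨i, j⟩ hij
      simp at hij
      cases i with
      | zero => simp [hψ]
      | succ i =>
        simp only
        rw [ode_unique hZ0 hD0 hZ h2 j (fun m hm => ih m (by omega) (by omega)) j le_rfl]
  rw [hPQ n hn, hQ, cs]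
  simp [tauS]

end TF

namespace PSys
open PowerSeries

section gf
variable {𝒯 : Type} (S : PSys 𝒯)

theorem sz_pos (T : 𝒯) : 0 < S.sz T := by rw [S.sz_eq]; omega
theorem sz_ne (T : 𝒯) : S.sz T ≠ 0 := (S.sz_pos T).ne'

theorem sz_lt {T t : 𝒯} (h : S.e T t ≠ 0) : S.e T t * S.sz t < S.sz T := by
  have h1 := S.sz_eq T
  have : S.e T t * S.sz t ≤ (S.e T).sum (fun t m => m * S.sz t) :=
    Finset.single_le_sum (f := fun t => S.e T t * S.sz t) (fun i _ => Nat.zero_le _) (Finsupp.mem_support_iff.2 h)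
  omega

theorem sz_lt' {T t : 𝒯} (h : S.e T t ≠ 0) : S.sz t < S.sz T :=
  lt_of_le_of_lt (Nat.le_mul_of_pos_left _ (Nat.pos_of_ne_zero h)) (S.sz_lt h)

noncomputable def upto (N : ℕ) : Finset 𝒯 := (Finset.range (N + 1)).biUnion S.lvl
theorem mem_upto {N : ℕ} {T : 𝒯} : T ∈ S.upto N ↔ S.sz T ≤ N := by
  simp [upto, S.mem_lvl, Nat.lt_succ_iff]

theorem disj_lvl {m n : ℕ} (h : m ≠ n) : Disjoint (S.lvl m) (S.lvl n) := by
  rw [Finset.disjoint_left]; intro T h1 h2; rw [S.mem_lvl] at h1 h2; omega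

theorem sum_upto {M : Type*} [AddCommMonoid M] (N : ℕ) (f : 𝒯 → M) :
    ∑ T ∈ S.upto N, f T = ∑ n ∈ Finset.range (N + 1), ∑ T ∈ S.lvl n, f T :=
  Finset.sum_biUnion (fun _ _ _ _ h => S.disj_lvl h)

variable {R : Type} [CommRing R] [Algebra ℝ R] [Algebra ℚ R] (E : Multiplicative ℝ →* R)

noncomputable def qS : R⟦X⟧ := PowerSeries.mk fun m => E (Multiplicative.ofAdd (Real.log (m.factorial : ℝ)))
noncomputable def w (T : 𝒯) : R := E (Multiplicative.ofAdd (S.F T))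
noncomputable def betaS : R⟦X⟧ := qS E * rescale (-1) (exp R)
noncomputable def gT (T : 𝒯) : R⟦X⟧ := expand (S.sz T) (S.sz_ne T) (rescale (S.w E T) (qS E))
noncomputable def hT (T : 𝒯) : R⟦X⟧ := expand (S.sz T) (S.sz_ne T) (rescale (S.w E T) (exp R))
noncomputable def bT (T : 𝒯) : R⟦X⟧ := expand (S.sz T) (S.sz_ne T) (rescale (S.w E T) (betaS E))

theorem bh (T : 𝒯) : S.bT E T * S.hT E T = S.gT E T := by
  unfold bT hT gT betaS
  rw [← map_mul, ← map_mul, mul_assoc]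
  have := exp_mul_exp_eq_exp_add (-1 : R) 1
  simp at this
  have h1 : (rescale (-1) (exp R)) * exp R = 1 := by
    have h := exp_mul_exp_neg_eq_one (A := R)
    rw [mul_comm]; exact h
  rw [h1, mul_one]

theorem coeff_gT (T : 𝒯) (n : ℕ) : coeff n (S.gT E T) =
    if S.sz T ∣ n then E (Multiplicative.ofAdd (Real.log ((n / S.sz T).factorial : ℝ) + (n / S.sz T : ℕ) * S.F T)) else 0 := by
  unfold gT
  rw [coeff_expand]
  split_ifs with h
  · rw [coeff_rescale, qS, coeff_mk, w, ← map_pow, ← map_mul, mul_comm, ← ofAdd_nsmul, ← ofAdd_add, nsmul_eq_mul]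
  · rfl

theorem claim1 (N n : ℕ) (hn : n ≤ N) :
    coeff n (∏ T ∈ S.upto N, S.gT E T) = ∑ T ∈ S.lvl (n + 1), S.w E T := by
  rw [coeff_prod]
  symm
  have hl : ∀ T0 : 𝒯, ∀ T : 𝒯, S.e T0 T * S.sz T ≠ 0 → T ∈ (S.e T0).support := by
    intro T0 T h
    rw [Finsupp.mem_support_iff]; intro h0; simp [h0] at h
  have key : ∀ T0 ∈ S.lvl (n + 1), (S.e T0).support ⊆ S.upto N := by
    intro T0 h0 T hT
    rw [S.mem_lvl] at h0
    rw [mem_upto]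
    have := S.sz_lt' (Finsupp.mem_support_iff.1 hT)
    omega
  refine Finset.sum_of_injOn (fun T0 => Finsupp.onFinset (S.e T0).support (fun T => S.e T0 T * S.sz T) (hl T0)) ?_ ?_ ?_ ?_
  · intro T1 _ T2 _ h
    apply S.e.injective
    ext T
    have := DFunLike.congr_fun h T
    simp only [Finsupp.onFinset_apply] at this
    exact Nat.eq_of_mul_eq_mul_right (S.sz_pos T) this
  · intro T0 h0
    simp only [Finset.mem_coe] at h0 ⊢
    have h2 := key T0 h0
    rw [S.mem_lvl] at h0
    rw [Finset.mem_finsuppAntidiag]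
    refine ⟨?_, ?_⟩
    · have h1 := S.sz_eq T0
      rw [← Finset.sum_subset h2]
      · simp only [Finsupp.onFinset_apply]
        have : ∑ x ∈ (S.e T0).support, S.e T0 x * S.sz x = (S.e T0).sum (fun t m => m * S.sz t) := rfl
        rw [this]; omega
      · intro T _ hT
        simp at hT
        simp [hT]
    · exact (Finsupp.support_onFinset_subset).trans h2
  · intro l hl' hni
    rw [Finset.mem_finsuppAntidiag] at hl'
    by_contra hne
    apply hni
    have hd : ∀ T, S.sz T ∣ l T := by
      intro T
      by_contra hnd
      have hT : T ∈ S.upto N := by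
        apply hl'.2
        rw [Finsupp.mem_support_iff]
        intro h0; rw [h0] at hnd; exact hnd (dvd_zero _)
      apply hne
      apply Finset.prod_eq_zero hT
      rw [coeff_gT, if_neg hnd]
    let m : 𝒯 →₀ ℕ := Finsupp.onFinset l.support (fun T => l T / S.sz T) (by
      intro T h; rw [Finsupp.mem_support_iff]; intro h0; simp [h0] at h)
    have hm : ∀ T, m T * S.sz T = l T := fun T => Nat.div_mul_cancel (hd T)
    refine ⟨S.e.symm m, ?_, ?_⟩
    · rw [Finset.mem_coe, S.mem_lvl, S.sz_eq, Equiv.apply_symm_apply]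
      have : m.sum (fun t m => m * S.sz t) = n := by
        rw [← hl'.1]
        rw [Finsupp.sum_of_support_subset m (s := S.upto N)]
        · exact Finset.sum_congr rfl (fun T _ => hm T)
        · exact (Finsupp.support_onFinset_subset).trans hl'.2
        · simp
      omega
    · ext T
      simp only [Finsupp.onFinset_apply, Equiv.apply_symm_apply]
      exact hm T
  · intro T0 h0
    have h2 := key T0 h0
    rw [← Finset.prod_subset h2]
    · simp only [Finsupp.onFinset_apply]
      unfold w
      rw [S.F_eq, Finsupp.sum, ofAdd_sum, map_prod]
      apply Finset.prod_congr rfl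
      intro T _
      rw [coeff_gT, if_pos (Dvd.intro_left _ rfl), Nat.mul_div_cancel _ (S.sz_pos T)]
    · intro T _ hT
      simp at hT
      simp only [Finsupp.onFinset_apply, hT, coeff_gT]
      simp

theorem der_expand (s : ℕ) (hs : s ≠ 0) (f : R⟦X⟧) : d⁄dX R (expand s hs f) = expand s hs (d⁄dX R f) * d⁄dX R (X ^ s) := by
  rw [expand_apply, expand_apply, derivative_subst]
  exact HasSubst.X_pow hs

theorem der_resc (a : R) : d⁄dX R (rescale a (exp R)) = C a * rescale a (exp R) := by
  have h := derivative_exp R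
  ext n
  have h1 := congrArg (coeff n) h
  rw [coeff_derivative] at h1
  rw [coeff_derivative, coeff_C_mul, coeff_rescale, coeff_rescale, ← h1]
  ring

theorem der_hT (T : 𝒯) : d⁄dX R (S.hT E T) = S.hT E T * d⁄dX R (C (S.w E T) * X ^ S.sz T) := by
  unfold hT
  rw [der_expand, der_resc, map_mul, expand_C, Derivation.leibniz]
  simp [smul_eq_mul]
  ring

theorem der_prod (s : Finset 𝒯) : d⁄dX R (∏ T ∈ s, S.hT E T) =
    (∏ T ∈ s, S.hT E T) * d⁄dX R (∑ T ∈ s, C (S.w E T) * X ^ S.sz T) := by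
  induction s using Finset.induction_on with
  | empty => simp
  | insert a s ha ih =>
    rw [Finset.prod_insert ha, Finset.sum_insert ha, Derivation.leibniz, ih, der_hT, map_add]
    simp only [smul_eq_mul]
    ring

noncomputable def psiN (N : ℕ) : R⟦X⟧ := X * ∏ T ∈ S.upto N, S.bT E T
noncomputable def psi : R⟦X⟧ := PowerSeries.mk fun n => coeff n (S.psiN E n)

theorem cc_hT (T : 𝒯) : constantCoeff (S.hT E T) = 1 := by
  unfold hT
  rw [constantCoeff_expand]
  rw [← coeff_zero_eq_constantCoeff_apply, coeff_rescale]
  simp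

theorem identN (N n : ℕ) (hn : n ≤ N) : ∑ T ∈ S.lvl n, S.w E T =
    ∑ k ∈ Finset.range (n + 1), algebraMap ℝ R (TF.tc k) * coeff n (S.psiN E N ^ k) := by
  have hP : ∀ n ≤ N, coeff n (∑ T ∈ S.upto N, C (S.w E T) * X ^ S.sz T) = ∑ T ∈ S.lvl n, S.w E T := by
    intro n hn
    rw [map_sum]
    symm
    apply Finset.sum_subset_zero_on_sdiff
    · intro T hT
      rw [S.mem_lvl] at hT; rw [mem_upto]; omega
    · intro T hT
      simp only [Finset.mem_sdiff, S.mem_lvl] at hT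
      rw [coeff_C_mul, coeff_X_pow, if_neg (fun h => hT.2 h.symm), mul_zero]
    · intro T hT
      rw [S.mem_lvl] at hT
      rw [coeff_C_mul, coeff_X_pow, if_pos hT.symm, mul_one]
  rw [← hP n hn]
  refine TF.tree_unique (R := R) (ψ := S.psiN E N) (Z := ∏ T ∈ S.upto N, S.hT E T) N ?_ ?_ (S.der_prod E _) ?_ n hn
  · simp [psiN]
  · rw [map_prod]; exact Finset.prod_eq_one (fun T _ => S.cc_hT E T)
  · intro n hn
    rw [hP n hn, psiN, mul_assoc, ← Finset.prod_mul_distrib]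
    simp only [bh]
    cases n with
    | zero =>
      simp
      apply Finset.sum_eq_zero
      intro T hT; rw [S.mem_lvl] at hT; exact absurd hT (S.sz_ne T)
    | succ n =>
      rw [coeff_succ_X_mul, claim1 S E N n (by omega)]

theorem beta0 : coeff 0 (betaS E) = 1 := by
  rw [betaS, coeff_mul]; simp [qS]
theorem beta1 : coeff 1 (betaS E) = 0 := by
  rw [betaS, coeff_mul]
  simp [Finset.antidiagonal, qS]
  simp [Finset.Nat.antidiagonal_succ, coeff_rescale, coeff_exp]

theorem bT_zero (T : 𝒯) : coeff 0 (S.bT E T) = 1 := by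
  unfold bT; rw [coeff_expand]; simp [beta0, coeff_rescale]

theorem bT_lt (T : 𝒯) (n : ℕ) (h0 : n ≠ 0) (h : n < 2 * S.sz T) : coeff n (S.bT E T) = 0 := by
  unfold bT; rw [coeff_expand]
  split_ifs with hd
  · obtain ⟨c, rfl⟩ := hd
    have hc : c = 1 := by
      have h1 := S.sz_pos T
      have : c < 2 := by
        by_contra hh; push Not at hh; nlinarith
      have : c ≠ 0 := by rintro rfl; simp at h0
      omega
    subst hc
    rw [mul_one, Nat.div_self (S.sz_pos T), coeff_rescale, beta1, mul_zero]
  · rfl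

theorem psiN_stab (N M : ℕ) (hNM : N ≤ M) (n : ℕ) (hn : n ≤ N) : coeff n (S.psiN E M) = coeff n (S.psiN E N) := by
  have hsub : S.upto N ⊆ S.upto M := by
    intro T; rw [mem_upto, mem_upto]; omega
  have hd : (X : R⟦X⟧) ^ (N + 1) ∣ (∏ T ∈ S.upto M \ S.upto N, S.bT E T) - 1 := by
    apply Finset.prod_induction _ (fun f => (X : R⟦X⟧) ^ (N + 1) ∣ f - 1)
    · intro a b ha hb
      have : a * b - 1 = (a - 1) * b + (b - 1) := by ring
      rw [this]; exact dvd_add (ha.mul_right _) hb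
    · simp
    · intro T hT
      simp only [Finset.mem_sdiff, mem_upto] at hT
      rw [X_pow_dvd_iff]
      intro m hm
      rcases Nat.eq_zero_or_pos m with rfl | h
      · rw [map_sub, bT_zero]; simp
      · rw [map_sub, bT_lt S E T m h.ne' (by omega), coeff_one, if_neg h.ne', sub_zero]
  have : (X : R⟦X⟧) ^ (N + 1) ∣ S.psiN E M - S.psiN E N := by
    unfold psiN
    rw [← Finset.prod_sdiff hsub]
    have : X * ((∏ T ∈ S.upto M \ S.upto N, S.bT E T) * ∏ T ∈ S.upto N, S.bT E T) - X * ∏ T ∈ S.upto N, S.bT E T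
      = ((∏ T ∈ S.upto M \ S.upto N, S.bT E T) - 1) * (X * ∏ T ∈ S.upto N, S.bT E T) := by ring
    rw [this]
    exact hd.mul_right _
  rw [X_pow_dvd_iff] at this
  have := this n (by omega)
  rw [map_sub] at this
  exact sub_eq_zero.1 this

theorem psi_coeff {n N : ℕ} (h : n ≤ N) : coeff n (S.psi E) = coeff n (S.psiN E N) := by
  rw [psi, coeff_mk, S.psiN_stab E n N h n le_rfl]

theorem ident (n : ℕ) : ∑ T ∈ S.lvl n, S.w E T =
    ∑ k ∈ Finset.range (n + 1), algebraMap ℝ R (TF.tc k) * coeff n (S.psi E ^ k) := by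
  rw [S.identN E n n le_rfl]
  apply Finset.sum_congr rfl
  intro k _
  congr 1
  have h : (X : R⟦X⟧) ^ (n + 1) ∣ S.psiN E n - S.psi E := by
    rw [X_pow_dvd_iff]
    intro m hm
    rw [map_sub, S.psi_coeff E (show m ≤ n by omega), sub_self]
  have := h.trans (sub_dvd_pow_sub_pow _ _ k)
  rw [X_pow_dvd_iff] at this
  have := this n (by omega)
  rw [map_sub] at this
  exact sub_eq_zero.1 this

theorem psi_zero : coeff 0 (S.psi E) = 0 := by rw [psi, coeff_mk, psiN]; simp
theorem psi_one : coeff 1 (S.psi E) = 1 := by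
  rw [psi, coeff_mk, psiN, show (1 : ℕ) = 0 + 1 from rfl, coeff_succ_X_mul]
  rw [coeff_zero_eq_constantCoeff_apply, map_prod]
  exact Finset.prod_eq_one (fun T _ => by rw [← coeff_zero_eq_constantCoeff_apply]; exact S.bT_zero E T)

end gf
end PSys

namespace PSys
open PowerSeries
open scoped ENNReal

section ev

theorem ev_conv (x : ℝ≥0∞) (f g : ℕ → ℝ≥0∞) :
    ∑' n, (∑ p ∈ Finset.HasAntidiagonal.antidiagonal n, f p.1 * g p.2) * x ^ n = (∑' n, f n * x ^ n) * ∑' n, g n * x ^ n := by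
  rw [← ENNReal.tsum_mul_right]
  simp_rw [← ENNReal.tsum_mul_left]
  rw [← ENNReal.tsum_prod (f := fun a b => f a * x ^ a * (g b * x ^ b))]
  rw [← Finset.HasAntidiagonal.sigmaAntidiagonalEquivProd.tsum_eq]
  rw [ENNReal.tsum_sigma']
  congr 1; ext n
  rw [tsum_fintype, Finset.sum_mul, ← Finset.sum_attach (Finset.HasAntidiagonal.antidiagonal n)]
  apply Finset.sum_congr rfl
  rintro ⟨⟨a, b⟩, h⟩ _
  rw [Finset.HasAntidiagonal.mem_antidiagonal] at h
  simp only [Finset.HasAntidiagonal.sigmaAntidiagonalEquivProd_apply]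
  rw [← h]; simp only; ring

variable {R : Type} [CommRing R]

structure SM (N : R → ℝ≥0∞) : Prop where
  zero : N 0 = 0
  one : N 1 ≤ 1
  add : ∀ a b, N (a + b) ≤ N a + N b
  mul : ∀ a b, N (a * b) ≤ N a * N b

theorem SM.sum {N : R → ℝ≥0∞} (h : SM N) {ι : Type*} (s : Finset ι) (f : ι → R) : N (∑ i ∈ s, f i) ≤ ∑ i ∈ s, N (f i) :=
  Finset.le_sum_of_subadditive N h.zero.le h.add s f

noncomputable def nv (N : R → ℝ≥0∞) (x : ℝ≥0∞) (F : R⟦X⟧) : ℝ≥0∞ := ∑' n, N (coeff n F) * x ^ n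

theorem nv_mul {N : R → ℝ≥0∞} (h : SM N) (x : ℝ≥0∞) (F G : R⟦X⟧) : nv N x (F * G) ≤ nv N x F * nv N x G := by
  unfold nv
  rw [← ev_conv]
  apply ENNReal.tsum_le_tsum
  intro n
  gcongr
  rw [coeff_mul]
  refine (h.sum _ _).trans (Finset.sum_le_sum fun p _ => h.mul _ _)

theorem nv_one {N : R → ℝ≥0∞} (h : SM N) (x : ℝ≥0∞) : nv N x 1 ≤ 1 := by
  unfold nv
  rw [tsum_eq_single 0]
  · simpa using h.one
  · intro n hn; rw [coeff_one, if_neg hn, h.zero, zero_mul]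

theorem nv_X {N : R → ℝ≥0∞} (h : SM N) (x : ℝ≥0∞) : nv N x X ≤ x := by
  unfold nv
  rw [tsum_eq_single 1]
  · simpa using mul_le_mul_left (h.one) x
  · intro n hn; rw [coeff_X, if_neg hn, h.zero, zero_mul]

theorem nv_prod {N : R → ℝ≥0∞} (h : SM N) (x : ℝ≥0∞) {ι : Type*} (s : Finset ι) (F : ι → R⟦X⟧) :
    nv N x (∏ i ∈ s, F i) ≤ ∏ i ∈ s, nv N x (F i) := by
  induction s using Finset.induction_on with
  | empty => simpa using nv_one h x
  | insert a s ha ih =>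
    rw [Finset.prod_insert ha, Finset.prod_insert ha]
    exact (nv_mul h x _ _).trans (by gcongr)

theorem nv_expand {N : R → ℝ≥0∞} (h : N 0 = 0) (x : ℝ≥0∞) (s : ℕ) (hs : s ≠ 0) (F : R⟦X⟧) :
    nv N x (expand s hs F) = ∑' m, N (coeff m F) * x ^ (s * m) := by
  unfold nv
  rw [← Function.Injective.tsum_eq (g := fun m => s * m) (fun a b hab => Nat.eq_of_mul_eq_mul_left (Nat.pos_of_ne_zero hs) hab)]
  · simp only [coeff_expand_mul]
  · intro n hn
    rw [Function.mem_support] at hn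
    by_contra hh
    apply hn
    rw [coeff_expand, if_neg, h, zero_mul]
    rintro ⟨c, rfl⟩
    exact hh ⟨c, rfl⟩

/-- exactness for nonnegative real series -/
def NN (F : ℝ⟦X⟧) : Prop := ∀ n, 0 ≤ coeff n F

theorem NN.mul {F G : ℝ⟦X⟧} (hF : NN F) (hG : NN G) : NN (F * G) := by
  intro n; rw [coeff_mul]; exact Finset.sum_nonneg fun p _ => mul_nonneg (hF _) (hG _)
theorem NN.one : NN (1 : ℝ⟦X⟧) := by intro n; rw [coeff_one]; split_ifs <;> norm_num
theorem NN.X : NN (X : ℝ⟦X⟧) := by intro n; rw [coeff_X]; split_ifs <;> norm_num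
theorem NN.prod {ι : Type*} {s : Finset ι} {F : ι → ℝ⟦X⟧} (h : ∀ i, NN (F i)) : NN (∏ i ∈ s, F i) :=
  Finset.prod_induction _ NN (fun _ _ => NN.mul) NN.one (fun i _ => h i)
theorem NN.pow {F : ℝ⟦X⟧} (h : NN F) (k : ℕ) : NN (F ^ k) := by
  induction k with
  | zero => simpa using NN.one
  | succ k ih => rw [pow_succ]; exact ih.mul h
theorem NN.expand {F : ℝ⟦X⟧} (h : NN F) (s : ℕ) (hs : s ≠ 0) : NN (PowerSeries.expand s hs F) := by
  intro n; rw [coeff_expand]; split_ifs; exacts [h _, le_rfl]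

noncomputable abbrev na (a : ℝ) : ℝ≥0∞ := ‖a‖ₑ

theorem SM_enorm {R : Type} [NormedField R] : SM (fun a : R => ‖a‖ₑ) where
  zero := by simp
  one := by simp
  add := enorm_add_le
  mul a b := by rw [enorm_mul]

theorem na_of {a : ℝ} (h : 0 ≤ a) : na a = ENNReal.ofReal a := by
  unfold na; rw [Real.enorm_eq_ofReal h]

theorem nv_mul_eq (x : ℝ≥0∞) {F G : ℝ⟦X⟧} (hF : NN F) (hG : NN G) : nv na x (F * G) = nv na x F * nv na x G := by
  unfold nv
  rw [← ev_conv]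
  congr 1; ext n; congr 1
  rw [coeff_mul, na_of (Finset.sum_nonneg fun p _ => mul_nonneg (hF _) (hG _)),
    ENNReal.ofReal_sum_of_nonneg (fun p _ => mul_nonneg (hF _) (hG _))]
  refine Finset.sum_congr rfl fun p _ => ?_
  rw [ENNReal.ofReal_mul (hF _), na_of (hF _), na_of (hG _)]

theorem nv_prod_eq (x : ℝ≥0∞) {ι : Type*} (s : Finset ι) {F : ι → ℝ⟦X⟧} (h : ∀ i, NN (F i)) :
    nv na x (∏ i ∈ s, F i) = ∏ i ∈ s, nv na x (F i) := by
  induction s using Finset.induction_on with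
  | empty =>
    simp [nv]
    rw [tsum_eq_single 0]
    · simp
    · intro n hn; rw [if_neg hn]; simp
  | insert a s ha ih =>
    rw [Finset.prod_insert ha, Finset.prod_insert ha, nv_mul_eq x (h a) (NN.prod h), ih]

theorem nv_pow_eq (x : ℝ≥0∞) {F : ℝ⟦X⟧} (h : NN F) (k : ℕ) : nv na x (F ^ k) = nv na x F ^ k := by
  rw [Finset.pow_eq_prod_const, nv_prod_eq x _ (fun _ => h), Finset.pow_eq_prod_const]

theorem nv_X_eq (x : ℝ≥0∞) : nv na x X = x := by
  unfold nv
  rw [tsum_eq_single 1]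
  · simp
  · intro n hn; rw [coeff_X, if_neg hn]; simp

theorem prod_one_add_fin {ι : Type*} (s : Finset ι) (y : ι → ℝ≥0∞) (hy : ∀ i ∈ s, y i ≠ ∞) :
    ∏ i ∈ s, (1 + y i) ≤ ENNReal.ofReal (Real.exp (∑ i ∈ s, y i).toReal) := by
  have h1 : ∀ i ∈ s, 1 + y i ≤ ENNReal.ofReal (Real.exp (y i).toReal) := by
    intro i hi
    have : 1 + y i = ENNReal.ofReal (1 + (y i).toReal) := by
      rw [ENNReal.ofReal_add (by norm_num) ENNReal.toReal_nonneg, ENNReal.ofReal_toReal (hy i hi), ENNReal.ofReal_one]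
    rw [this]
    apply ENNReal.ofReal_le_ofReal
    rw [add_comm]; exact Real.add_one_le_exp _
  refine (Finset.prod_le_prod' h1).trans ?_
  rw [← ENNReal.ofReal_prod_of_nonneg (fun i _ => (Real.exp_pos _).le), ← Real.exp_sum, ENNReal.toReal_sum hy]

theorem prod_one_add_le {ι : Type*} (s : Finset ι) (y : ι → ℝ≥0∞) (h : ∑' i, y i ≠ ∞) :
    ∏ i ∈ s, (1 + y i) ≤ ENNReal.ofReal (Real.exp (∑' i, y i).toReal) := by
  refine (prod_one_add_fin s y (fun i _ => ENNReal.ne_top_of_tsum_ne_top h i)).trans ?_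
  apply ENNReal.ofReal_le_ofReal
  apply Real.exp_le_exp.2
  exact ENNReal.toReal_mono h (ENNReal.sum_le_tsum s)

end ev

section bd
variable {𝒯 : Type} (S : PSys 𝒯) {R : Type} [CommRing R] [Algebra ℝ R] [Algebra ℚ R] (E : Multiplicative ℝ →* R)

theorem nv_psi_le (N : R → ℝ≥0∞) (x B : ℝ≥0∞) (h : ∀ M, nv N x (S.psiN E M) ≤ B) : nv N x (S.psi E) ≤ B := by
  unfold nv
  rw [ENNReal.tsum_eq_iSup_nat]
  apply iSup_le
  intro M
  refine le_trans ?_ (h M)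
  refine le_trans (Finset.sum_le_sum ?_) (ENNReal.sum_le_tsum (Finset.range M))
  intro n hn
  rw [S.psi_coeff E (show n ≤ M by simp at hn; omega)]

theorem nv_psi_prod {N : R → ℝ≥0∞} (hN : SM N) (x B : ℝ≥0∞) (h : ∀ M, ∏ T ∈ S.upto M, nv N x (S.bT E T) ≤ B) :
    nv N x (S.psi E) ≤ x * B := by
  apply nv_psi_le
  intro M
  unfold psiN
  refine (nv_mul hN x _ _).trans ?_
  gcongr
  · exact nv_X hN x
  · exact (nv_prod hN x _ _).trans (h M)

theorem nv_bT {N : R → ℝ≥0∞} (hN : SM N) (x : ℝ≥0∞) (T : 𝒯) : nv N x (S.bT E T) ≤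
    1 + ∑' m, N (S.w E T ^ (m + 2) * coeff (m + 2) (betaS E)) * x ^ (S.sz T * (m + 2)) := by
  unfold bT
  rw [nv_expand hN.zero]
  rw [← Summable.sum_add_tsum_nat_add' (k := 2) (f := fun m => N (coeff m (rescale (S.w E T) (betaS E))) * x ^ (S.sz T * m)) ENNReal.summable]
  simp only [coeff_rescale]
  refine add_le_add ?_ le_rfl
  rw [Finset.sum_range_succ, Finset.sum_range_one, beta0, beta1, mul_zero, mul_zero, hN.zero, zero_mul, add_zero, pow_zero, mul_one, pow_zero, mul_one]
  exact hN.one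

theorem nv_psi_geom {N : R → ℝ≥0∞} (hN : SM N) (x K c : ℝ≥0∞) (hx' : x ≠ ∞) (hc : c * x < 1) (hK : K ≠ ∞)
    (hb : ∀ T m, N (S.w E T ^ (m + 2) * coeff (m + 2) (betaS E)) ≤ K * c ^ (S.sz T * (m + 2)))
    (hs : ∑' T, (c * x) ^ (2 * S.sz T) ≠ ∞) : nv N x (S.psi E) < ∞ := by
  have key : ∀ T, nv N x (S.bT E T) ≤ 1 + K * (1 - c * x)⁻¹ * (c * x) ^ (2 * S.sz T) := by
    intro T
    refine (S.nv_bT E hN x T).trans ?_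
    gcongr
    calc ∑' m, N (S.w E T ^ (m + 2) * coeff (m + 2) (betaS E)) * x ^ (S.sz T * (m + 2))
        ≤ ∑' m : ℕ, K * (c * x) ^ (2 * S.sz T) * (c * x) ^ m := by
          apply ENNReal.tsum_le_tsum
          intro m
          calc _ ≤ K * c ^ (S.sz T * (m + 2)) * x ^ (S.sz T * (m + 2)) := by gcongr; exact hb T m
            _ = K * (c * x) ^ (S.sz T * (m + 2)) := by rw [mul_pow, mul_assoc]
            _ ≤ K * (c * x) ^ (2 * S.sz T + m) := by
              gcongr 1
              apply pow_le_pow_right_of_le_one' hc.le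
              have := S.sz_pos T
              nlinarith
            _ = _ := by rw [pow_add, mul_assoc]
      _ = _ := by rw [ENNReal.tsum_mul_left, ENNReal.tsum_geometric]; ring
  have hfin : ∑' T, K * (1 - c * x)⁻¹ * (c * x) ^ (2 * S.sz T) ≠ ∞ := by
    rw [ENNReal.tsum_mul_left]
    apply ENNReal.mul_ne_top _ hs
    apply ENNReal.mul_ne_top hK
    rw [ENNReal.inv_ne_top]
    exact (tsub_pos_of_lt hc).ne'
  · refine lt_of_le_of_lt (S.nv_psi_prod E hN x (ENNReal.ofReal (Real.exp (∑' T, K * (1 - c * x)⁻¹ * (c * x) ^ (2 * S.sz T)).toReal)) ?_) (ENNReal.mul_lt_top (lt_top_iff_ne_top.2 hx') ENNReal.ofReal_lt_top)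
    intro M
    exact (Finset.prod_le_prod' fun T _ => key T).trans (prod_one_add_le _ _ hfin)
end bd
end PSys

namespace PSys
open PowerSeries
open scoped ENNReal

noncomputable def cc (k : ℕ) : ℝ := TF.tc k * Real.exp (-(k : ℝ))

theorem cc_eq (k : ℕ) (hk : k ≠ 0) : cc k = 1 / (Real.sqrt 2 * (k * Real.sqrt k) * Stirling.stirlingSeq k) := by
  unfold cc TF.tc Stirling.stirlingSeq
  have h0 : (0 : ℝ) < k := by positivity
  have hf : (0 : ℝ) < k.factorial := by positivity
  rw [Real.sqrt_mul (by norm_num), div_pow, ← Real.exp_nat_mul, mul_one, Real.exp_neg]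
  have h2 : (0:ℝ) < Real.sqrt 2 := by positivity
  have h3 : (0:ℝ) < Real.sqrt k := by positivity
  have := Real.exp_pos (k : ℝ)
  have : (0:ℝ) < (k:ℝ)^k := by positivity
  field_simp

theorem cc_nonneg (k : ℕ) : 0 ≤ cc k := by
  unfold cc TF.tc; positivity

theorem cc_le (k : ℕ) (hk : k ≠ 0) : cc k ≤ 1 / (k * Real.sqrt k) := by
  rw [cc_eq k hk]
  have h0 : (0 : ℝ) < k := by positivity
  have h3 : (0:ℝ) < Real.sqrt k := by positivity
  apply one_div_le_one_div_of_le (by positivity)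
  have h1 := Stirling.sqrt_pi_le_stirlingSeq hk
  have h2 : 1 ≤ Real.sqrt Real.pi := by
    rw [Real.one_le_sqrt]; linarith [Real.pi_gt_three]
  have h4 : (1:ℝ) ≤ Real.sqrt 2 := by rw [Real.one_le_sqrt]; norm_num
  have h5 : 1 ≤ Real.sqrt 2 * Stirling.stirlingSeq k := by nlinarith
  nlinarith [mul_pos h0 h3]

theorem summable_ksqrt : Summable (fun k : ℕ => 1 / ((k : ℝ) * Real.sqrt k)) := by
  have := (Real.summable_one_div_nat_rpow (p := 3 / 2)).2 (by norm_num)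
  refine this.congr ?_
  intro k
  rcases Nat.eq_zero_or_pos k with rfl | h
  · simp
  · rw [Real.sqrt_eq_rpow, show (3/2 : ℝ) = 1 + 1/2 by norm_num, Real.rpow_add (by positivity), Real.rpow_one]

theorem cc_summable : Summable cc := by
  refine Summable.of_nonneg_of_le cc_nonneg ?_ summable_ksqrt
  intro k
  rcases Nat.eq_zero_or_pos k with rfl | h
  · simp [cc, TF.tc]
  · exact cc_le k h.ne'

section rho
variable {𝒯 : Type} (S : PSys 𝒯)

noncomputable abbrev E1 : Multiplicative ℝ →* ℝ := 1
noncomputable def ps : ℝ⟦X⟧ := S.psi E1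
noncomputable def Pv (x : ℝ≥0∞) : ℝ≥0∞ := ∑' T, x ^ S.sz T

theorem w_one (T : 𝒯) : S.w E1 T = 1 := rfl

theorem beta_aug (m : ℕ) : coeff m (betaS E1) = ∑ j ∈ Finset.range (m + 1), (-1 : ℝ) ^ j / j.factorial := by
  unfold betaS qS
  rw [mul_comm, coeff_mul, Finset.Nat.sum_antidiagonal_eq_sum_range_succ_mk]
  apply Finset.sum_congr rfl
  intro j _
  simp [coeff_rescale, coeff_exp, div_eq_mul_inv]

theorem beta_ge' (m : ℕ) : 1 / 3 + (if Even m then 1 / ((m + 3).factorial : ℝ) else 0) ≤ coeff (m + 2) (betaS E1) := by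
  induction m with
  | zero => rw [beta_aug]; norm_num [Finset.sum_range_succ, Nat.factorial]
  | succ m ih =>
    rw [beta_aug] at ih ⊢
    rw [Finset.sum_range_succ]
    by_cases h : Even m
    · have h1 : ¬ Even (m + 1) := by rw [Nat.even_add_one]; simpa
      rw [if_pos h] at ih
      rw [if_neg h1]
      have : (-1 : ℝ) ^ (m + 1 + 2) = -1 := by
        apply Odd.neg_one_pow; rw [← Nat.not_even_iff_odd]; simpa [Nat.even_add] using h
      rw [this, neg_div]
      have : m + 1 + 2 = m + 3 := rfl
      rw [this] at *
      linarith
    · have h1 : Even (m + 1) := by rw [Nat.even_add_one]; exact h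
      rw [if_neg h] at ih
      rw [if_pos h1]
      have : (-1 : ℝ) ^ (m + 1 + 2) = 1 := by
        apply Even.neg_one_pow; simpa [Nat.even_add] using h
      rw [this]
      have : (1 : ℝ) / ((m + 1 + 3).factorial : ℝ) ≤ 1 / ((m + 1 + 2).factorial : ℝ) := by
        apply one_div_le_one_div_of_le (by positivity)
        exact_mod_cast Nat.factorial_le (by omega)
      have e : m + 1 + 2 = m + 2 + 1 := rfl
      rw [e] at *
      linarith

theorem beta_ge (m : ℕ) : 1 / 3 ≤ coeff (m + 2) (betaS E1) := by
  refine le_trans ?_ (beta_ge' m)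
  split_ifs
  · have : (0:ℝ) ≤ 1 / ((m + 3).factorial : ℝ) := by positivity
    linarith
  · simp

theorem NN_beta : NN (betaS E1) := by
  intro m
  match m with
  | 0 => rw [beta0]; norm_num
  | 1 => rw [beta1]
  | m + 2 => linarith [beta_ge m]

theorem beta_le (m : ℕ) : coeff m (betaS E1) ≤ Real.exp 1 := by
  rw [beta_aug]
  refine le_trans (Finset.sum_le_sum fun j _ => ?_) (Real.sum_le_exp_of_nonneg (x := 1) zero_le_one (m + 1))
  refine div_le_div_of_nonneg_right ?_ (by positivity)
  rcases neg_one_pow_eq_or ℝ j with h | h <;> rw [h] <;> norm_num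

theorem resc_one (T : 𝒯) (F : ℝ⟦X⟧) : rescale (S.w E1 T) F = F := by
  rw [w_one]; simp

theorem NN_bT (T : 𝒯) : NN (S.bT E1 T) := by
  unfold bT; rw [resc_one]; exact NN_beta.expand _ _
theorem NN_hT (T : 𝒯) : NN (S.hT E1 T) := by
  unfold hT; rw [resc_one]; refine NN.expand (fun n => ?_) _ _
  rw [coeff_exp]; simp
theorem NN_gT (T : 𝒯) : NN (S.gT E1 T) := by
  rw [← bh]; exact (S.NN_bT T).mul (S.NN_hT T)
theorem NN_psiN (N : ℕ) : NN (S.psiN E1 N) := NN.X.mul (NN.prod fun T => S.NN_bT T)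
theorem NN_ps : NN S.ps := by
  intro n; unfold ps psi; rw [coeff_mk]; exact S.NN_psiN n n

theorem nv_gT (x : ℝ≥0∞) (T : 𝒯) : nv na x (S.gT E1 T) = ∑' m : ℕ, (x ^ S.sz T) ^ m := by
  unfold gT; rw [nv_expand (by simp), resc_one]
  congr 1; ext m
  simp [qS, pow_mul]

theorem nv_hT (x : ℝ) (hx : 0 ≤ x) (T : 𝒯) : nv na (ENNReal.ofReal x) (S.hT E1 T) = ENNReal.ofReal (Real.exp (x ^ S.sz T)) := by
  unfold hT; rw [nv_expand (by simp), resc_one]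
  rw [Real.exp_eq_exp_ℝ, NormedSpace.exp_eq_tsum_div]
  rw [ENNReal.ofReal_tsum_of_nonneg (fun n => by positivity) (Real.summable_pow_div_factorial _)]
  congr 1; ext m
  rw [na_of (by rw [coeff_exp]; simp), ← ENNReal.ofReal_pow hx, ← ENNReal.ofReal_mul (by rw [coeff_exp]; simp), coeff_exp]
  congr 1
  simp; rw [pow_mul]; ring

theorem sum_w (n : ℕ) : ∑ T ∈ S.lvl n, S.w E1 T = (S.lvl n).card := by simp [w_one]

theorem Pv_eq (x : ℝ≥0∞) : S.Pv x = ∑' n, ((S.lvl n).card : ℝ≥0∞) * x ^ n := by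
  unfold Pv
  rw [← (Equiv.sigmaFiberEquiv S.sz).tsum_eq, ENNReal.tsum_sigma']
  congr 1; ext n
  have : ∀ b : {T // S.sz T = n}, x ^ S.sz ((Equiv.sigmaFiberEquiv S.sz) ⟨n, b⟩) = x ^ n := by
    rintro ⟨T, hT⟩; simp [hT]
  simp_rw [this]
  have hs : {T | S.sz T = n} = (S.lvl n : Set 𝒯) := by ext T; simp [S.mem_lvl]
  rw [show (∑' b : {T // S.sz T = n}, x ^ n) = ∑' b : ({T | S.sz T = n} : Set 𝒯), x ^ n from rfl, hs]
  rw [Finset.tsum_subtype' (S.lvl n) (fun _ => x ^ n)]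
  simp

theorem coeff_g_le (N n : ℕ) : coeff n (∏ T ∈ S.upto N, S.gT E1 T) ≤ (S.lvl (n + 1)).card := by
  rw [← sum_w, ← S.claim1 E1 (max N n) n (le_max_right _ _)]
  have hsub : S.upto N ⊆ S.upto (max N n) := by
    intro T; rw [mem_upto, mem_upto]; intro h; exact h.trans (le_max_left _ _)
  rw [← Finset.prod_sdiff hsub, mul_comm, coeff_mul]
  have h1 := Finset.single_le_sum (f := fun p : ℕ × ℕ => coeff p.1 (∏ T ∈ S.upto N, S.gT E1 T) *
    coeff p.2 (∏ T ∈ S.upto (max N n) \ S.upto N, S.gT E1 T))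
    (fun p _ => mul_nonneg (NN.prod (fun T => S.NN_gT T) _) (NN.prod (fun T => S.NN_gT T) _))
    (show (n, 0) ∈ Finset.HasAntidiagonal.antidiagonal n by simp)
  refine le_trans (le_of_eq ?_) h1
  have h2 : coeff 0 (∏ T ∈ S.upto (max N n) \ S.upto N, S.gT E1 T) = 1 := by
    rw [coeff_zero_eq_constantCoeff_apply, map_prod]
    apply Finset.prod_eq_one
    intro T _
    rw [← coeff_zero_eq_constantCoeff_apply, coeff_gT]; simp
  simp only [h2, mul_one]

theorem psiN_hT_le (x : ℝ≥0∞) (N : ℕ) : nv na x (S.psiN E1 N) * ∏ T ∈ S.upto N, nv na x (S.hT E1 T) ≤ S.Pv x := by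
  rw [← nv_prod_eq x _ (fun T => S.NN_hT T), ← nv_mul_eq x (S.NN_psiN N) (NN.prod fun T => S.NN_hT T), psiN, mul_assoc,
    ← Finset.prod_mul_distrib, Pv_eq]
  simp only [bh]
  unfold nv
  apply ENNReal.tsum_le_tsum
  intro n
  gcongr
  cases n with
  | zero => simp
  | succ n =>
    rw [coeff_succ_X_mul, na_of (NN.prod (fun T => S.NN_gT T) n), ENNReal.ofReal_le_iff_le_toReal (by simp)]
    simpa using S.coeff_g_le N n

theorem Pv_le (x B : ℝ≥0∞) (h : ∀ N, ∑ T ∈ S.upto N, x ^ S.sz T ≤ B) : S.Pv x ≤ B := by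
  unfold Pv
  rw [ENNReal.tsum_eq_iSup_sum]
  apply iSup_le
  intro s
  refine le_trans ?_ (h (s.sup S.sz))
  apply Finset.sum_le_sum_of_subset
  intro T hT
  rw [mem_upto]; exact Finset.le_sup hT

theorem upto_zero : S.upto 0 = ∅ := by
  ext T; rw [mem_upto]; have := S.sz_pos T; simp; omega

theorem PN_succ (x : ℝ≥0∞) (N : ℕ) : ∑ T ∈ S.upto (N + 1), x ^ S.sz T ≤ x * ∏ T ∈ S.upto N, nv na x (S.gT E1 T) := by
  rw [← nv_prod_eq x _ (fun T => S.NN_gT T), sum_upto, Finset.sum_range_succ']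
  have h0 : S.lvl 0 = ∅ := by
    ext T; rw [S.mem_lvl]; simp [S.sz_ne T]
  rw [h0, Finset.sum_empty, add_zero]
  unfold nv
  rw [← ENNReal.tsum_mul_left]
  refine le_trans (Finset.sum_le_sum fun n hn => ?_) (ENNReal.sum_le_tsum (Finset.range (N + 1)))
  rw [S.claim1 E1 N n (by simp at hn; omega), sum_w, Finset.sum_congr rfl (g := fun _ => x ^ (n + 1)) (fun T hT => by rw [(S.mem_lvl _ _).1 hT])]
  rw [na_of (by positivity)]
  simp
  rw [pow_succ]; ring_nf; rfl

theorem Pv_sixth : S.Pv (ENNReal.ofReal (1 / 6)) ≤ ENNReal.ofReal (1 / 2) := by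
  apply Pv_le
  set x : ℝ≥0∞ := ENNReal.ofReal (1 / 6) with hx
  intro N
  induction N with
  | zero => rw [upto_zero]; simp
  | succ N ih =>
    refine (S.PN_succ x N).trans ?_
    have hxt : ∀ T, x ^ S.sz T ≤ ENNReal.ofReal (1 / 2) := by
      intro T
      calc x ^ S.sz T ≤ x ^ 1 := pow_le_pow_right_of_le_one' (by rw [hx, ENNReal.ofReal_le_one]; norm_num) (S.sz_pos T)
        _ ≤ _ := by rw [pow_one, hx]; apply ENNReal.ofReal_le_ofReal; norm_num
    have h1 : ∀ T, nv na x (S.gT E1 T) ≤ 1 + 2 * x ^ S.sz T := by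
      intro T
      rw [nv_gT, tsum_eq_zero_add' ENNReal.summable, pow_zero]
      gcongr
      simp_rw [pow_succ]
      rw [ENNReal.tsum_mul_right, ENNReal.tsum_geometric]
      gcongr
      rw [ENNReal.inv_le_iff_inv_le]
      have : (2 : ℝ≥0∞)⁻¹ = ENNReal.ofReal (1 / 2) := by
        rw [ENNReal.ofReal_div_of_pos (by norm_num)]; simp
      rw [this]
      apply ENNReal.le_sub_of_add_le_right (ne_top_of_le_ne_top ENNReal.ofReal_ne_top (hxt T))
      calc _ ≤ ENNReal.ofReal (1 / 2) + ENNReal.ofReal (1 / 2) := by gcongr; exact hxt T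
        _ = 1 := by rw [← ENNReal.ofReal_add (by norm_num) (by norm_num)]; norm_num
    have h2 := (Finset.prod_le_prod' (s := S.upto N) fun T _ => h1 T).trans (prod_one_add_fin _ _ (fun T _ => by
      apply ENNReal.mul_ne_top (by simp) (ne_top_of_le_ne_top ENNReal.ofReal_ne_top (hxt T))))
    calc _ ≤ x * ENNReal.ofReal (Real.exp (∑ i ∈ S.upto N, 2 * x ^ S.sz i).toReal) := by gcongr
      _ ≤ x * ENNReal.ofReal (Real.exp 1) := by
        gcongr
        rw [← Finset.mul_sum]
        have : 2 * ∑ i ∈ S.upto N, x ^ S.sz i ≤ 2 * ENNReal.ofReal (1 / 2) := by gcongr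
        have h3 := ENNReal.toReal_mono (by finiteness) this
        refine h3.trans ?_
        simp
      _ ≤ _ := by
        rw [hx, ← ENNReal.ofReal_mul (by norm_num)]
        apply ENNReal.ofReal_le_ofReal
        linarith [Real.exp_one_lt_d9]

theorem psi_exp_le (x : ℝ) (hx : 0 ≤ x) (hP : S.Pv (ENNReal.ofReal x) ≠ ∞) :
    nv na (ENNReal.ofReal x) S.ps ≠ ∞ ∧
    (nv na (ENNReal.ofReal x) S.ps).toReal * Real.exp (S.Pv (ENNReal.ofReal x)).toReal ≤ (S.Pv (ENNReal.ofReal x)).toReal := by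
  set y := ENNReal.ofReal x with hy
  have h1 : ∀ N, ∑ n ∈ Finset.range N, na (coeff n S.ps) * y ^ n * ENNReal.ofReal (Real.exp (∑ T ∈ S.upto N, x ^ S.sz T)) ≤ S.Pv y := by
    intro N
    refine le_trans ?_ (S.psiN_hT_le y N)
    rw [← Finset.sum_mul]
    simp only [hy, S.nv_hT x hx]
    rw [← ENNReal.ofReal_prod_of_nonneg (fun i _ => (Real.exp_pos _).le), ← Real.exp_sum]
    gcongr
    unfold nv
    refine le_trans (Finset.sum_le_sum ?_) (ENNReal.sum_le_tsum (Finset.range N))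
    intro n hn
    rw [ps, S.psi_coeff E1 (show n ≤ N by simp at hn; omega)]
  have h2 : nv na y S.ps ≤ S.Pv y := by
    unfold nv
    rw [ENNReal.tsum_eq_iSup_nat]
    apply iSup_le
    intro N
    refine le_trans (Finset.sum_le_sum fun n _ => ?_) (h1 N)
    apply le_mul_of_one_le_right zero_le
    rw [ENNReal.one_le_ofReal]
    apply Real.one_le_exp
    exact Finset.sum_nonneg fun T _ => by positivity
  have h3 : nv na y S.ps ≠ ∞ := ne_top_of_le_ne_top hP h2
  refine ⟨h3, ?_⟩
  have t1 : Filter.Tendsto (fun N => ∑ n ∈ Finset.range N, (na (coeff n S.ps) * y ^ n).toReal) Filter.atTop (nhds (nv na y S.ps).toReal) := by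
    have := (ENNReal.hasSum_toReal h3).tendsto_sum_nat
    rwa [← ENNReal.tsum_toReal_eq (ENNReal.ne_top_of_tsum_ne_top h3)] at this
  have t2 : Filter.Tendsto (fun N => ∑ T ∈ S.upto N, x ^ S.sz T) Filter.atTop (nhds (S.Pv y).toReal) := by
    have := (ENNReal.hasSum_toReal hP)
    rw [← ENNReal.tsum_toReal_eq (ENNReal.ne_top_of_tsum_ne_top hP)] at this
    have h5 := this.comp (f := S.upto) (x := Filter.atTop) ?_
    · refine h5.congr ?_
      intro N
      simp only [Function.comp]
      refine Finset.sum_congr rfl fun T _ => ?_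
      rw [hy, ← ENNReal.ofReal_pow hx, ENNReal.toReal_ofReal (by positivity)]
    · apply Filter.tendsto_atTop_finset_of_monotone
      · intro a b hab T; rw [mem_upto, mem_upto]; omega
      · intro T; exact ⟨S.sz T, by rw [mem_upto]⟩
  refine le_of_tendsto (t1.mul ((Real.continuous_exp.tendsto _).comp t2)) (Filter.Eventually.of_forall fun N => ?_)
  have h6 := ENNReal.toReal_mono hP (h1 N)
  refine le_trans (le_of_eq ?_) h6
  rw [← Finset.sum_mul, ENNReal.toReal_mul, ENNReal.toReal_ofReal (Real.exp_pos _).le, ENNReal.toReal_sum (fun n _ => ENNReal.ne_top_of_tsum_ne_top h3 n)]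
  rfl

theorem Pv_le_tc (x : ℝ≥0∞) : S.Pv x ≤ ∑' k, ENNReal.ofReal (TF.tc k) * nv na x S.ps ^ k := by
  have htc : ∀ k, 0 ≤ TF.tc k := fun k => by unfold TF.tc; positivity
  simp_rw [← nv_pow_eq x S.NN_ps]
  unfold nv
  simp_rw [← ENNReal.tsum_mul_left]
  rw [ENNReal.tsum_comm, Pv_eq]
  apply ENNReal.tsum_le_tsum
  intro n
  have h := S.ident E1 n
  rw [sum_w] at h
  replace h : ((S.lvl n).card : ℝ) = ∑ k ∈ Finset.range (n + 1), TF.tc k * coeff n (S.ps ^ k) := h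
  have h2 : ((S.lvl n).card : ℝ≥0∞) = ∑ k ∈ Finset.range (n + 1), ENNReal.ofReal (TF.tc k) * na (coeff n (S.ps ^ k)) := by
    have : ((S.lvl n).card : ℝ≥0∞) = ENNReal.ofReal ((S.lvl n).card : ℝ) := by simp
    rw [this, h, ENNReal.ofReal_sum_of_nonneg (fun k _ => mul_nonneg (htc k) (S.NN_ps.pow k n))]
    refine Finset.sum_congr rfl fun k _ => ?_
    rw [na_of (S.NN_ps.pow k n), ← ENNReal.ofReal_mul (htc k)]
  rw [h2, Finset.sum_mul]
  simp_rw [← mul_assoc]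
  exact ENNReal.sum_le_tsum _

theorem nv_real {F : ℝ⟦X⟧} (hF : NN F) {x : ℝ} (hx : 0 ≤ x) (h : nv na (ENNReal.ofReal x) F ≠ ∞) :
    HasSum (fun n => coeff n F * x ^ n) (nv na (ENNReal.ofReal x) F).toReal := by
  have h1 := ENNReal.hasSum_toReal h
  rw [← ENNReal.tsum_toReal_eq (ENNReal.ne_top_of_tsum_ne_top h)] at h1
  refine h1.congr_fun ?_
  intro n
  rw [na_of (hF n), ← ENNReal.ofReal_pow hx, ← ENNReal.ofReal_mul (hF n), ENNReal.toReal_ofReal (mul_nonneg (hF n) (by positivity))]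

theorem real_nv {F : ℝ⟦X⟧} (hF : NN F) {x : ℝ} (hx : 0 ≤ x) (h : Summable (fun n => coeff n F * x ^ n)) :
    nv na (ENNReal.ofReal x) F = ENNReal.ofReal (∑' n, coeff n F * x ^ n) := by
  rw [ENNReal.ofReal_tsum_of_nonneg (fun n => mul_nonneg (hF n) (by positivity)) h]
  unfold nv
  congr 1; ext n
  rw [na_of (hF n), ← ENNReal.ofReal_pow hx, ← ENNReal.ofReal_mul (hF n)]

theorem ps_fin (x : ℝ) (hx : 0 ≤ x) (h1 : x < 1) (h : S.Pv (ENNReal.ofReal (x ^ 2)) ≠ ∞) : nv na (ENNReal.ofReal x) S.ps ≠ ∞ := by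
  refine (S.nv_psi_geom E1 (N := na) (SM_enorm (R := ℝ)) (ENNReal.ofReal x) (ENNReal.ofReal (Real.exp 1)) 1 (by simp) (by simpa using h1) (by simp) ?_ ?_).ne
  · intro T m
    rw [w_one, one_pow, one_mul, one_pow, mul_one, na_of (NN_beta _)]
    exact ENNReal.ofReal_le_ofReal (beta_le _)
  · rw [one_mul]
    unfold Pv at h
    simp_rw [pow_mul, ← ENNReal.ofReal_pow hx]
    exact h

theorem Pv_mono {x y : ℝ≥0∞} (h : x ≤ y) : S.Pv x ≤ S.Pv y :=
  ENNReal.tsum_le_tsum fun T => by gcongr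

theorem x_le_ps (x : ℝ≥0∞) : x ≤ nv na x S.ps := by
  unfold nv
  refine le_trans (le_of_eq ?_) (ENNReal.le_tsum 1)
  rw [ps, psi_one]; simp

theorem Pv_fin_of (x : ℝ≥0∞) (h : nv na x S.ps ≤ ENNReal.ofReal (Real.exp (-1))) : S.Pv x ≠ ∞ := by
  refine ne_top_of_le_ne_top ?_ (S.Pv_le_tc x)
  refine ne_top_of_le_ne_top (cc_summable.tsum_ofReal_ne_top) (ENNReal.tsum_le_tsum fun k => ?_)
  unfold cc
  have htc : 0 ≤ TF.tc k := by unfold TF.tc; positivity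
  rw [ENNReal.ofReal_mul htc]
  gcongr
  calc _ ≤ ENNReal.ofReal (Real.exp (-1)) ^ k := by gcongr
    _ = _ := by rw [← ENNReal.ofReal_pow (Real.exp_pos _).le, ← Real.exp_nat_mul]; simp

theorem mul_exp_neg_le (p : ℝ) : p * Real.exp (-p) ≤ Real.exp (-1) := by
  have := Real.add_one_le_exp (p - 1)
  have h2 : Real.exp (-1) = Real.exp (p - 1) * Real.exp (-p) := by rw [← Real.exp_add]; ring_nf
  rw [h2]
  apply mul_le_mul_of_nonneg_right _ (Real.exp_pos _).le
  linarith

theorem ps_le (x : ℝ) (hx : 0 ≤ x) (hP : S.Pv (ENNReal.ofReal x) ≠ ∞) :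
    nv na (ENNReal.ofReal x) S.ps ≤ ENNReal.ofReal (Real.exp (-1)) := by
  obtain ⟨h1, h2⟩ := S.psi_exp_le x hx hP
  rw [← ENNReal.ofReal_toReal h1]
  apply ENNReal.ofReal_le_ofReal
  refine le_trans ?_ (mul_exp_neg_le (S.Pv (ENNReal.ofReal x)).toReal)
  rw [Real.exp_neg, ← div_eq_mul_inv, le_div_iff₀ (Real.exp_pos _)]
  exact h2

theorem rho_exists : ∃ ρ : ℝ, 0 < ρ ∧ ρ < 1 ∧ HasSum (fun n => coeff n S.ps * ρ ^ n) (Real.exp (-1)) ∧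
    HasSum (fun n => ((S.lvl n).card : ℝ) * ρ ^ n) 1 ∧ S.Pv (ENNReal.ofReal ρ) ≠ ∞ := by
  set A : Set ℝ := {x | 0 < x ∧ S.Pv (ENNReal.ofReal x) ≠ ∞} with hA
  have hA6 : (1/6 : ℝ) ∈ A := ⟨by norm_num, ne_top_of_le_ne_top (by simp) S.Pv_sixth⟩
  have hAle : ∀ x ∈ A, x ≤ Real.exp (-1) := by
    intro x hx
    have := (S.x_le_ps _).trans (S.ps_le x hx.1.le hx.2)
    exact (ENNReal.ofReal_le_ofReal_iff (Real.exp_pos _).le).1 this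
  have hbdd : BddAbove A := ⟨_, hAle⟩
  set ρ := sSup A with hρ
  have h6 : 1/6 ≤ ρ := le_csSup hbdd hA6
  have hρ0 : 0 < ρ := by linarith
  have hρ1 : ρ < 1 := lt_of_le_of_lt (csSup_le ⟨_, hA6⟩ hAle) (by rw [Real.exp_lt_one_iff]; norm_num)
  have hlt : ∀ x, 0 < x → x < ρ → x ∈ A := by
    intro x hx hxr
    obtain ⟨y, hy, hxy⟩ := exists_lt_of_lt_csSup ⟨_, hA6⟩ hxr
    exact ⟨hx, ne_top_of_le_ne_top hy.2 (S.Pv_mono (ENNReal.ofReal_le_ofReal hxy.le))⟩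
  obtain ⟨r, hr1, hr2⟩ := exists_between (show ρ < Real.sqrt ρ by
    apply Real.lt_sqrt_of_sq_lt; nlinarith)
  have hr0 : 0 < r := by linarith
  have hrr : r ^ 2 < ρ := (Real.lt_sqrt hr0.le).1 hr2
  have hr11 : r < 1 := by nlinarith
  have hsr : Summable (fun n => coeff n S.ps * r ^ n) :=
    (nv_real S.NN_ps hr0.le (S.ps_fin r hr0.le hr11 (hlt _ (by positivity) hrr).2)).summable
  have hsx : ∀ x, 0 ≤ x → x ≤ r → Summable (fun n => coeff n S.ps * x ^ n) := by
    intro x hx hxr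
    refine Summable.of_nonneg_of_le (fun n => mul_nonneg (S.NN_ps n) (by positivity)) (fun n => ?_) hsr
    have := S.NN_ps n
    gcongr
  have hcont : ContinuousOn (fun x : ℝ => ∑' n, coeff n S.ps * x ^ n) (Set.Icc 0 r) := by
    apply continuousOn_tsum (u := fun n => coeff n S.ps * r ^ n) _ hsr
    · intro n x hx
      rw [Real.norm_of_nonneg (mul_nonneg (S.NN_ps n) (pow_nonneg hx.1 n))]
      have := S.NN_ps n
      have := hx.1
      have := hx.2
      gcongr
    · intro n; fun_prop
  have hρmem : ρ ∈ Set.Icc 0 r := ⟨hρ0.le, hr1.le⟩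
  have hle : ∑' n, coeff n S.ps * ρ ^ n ≤ Real.exp (-1) := by
    have ht : Filter.Tendsto (fun x : ℝ => ∑' n, coeff n S.ps * x ^ n) (nhdsWithin ρ (Set.Ioo 0 ρ)) (nhds (∑' n, coeff n S.ps * ρ ^ n)) :=
      (hcont ρ hρmem).mono_left (nhdsWithin_mono _ (fun x hx => ⟨hx.1.le, (hx.2.trans hr1).le⟩))
    have : (nhdsWithin ρ (Set.Ioo 0 ρ)).NeBot := by
      rw [nhdsWithin_Ioo_eq_nhdsLT hρ0]; infer_instance
    refine le_of_tendsto ht ?_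
    filter_upwards [self_mem_nhdsWithin] with x hx
    have hxA := hlt x hx.1 hx.2
    have := S.ps_le x hx.1.le hxA.2
    rw [real_nv S.NN_ps hx.1.le (hsx x hx.1.le (hx.2.trans hr1).le)] at this
    exact (ENNReal.ofReal_le_ofReal_iff (Real.exp_pos _).le).1 this
  have hPρ : S.Pv (ENNReal.ofReal ρ) ≠ ∞ := by
    apply S.Pv_fin_of
    rw [real_nv S.NN_ps hρ0.le (hsx ρ hρ0.le hr1.le)]
    exact ENNReal.ofReal_le_ofReal hle
  have hge : Real.exp (-1) ≤ ∑' n, coeff n S.ps * ρ ^ n := by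
    by_contra hcon
    push Not at hcon
    have ht : Filter.Tendsto (fun x : ℝ => ∑' n, coeff n S.ps * x ^ n) (nhdsWithin ρ (Set.Ioo ρ r)) (nhds (∑' n, coeff n S.ps * ρ ^ n)) :=
      (hcont ρ hρmem).mono_left (nhdsWithin_mono _ (fun x hx => ⟨(hρ0.trans hx.1).le, hx.2.le⟩))
    have : (nhdsWithin ρ (Set.Ioo ρ r)).NeBot := by
      rw [nhdsWithin_Ioo_eq_nhdsGT hr1]; infer_instance
    obtain ⟨x, hx1, hx2⟩ := ((ht.eventually (gt_mem_nhds hcon)).and self_mem_nhdsWithin).exists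
    have hx0 : 0 < x := hρ0.trans hx2.1
    have hxA : x ∈ A := by
      refine ⟨hx0, S.Pv_fin_of _ ?_⟩
      rw [real_nv S.NN_ps hx0.le (hsx x hx0.le hx2.2.le)]
      exact ENNReal.ofReal_le_ofReal hx1.le
    exact absurd (le_csSup hbdd hxA) (not_le.2 hx2.1)
  have heq := le_antisymm hle hge
  refine ⟨ρ, hρ0, hρ1, ?_, ?_, hPρ⟩
  · rw [← heq]; exact (hsx ρ hρ0.le hr1.le).hasSum
  · have h1 := (S.psi_exp_le ρ hρ0.le hPρ).2
    rw [real_nv S.NN_ps hρ0.le (hsx ρ hρ0.le hr1.le), heq, ENNReal.toReal_ofReal (Real.exp_pos _).le, ← Real.exp_add] at h1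
    have h2 : (S.Pv (ENNReal.ofReal ρ)).toReal = 1 := by
      by_contra hne
      have := Real.add_one_lt_exp (x := (S.Pv (ENNReal.ofReal ρ)).toReal - 1) (by intro h; apply hne; linarith)
      rw [show -1 + (S.Pv (ENNReal.ofReal ρ)).toReal = (S.Pv (ENNReal.ofReal ρ)).toReal - 1 by ring] at h1
      linarith
    rw [← h2]
    rw [Pv_eq] at hPρ ⊢
    have h3 := ENNReal.hasSum_toReal hPρ
    rw [← ENNReal.tsum_toReal_eq (ENNReal.ne_top_of_tsum_ne_top hPρ)] at h3
    refine h3.congr_fun ?_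
    intro n
    simp [ENNReal.toReal_ofReal hρ0.le]

end rho
end PSys

namespace PSys
open PowerSeries
open scoped ENNReal

abbrev U : Type := AddMonoidAlgebra ℝ ℝ

noncomputable def wt (δ y : ℝ) : ℝ≥0∞ := ENNReal.ofReal (Real.exp (δ * Real.sqrt |y|))
noncomputable def nu (δ : ℝ) (a : U) : ℝ≥0∞ := ∑' y, ‖a.coeff y‖ₑ * wt δ y

theorem wt_add {δ : ℝ} (hδ : 0 ≤ δ) (x y : ℝ) : wt δ (x + y) ≤ wt δ x * wt δ y := by
  unfold wt
  rw [← ENNReal.ofReal_mul (Real.exp_pos _).le, ← Real.exp_add, ← mul_add]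
  apply ENNReal.ofReal_le_ofReal
  apply Real.exp_le_exp.2
  apply mul_le_mul_of_nonneg_left _ hδ
  calc Real.sqrt |x + y| ≤ Real.sqrt (|x| + |y|) := Real.sqrt_le_sqrt (abs_add_le _ _)
    _ ≤ _ := by
      apply Real.sqrt_le_iff.2
      refine ⟨by positivity, ?_⟩
      have h1 := Real.sq_sqrt (abs_nonneg x)
      have h2 := Real.sq_sqrt (abs_nonneg y)
      nlinarith [mul_nonneg (Real.sqrt_nonneg |x|) (Real.sqrt_nonneg |y|)]

theorem nu_single (δ y c : ℝ) : nu δ (AddMonoidAlgebra.single y c) = ‖c‖ₑ * wt δ y := by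
  unfold nu
  rw [tsum_eq_single y]
  · simp
  · intro z hz; simp [Finsupp.single_eq_of_ne hz]

theorem nu_add (δ : ℝ) (a b : U) : nu δ (a + b) ≤ nu δ a + nu δ b := by
  unfold nu
  rw [← ENNReal.tsum_add]
  apply ENNReal.tsum_le_tsum
  intro y
  rw [← add_mul]
  gcongr
  rw [AddMonoidAlgebra.coeff_add]; exact enorm_add_le _ _

theorem nu_zero (δ : ℝ) : nu δ 0 = 0 := by unfold nu; simp

theorem nu_sum (δ : ℝ) {ι : Type*} (s : Finset ι) (f : ι → U) : nu δ (∑ i ∈ s, f i) ≤ ∑ i ∈ s, nu δ (f i) :=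
  Finset.le_sum_of_subadditive (nu δ) (nu_zero δ).le (nu_add δ) s f

theorem nu_eq_sum (δ : ℝ) (a : U) : nu δ a = ∑ y ∈ a.coeff.support, ‖a.coeff y‖ₑ * wt δ y := by
  unfold nu
  apply tsum_eq_sum
  intro y hy
  rw [Finsupp.notMem_support_iff.1 hy]; simp

theorem SM_nu {δ : ℝ} (hδ : 0 ≤ δ) : SM (nu δ) where
  zero := nu_zero δ
  one := by
    rw [AddMonoidAlgebra.one_def, nu_single]; simp [wt]
  add := nu_add δ
  mul a b := by
    rw [AddMonoidAlgebra.mul_def]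
    unfold Finsupp.sum
    refine (nu_sum δ _ _).trans ?_
    rw [nu_eq_sum δ a, nu_eq_sum δ b, Finset.sum_mul]
    refine Finset.sum_le_sum fun x _ => ?_
    refine (nu_sum δ _ _).trans ?_
    rw [Finset.mul_sum]
    refine Finset.sum_le_sum fun y _ => ?_
    rw [nu_single, enorm_mul]
    calc _ ≤ ‖a.coeff x‖ₑ * ‖b.coeff y‖ₑ * (wt δ x * wt δ y) := by gcongr; exact wt_add hδ x y
      _ = _ := by ring

noncomputable def EU : Multiplicative ℝ →* U := AddMonoidAlgebra.of ℝ ℝ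

theorem EU_apply (y : ℝ) : EU (Multiplicative.ofAdd y) = AddMonoidAlgebra.single y 1 := rfl

theorem log_fact_nonneg (m : ℕ) : 0 ≤ Real.log (m.factorial : ℝ) :=
  Real.log_nonneg (by exact_mod_cast Nat.one_le_iff_ne_zero.2 (Nat.factorial_ne_zero m))

theorem log_fact_le (m : ℕ) : Real.log (m.factorial : ℝ) ≤ (m : ℝ) ^ 2 := by
  rcases Nat.eq_zero_or_pos m with rfl | h
  · simp
  have h0 : (0:ℝ) < m := by positivity
  calc Real.log (m.factorial : ℝ) ≤ Real.log ((m : ℝ) ^ m) := by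
        apply Real.log_le_log (by positivity)
        exact_mod_cast Nat.factorial_le_pow m
    _ = m * Real.log m := by rw [Real.log_pow]
    _ ≤ m * m := by
      gcongr
      linarith [Real.log_le_sub_one_of_pos h0]
    _ = _ := by ring

section
variable {𝒯 : Type} (S : PSys 𝒯)

theorem F_bd : ∀ n T, S.sz T = n → 0 ≤ S.F T ∧ S.F T ≤ (S.sz T : ℝ) ^ 2 := by
  intro n
  induction n using Nat.strong_induction_on with
  | _ n ih =>
    intro T hT
    have hc : ∀ t ∈ (S.e T).support, 0 ≤ S.F t ∧ S.F t ≤ (S.sz t : ℝ) ^ 2 := by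
      intro t ht
      exact ih (S.sz t) (by rw [← hT]; exact S.sz_lt' (Finsupp.mem_support_iff.1 ht)) t rfl
    rw [S.F_eq]
    unfold Finsupp.sum
    refine ⟨Finset.sum_nonneg fun t ht => add_nonneg (log_fact_nonneg _) (mul_nonneg (by positivity) (hc t ht).1), ?_⟩
    have hsz : (S.sz T : ℝ) = 1 + ∑ t ∈ (S.e T).support, (S.e T t * S.sz t : ℝ) := by
      have := S.sz_eq T
      unfold Finsupp.sum at this
      exact_mod_cast this
    have h1 : ∀ t ∈ (S.e T).support, Real.log ((S.e T t).factorial : ℝ) + S.e T t * S.F t ≤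
        (S.e T t * S.sz t : ℝ) ^ 2 + 2 * (S.e T t * S.sz t : ℝ) := by
      intro t ht
      have h2 := log_fact_le (S.e T t)
      have h3 := (hc t ht).2
      have hm : (1:ℝ) ≤ S.e T t := by exact_mod_cast Nat.one_le_iff_ne_zero.2 (Finsupp.mem_support_iff.1 ht)
      have hs : (1:ℝ) ≤ S.sz t := by exact_mod_cast S.sz_pos t
      have h4 : (S.e T t : ℝ) * S.F t ≤ S.e T t * (S.sz t : ℝ) ^ 2 := by gcongr
      have h5 : 0 ≤ (S.e T t : ℝ) * ((S.e T t - 1) * ((S.sz t : ℝ) ^ 2 - 1) + 2 * S.sz t - 1) := by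
        apply mul_nonneg (by linarith)
        have : 0 ≤ ((S.e T t : ℝ) - 1) * ((S.sz t : ℝ) ^ 2 - 1) := mul_nonneg (by linarith) (by nlinarith)
        linarith
      nlinarith
    refine (Finset.sum_le_sum h1).trans ?_
    rw [Finset.sum_add_distrib, ← Finset.mul_sum, hsz]
    have h6 := Finset.sum_sq_le_sq_sum_of_nonneg (s := (S.e T).support) (f := fun t => (S.e T t * S.sz t : ℝ)) (fun t _ => by positivity)
    nlinarith

theorem coeff_beta {R : Type} [CommRing R] [Algebra ℝ R] [Algebra ℚ R] (E : Multiplicative ℝ →* R) (m : ℕ) :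
    coeff m (betaS E) = ∑ p ∈ Finset.HasAntidiagonal.antidiagonal m,
      E (Multiplicative.ofAdd (Real.log (p.1.factorial : ℝ))) * algebraMap ℚ R ((-1) ^ p.2 / p.2.factorial) := by
  unfold betaS qS
  rw [coeff_mul]
  refine Finset.sum_congr rfl fun p _ => ?_
  rw [coeff_mk, coeff_rescale, coeff_exp]
  congr 1
  have e : ((-1 : ℚ) ^ p.2 / (p.2.factorial : ℚ)) = (-1) ^ p.2 * (1 / (p.2.factorial : ℚ)) := by ring
  rw [e, map_mul]; simp

theorem sum_anti_exp (m : ℕ) : ∑ p ∈ Finset.HasAntidiagonal.antidiagonal m, (1 : ℝ) / p.2.factorial ≤ Real.exp 1 := by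
  rw [← Finset.Nat.sum_antidiagonal_swap]
  simp only [Prod.snd_swap]
  rw [Finset.Nat.sum_antidiagonal_eq_sum_range_succ_mk]
  refine le_trans (le_of_eq ?_) (Real.sum_le_exp_of_nonneg (x := 1) zero_le_one (m + 1))
  simp

theorem nu_b {δ : ℝ} (hδ : 0 ≤ δ) (T : 𝒯) (m : ℕ) : nu δ (S.w EU T ^ (m + 2) * coeff (m + 2) (betaS EU)) ≤
    ENNReal.ofReal (Real.exp 1) * ENNReal.ofReal (Real.exp (2 * δ)) ^ (S.sz T * (m + 2)) := by
  rw [coeff_beta, Finset.mul_sum]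
  refine (nu_sum δ _ _).trans ?_
  have : ∀ p ∈ Finset.HasAntidiagonal.antidiagonal (m + 2),
    nu δ (S.w EU T ^ (m + 2) * (EU (Multiplicative.ofAdd (Real.log (p.1.factorial : ℝ))) * algebraMap ℚ U ((-1) ^ p.2 / p.2.factorial))) ≤
     ENNReal.ofReal (1 / p.2.factorial) * ENNReal.ofReal (Real.exp (2 * δ)) ^ (S.sz T * (m + 2)) := by
    intro p hp
    have hp1 : p.1 ≤ m + 2 := by rw [Finset.HasAntidiagonal.mem_antidiagonal] at hp; omega
    have e1 : S.w EU T ^ (m + 2) * (EU (Multiplicative.ofAdd (Real.log (p.1.factorial : ℝ))) * algebraMap ℚ U ((-1) ^ p.2 / p.2.factorial))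
      = AddMonoidAlgebra.single (((m + 2 : ℕ) : ℝ) * S.F T + Real.log (p.1.factorial : ℝ)) ((-1 : ℝ) ^ p.2 / (p.2.factorial : ℝ)) := by
      unfold w
      rw [EU_apply, EU_apply, AddMonoidAlgebra.single_pow, one_pow, nsmul_eq_mul]
      have e3 : ∀ q : ℚ, algebraMap ℚ U q = AddMonoidAlgebra.single 0 (q : ℝ) := by
        intro q
        have := RingHom.congr_fun (Subsingleton.elim (algebraMap ℚ U) ((algebraMap ℝ U).comp (algebraMap ℚ ℝ))) q
        rw [this]; simp
      rw [e3, ← mul_assoc, AddMonoidAlgebra.single_mul_single, AddMonoidAlgebra.single_mul_single]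
      simp
    rw [e1, nu_single]
    have e2 : ‖((-1 : ℝ)) ^ p.2 / (p.2.factorial : ℝ)‖ₑ = ENNReal.ofReal (1 / p.2.factorial) := by
      rw [← ofReal_norm_eq_enorm]; congr 1
      simp
    rw [e2]
    gcongr
    unfold wt
    rw [← ENNReal.ofReal_pow (Real.exp_pos _).le, ← Real.exp_nat_mul]
    apply ENNReal.ofReal_le_ofReal
    apply Real.exp_le_exp.2
    obtain ⟨hF0, hF1⟩ := S.F_bd _ T rfl
    have hs : (1:ℝ) ≤ S.sz T := by exact_mod_cast S.sz_pos T
    have hm : (1:ℝ) ≤ ((m + 2 : ℕ) : ℝ) := by push_cast; linarith [(Nat.cast_nonneg m : (0:ℝ) ≤ m)]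
    have hl := log_fact_le p.1
    have hl0 := log_fact_nonneg p.1
    have hp2 : (p.1 : ℝ) ≤ ((m + 2 : ℕ) : ℝ) := by exact_mod_cast hp1
    have hp0 : (0:ℝ) ≤ p.1 := by positivity
    set M : ℝ := ((m + 2 : ℕ) : ℝ)
    have : Real.sqrt |M * S.F T + Real.log (p.1.factorial : ℝ)| ≤ 2 * (S.sz T * M) := by
      rw [abs_of_nonneg (by positivity)]
      apply Real.sqrt_le_iff.2
      refine ⟨by positivity, ?_⟩
      have h1 : M * S.F T ≤ M * (S.sz T : ℝ) ^ 2 := by gcongr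
      have h2 : M * (S.sz T : ℝ) ^ 2 ≤ M ^ 2 * (S.sz T : ℝ) ^ 2 := by gcongr; nlinarith
      have h3 : Real.log (p.1.factorial : ℝ) ≤ M ^ 2 := hl.trans (by gcongr)
      have h4 : M ^ 2 * 1 ≤ M ^ 2 * (S.sz T : ℝ) ^ 2 := by gcongr; nlinarith
      have h5 : 0 ≤ M ^ 2 * (S.sz T : ℝ) ^ 2 := by positivity
      nlinarith
    push_cast
    have h7 := mul_le_mul_of_nonneg_left this hδ
    refine h7.trans (le_of_eq ?_)
    simp only [M]; push_cast; ring
  refine (Finset.sum_le_sum this).trans ?_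
  rw [← Finset.sum_mul]
  gcongr
  rw [← ENNReal.ofReal_sum_of_nonneg (fun p _ => by positivity)]
  exact ENNReal.ofReal_le_ofReal (sum_anti_exp _)

theorem nu_psi {ρ : ℝ} (h0 : 0 < ρ) (h1 : ρ < 1) (hP : S.Pv (ENNReal.ofReal ρ) ≠ ∞) {r : ℝ} (hr : ρ < r) (hr2 : r < Real.sqrt ρ) :
    ∃ δ : ℝ, 0 < δ ∧ nv (nu δ) (ENNReal.ofReal r) (S.psi EU) ≠ ∞ := by
  have hr0 : 0 < r := h0.trans hr
  have hq : 1 < Real.sqrt ρ / r := by rwa [one_lt_div hr0]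
  refine ⟨Real.log (Real.sqrt ρ / r) / 2, by have := Real.log_pos hq; positivity, ?_⟩
  have hd : 0 ≤ Real.log (Real.sqrt ρ / r) / 2 := by have := Real.log_pos hq; positivity
  have e0 : ENNReal.ofReal (Real.exp (2 * (Real.log (Real.sqrt ρ / r) / 2))) * ENNReal.ofReal r = ENNReal.ofReal (Real.sqrt ρ) := by
    rw [← ENNReal.ofReal_mul (Real.exp_pos _).le, mul_div_cancel₀ _ (by norm_num), Real.exp_log (by linarith), div_mul_cancel₀ _ hr0.ne']
  refine (S.nv_psi_geom EU (SM_nu hd) (ENNReal.ofReal r) (ENNReal.ofReal (Real.exp 1)) (ENNReal.ofReal (Real.exp (2 * (Real.log (Real.sqrt ρ / r) / 2)))) (by simp) ?_ (by simp) (S.nu_b hd) ?_).ne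
  · rw [e0, ENNReal.ofReal_lt_one, Real.sqrt_lt' (by norm_num)]; simpa
  · rw [e0]
    simp_rw [pow_mul, ← ENNReal.ofReal_pow (Real.sqrt_nonneg ρ) 2, Real.sq_sqrt h0.le]
    exact hP

end
end PSys

namespace PSys
open PowerSeries
open scoped ENNReal

theorem exp_two (u : ℝ) : ‖Complex.exp (u * Complex.I) - 1 - u * Complex.I‖ ≤ 3 * u ^ 2 := by
  have hn : ‖(u : ℂ) * Complex.I‖ = |u| := by simp
  by_cases h : |u| ≤ 1
  · have := Complex.norm_exp_sub_one_sub_id_le (x := u * Complex.I) (by rwa [hn])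
    rw [hn, sq_abs] at this
    nlinarith [sq_nonneg u]
  · push Not at h
    have h1 : ‖Complex.exp (u * Complex.I)‖ = 1 := Complex.norm_exp_ofReal_mul_I u
    have := norm_sub_le (Complex.exp (u * Complex.I) - 1) (u * Complex.I)
    have h2 := norm_sub_le (Complex.exp (u * Complex.I)) 1
    rw [h1, norm_one] at h2
    rw [hn] at this
    nlinarith [sq_abs u]

theorem exp_three (u : ℝ) : ‖Complex.exp (u * Complex.I) - 1 - u * Complex.I + u ^ 2 / 2‖ ≤ 4 * |u| ^ 3 := by
  have hn : ‖(u : ℂ) * Complex.I‖ = |u| := by simp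
  by_cases h : |u| ≤ 1
  · have := Complex.exp_bound (x := u * Complex.I) (by rwa [hn]) (n := 3) (by norm_num)
    rw [hn] at this
    have e : Complex.exp (u * Complex.I) - 1 - u * Complex.I + u ^ 2 / 2 = Complex.exp (u * Complex.I) - ∑ m ∈ Finset.range 3, (u * Complex.I) ^ m / m.factorial := by
      simp [Finset.sum_range_succ, Nat.factorial, mul_pow]; ring
    rw [e]
    refine this.trans ?_
    have : 0 ≤ |u| ^ 3 := by positivity
    norm_num [Nat.factorial]; nlinarith
  · push Not at h
    have := norm_add_le (Complex.exp (u * Complex.I) - 1 - u * Complex.I) ((u : ℂ) ^ 2 / 2)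
    have h2 := exp_two u
    have h3 : ‖(u : ℂ) ^ 2 / 2‖ = u ^ 2 / 2 := by simp
    rw [h3] at this
    have h4 : |u| ^ 2 ≤ |u| ^ 3 := pow_le_pow_right₀ h.le (by norm_num)
    rw [sq_abs] at h4
    nlinarith [sq_nonneg u]

noncomputable def Et (θ : ℝ) : Multiplicative ℝ →* ℂ where
  toFun y := Complex.exp ((θ * y.toAdd : ℝ) * Complex.I)
  map_one' := by simp
  map_mul' x y := by rw [← Complex.exp_add, ← add_mul, ← Complex.ofReal_add, ← mul_add]; rfl

theorem Et_apply (θ y : ℝ) : Et θ (Multiplicative.ofAdd y) = Complex.exp ((θ * y : ℝ) * Complex.I) := rfl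

theorem Et_norm (θ : ℝ) (y : Multiplicative ℝ) : ‖Et θ y‖ = 1 := Complex.norm_exp_ofReal_mul_I _

theorem beta_dom (θ : ℝ) (m : ℕ) : ‖coeff (m + 2) (betaS (Et θ))‖ ≤ coeff (m + 2) (betaS E1) + 100 * θ ^ 2 * ((m : ℝ) + 2) ^ 4 := by
  have he : Real.exp 1 < 3 := Real.exp_one_lt_d9.trans (by norm_num)
  have he0 : 0 < Real.exp 1 := Real.exp_pos 1
  set B1 : ℝ := ∑ p ∈ Finset.HasAntidiagonal.antidiagonal (m + 2), Real.log (p.1.factorial : ℝ) * ((-1) ^ p.2 / p.2.factorial) with hB1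
  set B0 := coeff (m + 2) (betaS E1) with hB0
  have hb0 : 1 / 3 ≤ B0 := beta_ge m
  have hsgn : ∀ k : ℕ, |((-1 : ℝ)) ^ k / (k.factorial : ℝ)| = 1 / k.factorial := by intro k; rw [abs_div, abs_pow]; simp
  have hlog : ∀ p ∈ Finset.HasAntidiagonal.antidiagonal (m + 2), Real.log (p.1.factorial : ℝ) ≤ ((m : ℝ) + 2) ^ 2 := by
    intro p hp
    have hp1 : p.1 ≤ m + 2 := by rw [Finset.HasAntidiagonal.mem_antidiagonal] at hp; omega
    refine (log_fact_le _).trans ?_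
    gcongr; exact_mod_cast hp1
  have hsum := sum_anti_exp (m + 2)
  have hB1' : |B1| ≤ 3 * ((m : ℝ) + 2) ^ 2 := by
    rw [hB1]
    refine (Finset.abs_sum_le_sum_abs _ _).trans ?_
    calc _ ≤ ∑ p ∈ Finset.HasAntidiagonal.antidiagonal (m + 2), ((m : ℝ) + 2) ^ 2 * ((1 : ℝ) / p.2.factorial) := by
          refine Finset.sum_le_sum fun p hp => ?_
          rw [abs_mul, hsgn, abs_of_nonneg (log_fact_nonneg _)]
          gcongr; exact hlog p hp
      _ ≤ _ := by rw [← Finset.mul_sum]; nlinarith [sq_nonneg ((m : ℝ) + 2)]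
  have hrem : ‖coeff (m + 2) (betaS (Et θ)) - (B0 + (θ * B1 : ℝ) * Complex.I)‖ ≤ 9 * θ ^ 2 * ((m : ℝ) + 2) ^ 4 := by
    have e : coeff (m + 2) (betaS (Et θ)) - (B0 + (θ * B1 : ℝ) * Complex.I) =
      ∑ p ∈ Finset.HasAntidiagonal.antidiagonal (m + 2), (Complex.exp ((θ * Real.log (p.1.factorial : ℝ) : ℝ) * Complex.I) - 1 - (θ * Real.log (p.1.factorial : ℝ) : ℝ) * Complex.I) * (((-1 : ℝ) ^ p.2 / p.2.factorial : ℝ) : ℂ) := by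
      rw [hB0, coeff_beta, coeff_beta, hB1]
      push_cast
      rw [Finset.mul_sum, Finset.sum_mul, ← Finset.sum_add_distrib, ← Finset.sum_sub_distrib]
      refine Finset.sum_congr rfl fun p _ => ?_
      rw [Et_apply]; simp; ring
    rw [e]
    refine (norm_sum_le _ _).trans ?_
    calc _ ≤ ∑ p ∈ Finset.HasAntidiagonal.antidiagonal (m + 2), 3 * θ ^ 2 * ((m : ℝ) + 2) ^ 4 * ((1 : ℝ) / p.2.factorial) := by
          refine Finset.sum_le_sum fun p hp => ?_
          rw [norm_mul, Complex.norm_real, Real.norm_eq_abs, hsgn]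
          gcongr
          refine (exp_two _).trans ?_
          rw [mul_pow, mul_assoc]
          have := pow_le_pow_left₀ (log_fact_nonneg _) (hlog p hp) 2
          rw [← pow_mul] at this
          gcongr
      _ ≤ _ := by
        rw [← Finset.mul_sum]
        have : 0 ≤ 3 * θ ^ 2 * ((m : ℝ) + 2) ^ 4 := by positivity
        nlinarith
  have hmain : ‖(B0 + (θ * B1 : ℝ) * Complex.I : ℂ)‖ ≤ B0 + 2 * θ ^ 2 * B1 ^ 2 := by
    rw [Complex.norm_add_mul_I]
    apply Real.sqrt_le_iff.2
    refine ⟨by positivity, ?_⟩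
    have : 0 ≤ θ ^ 2 * B1 ^ 2 := by positivity
    nlinarith
  have hq : B1 ^ 2 ≤ 9 * ((m : ℝ) + 2) ^ 4 := by
    have := pow_le_pow_left₀ (abs_nonneg _) hB1' 2
    rw [sq_abs] at this; nlinarith
  have ht : θ ^ 2 * B1 ^ 2 ≤ θ ^ 2 * (9 * ((m : ℝ) + 2) ^ 4) := by gcongr
  have h0 : 0 ≤ θ ^ 2 * ((m : ℝ) + 2) ^ 4 := by positivity
  have htri := norm_add_le (coeff (m + 2) (betaS (Et θ)) - (B0 + (θ * B1 : ℝ) * Complex.I)) (B0 + (θ * B1 : ℝ) * Complex.I)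
  rw [sub_add_cancel] at htri
  linarith

section
variable {𝒯 : Type} (S : PSys 𝒯)

theorem psiN_le (N n : ℕ) : coeff n (S.psiN E1 N) ≤ coeff n S.ps := by
  unfold ps
  rw [S.psi_coeff E1 (le_max_right N n)]
  have hsub : S.upto N ⊆ S.upto (max N n) := by
    intro T; rw [mem_upto, mem_upto]; intro h; exact h.trans (le_max_left _ _)
  have e : S.psiN E1 (max N n) = S.psiN E1 N * ∏ T ∈ S.upto (max N n) \ S.upto N, S.bT E1 T := by
    unfold psiN; rw [← Finset.prod_sdiff hsub]; ring
  rw [e, coeff_mul]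
  have h1 := Finset.single_le_sum (f := fun p : ℕ × ℕ => coeff p.1 (S.psiN E1 N) *
    coeff p.2 (∏ T ∈ S.upto (max N n) \ S.upto N, S.bT E1 T))
    (fun p _ => mul_nonneg (S.NN_psiN _ _) (NN.prod (fun T => S.NN_bT T) _))
    (show (n, 0) ∈ Finset.HasAntidiagonal.antidiagonal n by simp)
  refine le_trans (le_of_eq ?_) h1
  have h2 : coeff 0 (∏ T ∈ S.upto (max N n) \ S.upto N, S.bT E1 T) = 1 := by
    rw [coeff_zero_eq_constantCoeff_apply, map_prod]
    apply Finset.prod_eq_one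
    intro T _
    rw [← coeff_zero_eq_constantCoeff_apply, bT_zero]
  simp only [h2, mul_one]

theorem nv_psiN_le (x : ℝ≥0∞) (N : ℕ) : nv na x (S.psiN E1 N) ≤ nv na x S.ps := by
  refine ENNReal.tsum_le_tsum fun n => ?_
  rw [na_of (S.NN_psiN _ _), na_of (S.NN_ps _)]
  gcongr; exact S.psiN_le N n

theorem nv_bT_dom (θ : ℝ) (x : ℝ≥0∞) (T : 𝒯) : nv (fun z : ℂ => ‖z‖ₑ) x (S.bT (Et θ) T) ≤
    nv na x (S.bT E1 T) * (1 + ENNReal.ofReal (100 * θ ^ 2) * ∑' m : ℕ, ENNReal.ofReal (((m : ℝ) + 2) ^ 4) * x ^ (S.sz T * (m + 2))) := by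
  have h0 : nv na x (S.bT E1 T) = 1 + ∑' m, ENNReal.ofReal (coeff (m + 2) (betaS E1)) * x ^ (S.sz T * (m + 2)) := by
    unfold bT
    rw [nv_expand (by simp), resc_one, ← Summable.sum_add_tsum_nat_add' (k := 2) (f := fun m => na (coeff m (betaS E1)) * x ^ (S.sz T * m)) ENNReal.summable]
    rw [Finset.sum_range_succ, Finset.sum_range_one, beta0, beta1]
    simp only [na_of (NN_beta _)]
    simp
  refine (S.nv_bT (Et θ) SM_enorm x T).trans ?_
  rw [mul_add, mul_one]
  calc _ ≤ 1 + ∑' m, (ENNReal.ofReal (coeff (m + 2) (betaS E1)) * x ^ (S.sz T * (m + 2)) +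
        ENNReal.ofReal (100 * θ ^ 2) * (ENNReal.ofReal (((m : ℝ) + 2) ^ 4) * x ^ (S.sz T * (m + 2)))) := by
        gcongr with m
        rw [← mul_assoc, ← add_mul, ← ENNReal.ofReal_mul (by positivity), ← ENNReal.ofReal_add (NN_beta _) (by positivity)]
        gcongr
        rw [← ofReal_norm_eq_enorm]
        apply ENNReal.ofReal_le_ofReal
        rw [norm_mul, norm_pow, w, Et_norm, one_pow, one_mul]
        exact beta_dom θ m
    _ = nv na x (S.bT E1 T) + ENNReal.ofReal (100 * θ ^ 2) * ∑' m : ℕ, ENNReal.ofReal (((m : ℝ) + 2) ^ 4) * x ^ (S.sz T * (m + 2)) := by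
        rw [ENNReal.tsum_add, ENNReal.tsum_mul_left, ← add_assoc, h0]
    _ ≤ _ := by
        refine add_le_add le_rfl (le_mul_of_one_le_left (by simp) ?_)
        rw [h0]; exact le_self_add

theorem dom (x : ℝ) (h0 : 0 ≤ x) (h1 : x < 1) (hP : S.Pv (ENNReal.ofReal (x ^ 2)) ≠ ∞) : ∃ K : ℝ, 0 ≤ K ∧ ∀ y, 0 ≤ y → y ≤ x → ∀ θ,
    nv (fun z : ℂ => ‖z‖ₑ) (ENNReal.ofReal y) (S.psi (Et θ)) ≤ nv na (ENNReal.ofReal y) S.ps * ENNReal.ofReal (Real.exp (K * θ ^ 2)) := by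
  set Y : 𝒯 → ℝ≥0∞ := fun T => ∑' m : ℕ, ENNReal.ofReal (((m : ℝ) + 2) ^ 4) * (ENNReal.ofReal x) ^ (S.sz T * (m + 2)) with hY
  have hYs : ∑' T, Y T ≠ ∞ := by
    have hs : Summable (fun m : ℕ => ((m : ℝ) + 2) ^ 4 * x ^ m) := by
      have := summable_pow_mul_geometric_of_norm_lt_one 4 (r := x) (by rwa [Real.norm_eq_abs, abs_of_nonneg h0])
      have h2 := (summable_nat_add_iff 2).2 this
      rcases h0.eq_or_lt with rfl | hx
      · exact summable_of_ne_finset_zero (s := {0}) (fun m hm => by simp at hm; simp [hm])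
      · refine (h2.mul_left ((x ^ 2)⁻¹)).congr fun m => ?_
        push_cast; field_simp; ring
    have hb : ∀ T, Y T ≤ ENNReal.ofReal (∑' m : ℕ, ((m : ℝ) + 2) ^ 4 * x ^ m) * (ENNReal.ofReal (x ^ 2)) ^ (S.sz T) := by
      intro T
      rw [ENNReal.ofReal_tsum_of_nonneg (fun m => by positivity) hs, ← ENNReal.tsum_mul_right]
      refine ENNReal.tsum_le_tsum fun m => ?_
      rw [ENNReal.ofReal_mul (by positivity), mul_assoc]
      gcongr
      rw [← ENNReal.ofReal_pow h0, ← ENNReal.ofReal_pow (by positivity), ← ENNReal.ofReal_mul (by positivity)]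
      apply ENNReal.ofReal_le_ofReal
      rw [← pow_mul, ← pow_add]
      apply pow_le_pow_of_le_one h0 h1.le
      nlinarith [S.sz_pos T]
    refine ne_top_of_le_ne_top ?_ (ENNReal.tsum_le_tsum hb)
    rw [ENNReal.tsum_mul_left]
    exact ENNReal.mul_ne_top (by simp) hP
  refine ⟨100 * (∑' T, Y T).toReal, by positivity, fun y hy0 hyx θ => ?_⟩
  apply nv_psi_le
  intro M
  have hX : nv (fun z : ℂ => ‖z‖ₑ) (ENNReal.ofReal y) X ≤ ENNReal.ofReal y := nv_X SM_enorm _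
  calc nv (fun z : ℂ => ‖z‖ₑ) (ENNReal.ofReal y) (S.psiN (Et θ) M) ≤ ENNReal.ofReal y * ∏ T ∈ S.upto M, nv (fun z : ℂ => ‖z‖ₑ) (ENNReal.ofReal y) (S.bT (Et θ) T) := by
        unfold psiN
        refine (nv_mul SM_enorm _ _ _).trans ?_
        gcongr
        exact nv_prod SM_enorm _ _ _
    _ ≤ ENNReal.ofReal y * ∏ T ∈ S.upto M, (nv na (ENNReal.ofReal y) (S.bT E1 T) * (1 + ENNReal.ofReal (100 * θ ^ 2) * Y T)) := by
        refine mul_le_mul_right (Finset.prod_le_prod' fun T _ => ?_) _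
        refine (S.nv_bT_dom θ _ T).trans ?_
        simp only [hY]
        gcongr
    _ = nv na (ENNReal.ofReal y) (S.psiN E1 M) * ∏ T ∈ S.upto M, (1 + ENNReal.ofReal (100 * θ ^ 2) * Y T) := by
        rw [Finset.prod_mul_distrib, ← mul_assoc]
        unfold psiN
        rw [nv_mul_eq _ NN.X (NN.prod fun T => S.NN_bT T), nv_X_eq, nv_prod_eq _ _ (fun T => S.NN_bT T)]
    _ ≤ _ := by
        gcongr
        · exact S.nv_psiN_le _ _
        · refine (prod_one_add_le _ _ ?_).trans ?_
          · rw [ENNReal.tsum_mul_left]; exact ENNReal.mul_ne_top ENNReal.ofReal_ne_top hYs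
          · rw [ENNReal.tsum_mul_left, ENNReal.toReal_mul, ENNReal.toReal_ofReal (by positivity)]
            apply ENNReal.ofReal_le_ofReal
            apply Real.exp_le_exp.2
            apply le_of_eq; ring
end
end PSys

namespace PSys
open PowerSeries
open scoped ENNReal

structure Ren where
  f : ℝ⟦X⟧
  f1 : ℝ⟦X⟧
  f2 : ℝ⟦X⟧
  h : ℝ → ℂ⟦X⟧
  v : ℕ → ℝ
  R : ℝ
  K : ℝ
  hR : 1 < R
  hK : 0 ≤ K
  f_nn : NN f
  f_0 : coeff 0 f = 0
  f_1 : 0 < coeff 1 f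
  f_sum : HasSum (fun j => coeff j f) 1
  v_sum : Summable fun j => v j * R ^ j
  f_v : ∀ j, |coeff j f| ≤ v j
  f1_v : ∀ j, |coeff j f1| ≤ v j
  f2_v : ∀ j, |coeff j f2| ≤ v j
  f1_sum : HasSum (fun j => coeff j f1) 0
  h_0 : ∀ θ, coeff 0 (h θ) = 0
  h_v : ∀ θ j, ‖coeff j (h θ) - (coeff j f + θ * coeff j f1 * Complex.I - θ ^ 2 * coeff j f2)‖ ≤ |θ| ^ 3 * v j
  h_sum : ∀ θ x, 0 ≤ x → x ≤ R → Summable fun j => ‖coeff j (h θ)‖ * x ^ j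
  h_dom : ∀ θ x, 0 ≤ x → x ≤ R → ∑' j, ‖coeff j (h θ)‖ * x ^ j ≤ (∑' j, coeff j f * x ^ j) * Real.exp (K * θ ^ 2)

section
variable {𝒯 : Type} (S : PSys 𝒯)

theorem psi_map {R R' : Type} [CommRing R] [Algebra ℝ R] [Algebra ℚ R] [CommRing R'] [Algebra ℝ R'] [Algebra ℚ R']
    (E : Multiplicative ℝ →* R) (E' : Multiplicative ℝ →* R') (φ : R →+* R') (h : ∀ y, φ (E y) = E' y) (j : ℕ) :
    φ (coeff j (S.psi E)) = coeff j (S.psi E') := by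
  have hb : ∀ T, map φ (S.bT E T) = S.bT E' T := by
    intro T
    unfold bT betaS
    rw [map_expand, ← rescale_map, map_mul, ← rescale_map, map_exp]
    congr 2
    · unfold w; rw [h]
    · congr 1
      · ext n; simp [qS, h]
      · congr 1; simp
  unfold psi
  rw [coeff_mk, coeff_mk, ← coeff_map]
  congr 1
  unfold psiN
  rw [map_mul, map_prod, map_X]
  simp_rw [hb]

noncomputable def HU (ρ μ : ℝ) : U⟦X⟧ := C (algebraMap ℝ U (Real.exp 1)) * rescale (AddMonoidAlgebra.single (-μ) ρ : U) (S.psi EU)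

theorem HU_pow (ρ μ : ℝ) (k n : ℕ) : coeff n (S.HU ρ μ ^ k) = AddMonoidAlgebra.single (-(μ * n)) (Real.exp k * ρ ^ n) * coeff n (S.psi EU ^ k) := by
  unfold HU
  rw [mul_pow, ← map_pow, ← map_pow, ← map_pow, coeff_C_mul, coeff_rescale, AddMonoidAlgebra.single_pow, ← mul_assoc]
  congr 1
  rw [← Real.exp_nat_mul, mul_one]
  simp [AddMonoidAlgebra.single_mul_single, mul_comm]

theorem identU (ρ μ : ℝ) (n : ℕ) : ∑ T ∈ S.lvl n, (AddMonoidAlgebra.single (S.F T - μ * n) (ρ ^ n) : U) =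
    ∑ k ∈ Finset.range (n + 1), algebraMap ℝ U (cc k) * coeff n (S.HU ρ μ ^ k) := by
  have h := congrArg (fun a : U => AddMonoidAlgebra.single (-(μ * n)) (ρ ^ n) * a) (S.ident EU n)
  simp only [Finset.mul_sum] at h
  refine Eq.trans (Eq.trans ?_ h) ?_
  · refine Finset.sum_congr rfl fun T _ => ?_
    unfold w
    rw [EU_apply, AddMonoidAlgebra.single_mul_single, mul_one]
    congr 1; ring
  · refine Finset.sum_congr rfl fun k _ => ?_
    rw [HU_pow, ← mul_assoc, ← mul_assoc]
    congr 1
    have : algebraMap ℝ U (TF.tc k) = algebraMap ℝ U (cc k) * algebraMap ℝ U (Real.exp k) := by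
      rw [← map_mul, cc, mul_assoc, ← Real.exp_add, neg_add_cancel, Real.exp_zero, mul_one]
    rw [this, mul_comm, mul_assoc]
    congr 1
    simp [AddMonoidAlgebra.single_mul_single]

noncomputable def aj (j : ℕ) : U := coeff j (S.psi EU)
noncomputable def Lf {M : Type} [AddCommGroup M] [Module ℝ M] (a : U) (φ : ℝ → M) : M := a.coeff.sum fun y c => c • φ y

theorem lift_H {A : Type} [CommRing A] [Algebra ℝ A] (E : Multiplicative ℝ →* A) (ρ μ : ℝ) (j : ℕ) :
    AddMonoidAlgebra.lift ℝ A ℝ E (coeff j (S.HU ρ μ)) = (Real.exp 1 * ρ ^ j) • Lf (S.aj j) (fun y => E (Multiplicative.ofAdd (y - μ * j))) := by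
  have := S.HU_pow ρ μ 1 j
  rw [pow_one, pow_one, Nat.cast_one] at this
  rw [this, map_mul, AddMonoidAlgebra.lift_single, smul_mul_assoc]
  congr 1
  rw [AddMonoidAlgebra.lift_apply]
  unfold Lf Finsupp.sum aj
  rw [Finset.mul_sum]
  refine Finset.sum_congr rfl fun y _ => ?_
  rw [mul_smul_comm, ← map_mul, ← ofAdd_add]
  congr 3; ring

theorem lift_ident {A : Type} [CommRing A] [Algebra ℝ A] (E : Multiplicative ℝ →* A) (ρ μ : ℝ) (n : ℕ) :
    ∑ T ∈ S.lvl n, ρ ^ n • E (Multiplicative.ofAdd (S.F T - μ * n)) =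
    ∑ k ∈ Finset.range (n + 1), cc k • coeff n (map (AddMonoidAlgebra.lift ℝ A ℝ E : U →+* A) (S.HU ρ μ) ^ k) := by
  have := congrArg (AddMonoidAlgebra.lift ℝ A ℝ E) (S.identU ρ μ n)
  rw [map_sum, map_sum] at this
  simp only [AddMonoidAlgebra.lift_single, map_mul, AlgHom.commutes] at this
  rw [this]
  refine Finset.sum_congr rfl fun k _ => ?_
  rw [← map_pow, coeff_map, Algebra.smul_def]; rfl

-- jets
noncomputable def EJ : Multiplicative ℝ →* ℝ⟦X⟧ where
  toFun y := rescale y.toAdd (PowerSeries.exp ℝ)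
  map_one' := by
    ext n; simp [coeff_rescale, coeff_exp, coeff_one]
  map_mul' x y := (exp_mul_exp_eq_exp_add x.toAdd y.toAdd).symm

theorem EJ_coeff (y : ℝ) (i : ℕ) : coeff i (EJ (Multiplicative.ofAdd y)) = y ^ i / i.factorial := by
  show coeff i (rescale y (PowerSeries.exp ℝ)) = _
  rw [coeff_rescale, coeff_exp]; simp [div_eq_mul_inv]

noncomputable def Dj (i : ℕ) (P : (ℝ⟦X⟧)⟦X⟧) : ℝ⟦X⟧ := PowerSeries.mk fun n => coeff i (coeff n P)

theorem Dj0 (P Q : (ℝ⟦X⟧)⟦X⟧) : Dj 0 (P * Q) = Dj 0 P * Dj 0 Q := by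
  ext n; simp [Dj, coeff_mul]
theorem Dj1 (P Q : (ℝ⟦X⟧)⟦X⟧) : Dj 1 (P * Q) = Dj 0 P * Dj 1 Q + Dj 1 P * Dj 0 Q := by
  ext n; simp only [Dj, coeff_mk, coeff_mul, map_add, map_sum, ← Finset.sum_add_distrib]
  refine Finset.sum_congr rfl fun p _ => ?_
  rw [Finset.Nat.sum_antidiagonal_eq_sum_range_succ_mk]
  simp [Finset.sum_range_succ]
theorem Dj2 (P Q : (ℝ⟦X⟧)⟦X⟧) : Dj 2 (P * Q) = Dj 0 P * Dj 2 Q + Dj 1 P * Dj 1 Q + Dj 2 P * Dj 0 Q := by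
  ext n; simp only [Dj, coeff_mk, coeff_mul, map_add, map_sum, ← Finset.sum_add_distrib]
  refine Finset.sum_congr rfl fun p _ => ?_
  rw [Finset.Nat.sum_antidiagonal_eq_sum_range_succ_mk]
  simp [Finset.sum_range_succ]
theorem Dj_one (i : ℕ) : Dj i 1 = if i = 0 then 1 else 0 := by
  ext n; simp only [Dj, coeff_mk]; rw [coeff_one]
  split_ifs with h1 h2 h2 <;> simp [coeff_one, h1, h2]
theorem Dj0_pow (P : (ℝ⟦X⟧)⟦X⟧) (k : ℕ) : Dj 0 (P ^ k) = Dj 0 P ^ k := by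
  induction k with
  | zero => simp [Dj_one]
  | succ k ih => rw [pow_succ, Dj0, ih, pow_succ]
theorem Dj1_pow (P : (ℝ⟦X⟧)⟦X⟧) (k : ℕ) : Dj 1 (P ^ k) = (k : ℝ) • (Dj 0 P ^ (k - 1) * Dj 1 P) := by
  induction k with
  | zero => simp [Dj_one]
  | succ k ih =>
    rw [pow_succ, Dj1, Dj0_pow, ih]
    rcases k with _ | k
    · simp
    · have e2 : ((k + 1 + 1 : ℕ) : ℝ) = ((k + 1 : ℕ) : ℝ) + 1 := by push_cast; ring
      rw [e2]
      simp only [Nat.add_sub_cancel, Algebra.smul_def, map_add, map_one]; ring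
theorem Dj2_pow (P : (ℝ⟦X⟧)⟦X⟧) (k : ℕ) : Dj 2 (P ^ k) = (k : ℝ) • (Dj 0 P ^ (k - 1) * Dj 2 P) + ((k : ℝ) * (k - 1) / 2) • (Dj 0 P ^ (k - 2) * Dj 1 P ^ 2) := by
  induction k with
  | zero => simp [Dj_one]
  | succ k ih =>
    rw [pow_succ, Dj2, Dj0_pow, ih, Dj1_pow]
    rcases k with _ | k
    · simp
    · rcases k with _ | k
      · ext n; simp [pow_two]; ring
      · have e : ((k + 1 + 1 + 1 : ℕ) : ℝ) * ((k + 1 + 1 + 1 : ℕ) - 1) / 2 = ((k + 1 + 1 : ℕ) : ℝ) * ((k + 1 + 1 : ℕ) - 1) / 2 + ((k + 1 + 1 : ℕ) : ℝ) := by push_cast; ring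
        rw [e]
        have e2 : ((k + 1 + 1 + 1 : ℕ) : ℝ) = ((k + 1 + 1 : ℕ) : ℝ) + 1 := by push_cast; ring
        rw [e2]
        simp only [Nat.add_sub_cancel, Algebra.smul_def, map_add, map_one]
        have e3 : k + 1 + 1 + 1 - 2 = k + 1 := by omega
        have e4 : k + 1 + 1 - 2 = k := by omega
        rw [e3, e4]; ring
end
end PSys

namespace PSys
open PowerSeries
open scoped ENNReal

theorem cube_wt {δ : ℝ} (hδ : 0 < δ) (y : ℝ) : (1 + |y|) ^ 3 ≤ 8 * (1 + 720 / δ ^ 6) * Real.exp (δ * Real.sqrt |y|) := by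
  set t := δ * Real.sqrt |y| with ht
  have ht0 : 0 ≤ t := by positivity
  have h1 := Real.pow_div_factorial_le_exp t ht0 6
  have h6 : t ^ 6 = δ ^ 6 * |y| ^ 3 := by
    rw [ht, mul_pow, show Real.sqrt |y| ^ 6 = (Real.sqrt |y| ^ 2) ^ 3 by ring, Real.sq_sqrt (abs_nonneg y)]
  have hf : ((Nat.factorial 6 : ℕ) : ℝ) = 720 := by norm_num [Nat.factorial]
  rw [h6, hf] at h1
  have h2 : 1 ≤ Real.exp t := Real.one_le_exp ht0
  have h3 : |y| ^ 3 ≤ 720 / δ ^ 6 * Real.exp t := by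
    have hd : 0 < δ ^ 6 := by positivity
    rw [div_mul_eq_mul_div, le_div_iff₀ hd]; linarith
  have h4 : (1 + |y|) ^ 3 ≤ 8 * (1 + |y| ^ 3) := by
    have := abs_nonneg y
    nlinarith [mul_nonneg this (sq_nonneg (|y| - 1)), sq_nonneg (|y| - 1)]
  linarith

theorem Lf_bd {M : Type} [NormedAddCommGroup M] [NormedSpace ℝ M] {δ : ℝ} (a : U) (ha : nu δ a ≠ ∞) (φ : ℝ → M) (B : ℝ)
    (h : ∀ y, ‖φ y‖ ≤ B * Real.exp (δ * Real.sqrt |y|)) : ‖Lf a φ‖ ≤ B * (nu δ a).toReal := by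
  unfold Lf Finsupp.sum
  refine (norm_sum_le _ _).trans ?_
  rw [nu_eq_sum, ENNReal.toReal_sum (fun y _ => ENNReal.mul_ne_top (by simp) (by simp [wt])), Finset.mul_sum]
  refine Finset.sum_le_sum fun y _ => ?_
  rw [norm_smul, ENNReal.toReal_mul, wt, ENNReal.toReal_ofReal (Real.exp_pos _).le]
  have : (‖a.coeff y‖ₑ).toReal = ‖a.coeff y‖ := by simp
  rw [this]
  calc _ ≤ ‖a.coeff y‖ * (B * Real.exp (δ * Real.sqrt |y|)) := by gcongr; exact h y
    _ = _ := by ring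

theorem Lf_add (a : U) {M : Type} [AddCommGroup M] [Module ℝ M] (φ ψ : ℝ → M) : Lf a (fun y => φ y + ψ y) = Lf a φ + Lf a ψ := by
  unfold Lf Finsupp.sum; rw [← Finset.sum_add_distrib]; simp
theorem Lf_smul (a : U) {M N : Type} [AddCommGroup M] [Module ℝ M] [AddCommGroup N] [Module ℝ N] (L : M →ₗ[ℝ] N) (φ : ℝ → M) : Lf a (fun y => L (φ y)) = L (Lf a φ) := by
  unfold Lf Finsupp.sum; rw [map_sum]; simp

section
variable {𝒯 : Type} (S : PSys 𝒯)

theorem zbd (μ y : ℝ) (j : ℕ) : |y - μ * j| ≤ (1 + |μ|) * (1 + j) * (1 + |y|) := by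
  have := abs_sub y (μ * j)
  rw [abs_mul, Nat.abs_cast] at this
  nlinarith [abs_nonneg y, abs_nonneg μ, (Nat.cast_nonneg j : (0:ℝ) ≤ j), mul_nonneg (abs_nonneg μ) (abs_nonneg y),
   mul_nonneg (Nat.cast_nonneg j : (0:ℝ) ≤ j) (abs_nonneg y), mul_nonneg (mul_nonneg (Nat.cast_nonneg j : (0:ℝ) ≤ j) (abs_nonneg y)) (abs_nonneg μ), mul_nonneg (Nat.cast_nonneg j : (0:ℝ) ≤ j) (abs_nonneg μ)]

theorem zpow (μ y : ℝ) (j i : ℕ) (hi : i ≤ 3) : |y - μ * j| ^ i ≤ ((1 + |μ|) * (1 + j)) ^ 3 * (1 + |y|) ^ 3 := by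
  have h1 : 1 ≤ (1 + |μ|) * (1 + j) * (1 + |y|) := by
    have a1 : 1 ≤ 1 + |μ| := by linarith [abs_nonneg μ]
    have a2 : (1:ℝ) ≤ 1 + j := by linarith [(Nat.cast_nonneg j : (0:ℝ) ≤ j)]
    have a3 : 1 ≤ 1 + |y| := by linarith [abs_nonneg y]
    exact one_le_mul_of_one_le_of_one_le (one_le_mul_of_one_le_of_one_le a1 a2) a3
  rw [← mul_pow]
  exact (pow_le_pow_left₀ (abs_nonneg _) (zbd μ y j) i).trans (pow_le_pow_right₀ h1 hi)

theorem summ_cube {q : ℝ} (h0 : 0 < q) (h1 : q < 1) : Summable fun j : ℕ => ((j : ℝ) + 1) ^ 3 * q ^ j := by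
  have h3 : Summable fun j : ℕ => ((j : ℝ)) ^ 3 * q ^ j := summable_pow_mul_geometric_of_norm_lt_one 3 (by rwa [Real.norm_eq_abs, abs_of_pos h0])
  have h4 : Summable fun j : ℕ => (((j + 1 : ℕ) : ℝ)) ^ 3 * q ^ (j + 1) := (summable_nat_add_iff (f := fun j : ℕ => ((j : ℝ)) ^ 3 * q ^ j) 1).2 h3
  refine (h4.mul_left q⁻¹).congr fun j => ?_
  push_cast; field_simp; ring

set_option maxHeartbeats 800000 in
theorem bd_ex {ρ : ℝ} (h0 : 0 < ρ) (h1 : ρ < 1) (hP : S.Pv (ENNReal.ofReal ρ) ≠ ∞) : ∃ R, 1 < R ∧ R * ρ < Real.sqrt ρ ∧ ∀ μ : ℝ, ∃ v : ℕ → ℝ,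
    (∀ j, 0 ≤ v j) ∧ (Summable fun j => v j * R ^ j) ∧ ∀ (j : ℕ) (M : Type) [NormedAddCommGroup M] [NormedSpace ℝ M] (φ : ℝ → M) (B : ℝ), 0 ≤ B →
      (∀ y, ‖φ y‖ ≤ 4 * B * (((1 + |μ|) * (1 + j)) ^ 3 * (1 + |y|) ^ 3)) → ‖(Real.exp 1 * ρ ^ j) • Lf (S.aj j) φ‖ ≤ B * v j := by
  have hsq : ρ < Real.sqrt ρ := by
    apply Real.lt_sqrt_of_sq_lt; nlinarith
  obtain ⟨r, hr, hr2⟩ := exists_between hsq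
  obtain ⟨R', hR1, hR2⟩ := exists_between hr
  have hr0 : 0 < r := h0.trans hr
  have hR0 : 0 < R' := h0.trans hR1
  have hRr : R' / ρ * ρ = R' := div_mul_cancel₀ _ h0.ne'
  have hRR : 1 < R' / ρ := by rwa [one_lt_div h0]
  obtain ⟨δ, hδ, hnu⟩ := S.nu_psi h0 h1 hP hr hr2
  obtain ⟨K0, hK0p, hK0⟩ : ∃ K0 : ℝ, 0 ≤ K0 ∧ ∀ y, (1 + |y|) ^ 3 ≤ K0 * Real.exp (δ * Real.sqrt |y|) := ⟨8 * (1 + 720 / δ ^ 6), by positivity, cube_wt hδ⟩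
  obtain ⟨N, hN⟩ : ∃ N : ℕ → ℝ, ∀ j, N j = (nu δ (S.aj j)).toReal := ⟨_, fun _ => rfl⟩
  have hNp : ∀ j, 0 ≤ N j := fun j => by rw [hN]; exact ENNReal.toReal_nonneg
  have hNs : Summable fun j => N j * r ^ j := by
    have := ENNReal.summable_toReal hnu
    refine this.congr fun j => ?_
    rw [ENNReal.toReal_mul, ENNReal.toReal_pow, ENNReal.toReal_ofReal hr0.le, hN]; rfl
  have hNf : ∀ j, nu δ (S.aj j) ≠ ∞ := by
    intro j
    have h := ENNReal.ne_top_of_tsum_ne_top hnu j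
    intro h2
    apply h
    show nu δ (S.aj j) * _ = ∞
    rw [h2, ENNReal.top_mul]
    apply pow_ne_zero; simpa using hr0
  refine ⟨R' / ρ, hRR, by rw [hRr]; linarith, fun μ => ⟨fun j => Real.exp 1 * ρ ^ j * (4 * ((1 + |μ|) * (1 + j)) ^ 3 * K0 * N j), fun j => by have := hNp j; positivity, ?_, ?_⟩⟩
  · have hg : Summable fun j : ℕ => ((j : ℝ) + 1) ^ 3 * (R' / r) ^ j := summ_cube (by positivity) ((div_lt_one hr0).2 hR2)
    obtain ⟨B, hB⟩ : ∃ B, ∀ j : ℕ, ((j : ℝ) + 1) ^ 3 * (R' / r) ^ j ≤ B := ⟨_, fun j => hg.le_tsum j (fun i _ => by positivity)⟩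
    refine Summable.of_nonneg_of_le (fun j => by have := hNp j; positivity) (fun j => ?_) ((hNs.mul_left (Real.exp 1 * (4 * (1 + |μ|) ^ 3 * K0) * B)))
    have hb : ((j : ℝ) + 1) ^ 3 * (R' / r) ^ j ≤ B := hB j
    have e1 : ρ ^ j * (R' / ρ) ^ j = (R' / r) ^ j * r ^ j := by
      rw [← mul_pow, ← mul_pow]; congr 1; field_simp
    have e : Real.exp 1 * ρ ^ j * (4 * ((1 + |μ|) * (1 + j)) ^ 3 * K0 * N j) * (R' / ρ) ^ j = Real.exp 1 * (4 * (1 + |μ|) ^ 3 * K0) * (((j : ℝ) + 1) ^ 3 * (R' / r) ^ j) * (N j * r ^ j) := by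
      linear_combination (Real.exp 1 * (4 * ((1 + |μ|) * (1 + j)) ^ 3 * K0 * N j)) * e1
    rw [e]
    have := hNp j
    gcongr
  · intro j M _ _ φ B hB hφ
    have := Lf_bd (S.aj j) (hNf j) φ (4 * B * ((1 + |μ|) * (1 + j)) ^ 3 * K0) (fun y => (hφ y).trans ?_)
    · rw [norm_smul, Real.norm_eq_abs, abs_of_nonneg (by positivity)]
      calc _ ≤ Real.exp 1 * ρ ^ j * (4 * B * ((1 + |μ|) * (1 + j)) ^ 3 * K0 * (nu δ (S.aj j)).toReal) := by gcongr
        _ = _ := by rw [← hN]; ring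
    · calc _ ≤ 4 * B * (((1 + |μ|) * (1 + j)) ^ 3 * (K0 * Real.exp (δ * Real.sqrt |y|))) := by
            gcongr
            exact hK0 y
        _ = _ := by ring

set_option maxHeartbeats 1000000 in
theorem ren_exists : ∃ (ρ μ : ℝ) (D : Ren), 0 < ρ ∧ ρ < 1 ∧ HasSum (fun n => ((S.lvl n).card : ℝ) * ρ ^ n) 1 ∧
    (∀ n, ((S.lvl n).card : ℝ) * ρ ^ n = ∑ k ∈ Finset.range (n + 1), cc k * coeff n (D.f ^ k)) ∧
    (∀ n, ρ ^ n * ∑ T ∈ S.lvl n, (S.F T - μ * n) = ∑ k ∈ Finset.range (n + 1), cc k * (k * coeff n (D.f ^ (k - 1) * D.f1))) ∧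
    (∀ n, ρ ^ n * ∑ T ∈ S.lvl n, (S.F T - μ * n) ^ 2 / 2 = ∑ k ∈ Finset.range (n + 1), cc k * (k * coeff n (D.f ^ (k - 1) * D.f2) + (k : ℝ) * (k - 1) / 2 * coeff n (D.f ^ (k - 2) * D.f1 ^ 2))) ∧
    (∀ θ n, (ρ ^ n : ℝ) * ∑ T ∈ S.lvl n, Complex.exp ((θ * (S.F T - μ * n) : ℝ) * Complex.I) = ∑ k ∈ Finset.range (n + 1), cc k * coeff n (D.h θ ^ k)) := by
  obtain ⟨ρ, h0, h1, hf, hp, hP⟩ := S.rho_exists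
  obtain ⟨R, hR, hRρ, hv⟩ := S.bd_ex h0 h1 hP
  have hs1 : Real.sqrt ρ < 1 := by rw [Real.sqrt_lt' (by norm_num)]; simpa
  obtain ⟨f, hfdef⟩ : ∃ f, f = map (AddMonoidAlgebra.lift ℝ ℝ ℝ E1 : U →+* ℝ) (S.HU ρ 0) := ⟨_, rfl⟩
  have hfL : ∀ j, coeff j f = (Real.exp 1 * ρ ^ j) • Lf (S.aj j) (fun y => (1:ℝ)) := by
    intro j
    rw [hfdef, coeff_map]
    exact S.lift_H E1 ρ 0 j
  have hfps : ∀ j, coeff j f = Real.exp 1 * (coeff j S.ps * ρ ^ j) := by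
    intro j
    rw [hfL, smul_eq_mul, mul_assoc]
    congr 1
    rw [mul_comm]; congr 1
    have := S.psi_map EU E1 (AddMonoidAlgebra.lift ℝ ℝ ℝ E1 : U →+* ℝ) (fun y => by simp [EU]) j
    rw [ps, ← this]
    show _ = AddMonoidAlgebra.lift ℝ ℝ ℝ E1 _
    rw [AddMonoidAlgebra.lift_apply]; rfl
  have hfnn : NN f := fun j => by rw [hfps]; have := S.NN_ps j; positivity
  have hfsum : HasSum (fun j => coeff j f) 1 := by
    have := hf.mul_left (Real.exp 1)
    rw [← Real.exp_add, add_neg_cancel, Real.exp_zero] at this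
    exact this.congr_fun (fun j => hfps j)
  have hf1 : 0 < coeff 1 f := by rw [hfps, ps, psi_one]; positivity
  have hf0 : coeff 0 f = 0 := by rw [hfps, ps, psi_zero]; ring
  have hone : ∀ (μ y : ℝ) (j : ℕ), (1 + (j:ℝ)) * (1 + |y|) ≤ ((1 + |μ|) * (1 + j)) ^ 3 * (1 + |y|) ^ 3 := by
    intro μ y j
    rw [← mul_pow]
    have a1 : 1 ≤ 1 + |μ| := by linarith [abs_nonneg μ]
    have a2 : (1:ℝ) ≤ 1 + j := by linarith [(Nat.cast_nonneg j : (0:ℝ) ≤ j)]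
    have a3 : 1 ≤ 1 + |y| := by linarith [abs_nonneg y]
    refine le_trans ?_ (le_self_pow₀ (one_le_mul_of_one_le_of_one_le (one_le_mul_of_one_le_of_one_le a1 a2) a3) (by norm_num))
    gcongr
    exact le_mul_of_one_le_left (by linarith) a1
  obtain ⟨g, hg⟩ : ∃ g : ℕ → ℝ, ∀ j, g j = (Real.exp 1 * ρ ^ j) • Lf (S.aj j) (fun y => y) := ⟨_, fun _ => rfl⟩
  have hsm : ∀ v : ℕ → ℝ, (∀ j, 0 ≤ v j) → (Summable fun j => v j * R ^ j) → Summable v := fun v h2 h3 =>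
    Summable.of_nonneg_of_le h2 (fun j => le_mul_of_one_le_right (h2 j) (one_le_pow₀ hR.le)) h3
  have hgs : Summable g ∧ Summable fun j : ℕ => (j : ℝ) * coeff j f := by
    obtain ⟨v, hv0, hvs, hvb⟩ := hv 0
    constructor
    · refine Summable.of_norm_bounded (hsm v hv0 hvs) (fun j => ?_)
      have := hvb j ℝ (fun y => y) 1 zero_le_one (fun y => ?_)
      · rwa [one_mul, ← hg] at this
      · have := hone 0 y j
        rw [Real.norm_eq_abs]
        nlinarith [abs_nonneg y, (Nat.cast_nonneg j : (0:ℝ) ≤ j), mul_nonneg (Nat.cast_nonneg j : (0:ℝ) ≤ j) (abs_nonneg y)]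
    · refine Summable.of_norm_bounded (hsm v hv0 hvs) (fun j => ?_)
      have := hvb j ℝ (fun y => (j : ℝ)) 1 zero_le_one (fun y => ?_)
      · rw [one_mul] at this
        have e : (j : ℝ) * coeff j f = (Real.exp 1 * ρ ^ j) • Lf (S.aj j) (fun y => (j : ℝ)) := by
          have := Lf_smul (S.aj j) (LinearMap.mulLeft ℝ (j : ℝ)) (fun y => (1:ℝ))
          simp only [LinearMap.mulLeft_apply, mul_one] at this
          rw [this, hfL, smul_eq_mul, smul_eq_mul]; ring
        rwa [e]
      · have := hone 0 y j
        rw [Real.norm_eq_abs, Nat.abs_cast]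
        nlinarith [abs_nonneg y, (Nat.cast_nonneg j : (0:ℝ) ≤ j), mul_nonneg (Nat.cast_nonneg j : (0:ℝ) ≤ j) (abs_nonneg y)]
  obtain ⟨hgs, hms⟩ := hgs
  have hm : 0 < ∑' j : ℕ, (j : ℝ) * coeff j f := by
    refine hms.tsum_pos (fun j => mul_nonneg (by positivity) (hfnn j)) 1 (by simpa using hf1)
  obtain ⟨μ, hμ⟩ : ∃ μ, μ = (∑' j, g j) / ∑' j : ℕ, (j : ℝ) * coeff j f := ⟨_, rfl⟩
  obtain ⟨v, hv0, hvs, hvb⟩ := hv μ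
  have hvb' : ∀ (j : ℕ) (M : Type) [NormedAddCommGroup M] [NormedSpace ℝ M] (φ : ℝ → M) (B : ℝ) (i : ℕ), 0 ≤ B → i ≤ 3 →
      (∀ y, ‖φ y‖ ≤ 4 * B * |y - μ * j| ^ i) → ‖(Real.exp 1 * ρ ^ j) • Lf (S.aj j) φ‖ ≤ B * v j := by
    intro j M _ _ φ B i hB hi hφ
    refine hvb j M φ B hB fun y => (hφ y).trans ?_
    gcongr
    exact zpow μ y j i hi
  obtain ⟨J, hJ⟩ : ∃ J, J = map (AddMonoidAlgebra.lift ℝ ℝ⟦X⟧ ℝ EJ : U →+* ℝ⟦X⟧) (S.HU ρ μ) := ⟨_, rfl⟩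
  have hDj : ∀ i j, coeff j (Dj i J) = (Real.exp 1 * ρ ^ j) • Lf (S.aj j) (fun y => (y - μ * j) ^ i / i.factorial) := by
    intro i j
    unfold Dj
    rw [coeff_mk, hJ, coeff_map]
    have := S.lift_H EJ ρ μ j
    show coeff i (AddMonoidAlgebra.lift ℝ ℝ⟦X⟧ ℝ EJ (coeff j (S.HU ρ μ))) = _
    rw [this, map_smul, ← Lf_smul]
    simp_rw [EJ_coeff]
  have hD0 : Dj 0 J = f := by
    ext j; rw [hDj, hfL]; simp
  have hfac : ∀ i : ℕ, (1:ℝ) ≤ i.factorial := fun i => by exact_mod_cast Nat.one_le_iff_ne_zero.2 (Nat.factorial_ne_zero i)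
  have hDv : ∀ i ≤ 3, ∀ j, |coeff j (Dj i J)| ≤ v j := by
    intro i hi j
    rw [hDj]
    have := hvb' j ℝ (fun y => (y - μ * j) ^ i / i.factorial) 1 i zero_le_one hi (fun y => ?_)
    · rwa [one_mul] at this
    · rw [norm_div, norm_pow, Real.norm_eq_abs, Real.norm_eq_abs, Nat.abs_cast]
      have : 0 ≤ |y - μ * j| ^ i := by positivity
      refine (div_le_self this (hfac i)).trans (by linarith)
  have hH : ∀ θ j, coeff j (map (AddMonoidAlgebra.lift ℝ ℂ ℝ (Et θ) : U →+* ℂ) (S.HU ρ μ)) =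
      (Real.exp 1 * ρ ^ j) • Lf (S.aj j) (fun y => Complex.exp ((θ * (y - μ * j) : ℝ) * Complex.I)) := by
    intro θ j
    rw [coeff_map]
    exact S.lift_H (Et θ) ρ μ j
  have hHn : ∀ θ j, ‖coeff j (map (AddMonoidAlgebra.lift ℝ ℂ ℝ (Et θ) : U →+* ℂ) (S.HU ρ μ))‖ = Real.exp 1 * (‖coeff j (S.psi (Et θ))‖ * ρ ^ j) := by
    intro θ j
    have := S.psi_map EU (Et θ) (AddMonoidAlgebra.lift ℝ ℂ ℝ (Et θ) : U →+* ℂ) (fun y => by simp [EU]) j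
    rw [← this, coeff_map]
    have h2 := S.HU_pow ρ μ 1 j
    rw [pow_one, pow_one, Nat.cast_one] at h2
    rw [h2, map_mul, norm_mul]
    have h3 : (AddMonoidAlgebra.lift ℝ ℂ ℝ (Et θ) : U →+* ℂ) (AddMonoidAlgebra.single (-(μ * j)) (Real.exp 1 * ρ ^ j)) = (Real.exp 1 * ρ ^ j) • Et θ (Multiplicative.ofAdd (-(μ * j))) :=
      AddMonoidAlgebra.lift_single _ _ _
    rw [h3, norm_smul, Et_norm, Real.norm_eq_abs, abs_of_pos (by positivity)]
    ring
  have hPx : S.Pv (ENNReal.ofReal ((R * ρ) ^ 2)) ≠ ∞ := by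
    refine ne_top_of_le_ne_top hP (S.Pv_mono (ENNReal.ofReal_le_ofReal ?_))
    calc (R * ρ) ^ 2 ≤ (Real.sqrt ρ) ^ 2 := by gcongr
      _ = ρ := Real.sq_sqrt h0.le
  obtain ⟨K, hK, hdom⟩ := S.dom (R * ρ) (by positivity) (hRρ.trans hs1) hPx
  have hsd : ∀ θ x, 0 ≤ x → x ≤ R → (Summable fun j => ‖coeff j (map (AddMonoidAlgebra.lift ℝ ℂ ℝ (Et θ) : U →+* ℂ) (S.HU ρ μ))‖ * x ^ j) ∧
     ∑' j, ‖coeff j (map (AddMonoidAlgebra.lift ℝ ℂ ℝ (Et θ) : U →+* ℂ) (S.HU ρ μ))‖ * x ^ j ≤ (∑' j, coeff j f * x ^ j) * Real.exp (K * θ ^ 2) := by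
    intro θ x hx hxR
    have hy : 0 ≤ x * ρ := by positivity
    have h2 := hdom (x * ρ) hy (by gcongr) θ
    have hfin : nv na (ENNReal.ofReal (x * ρ)) S.ps ≠ ∞ := by
      refine S.ps_fin _ hy (lt_of_le_of_lt (by gcongr) (hRρ.trans hs1)) ?_
      exact ne_top_of_le_ne_top hPx (S.Pv_mono (ENNReal.ofReal_le_ofReal (by gcongr)))
    have hps := nv_real S.NN_ps hy hfin
    have htop : nv (fun z : ℂ => ‖z‖ₑ) (ENNReal.ofReal (x * ρ)) (S.psi (Et θ)) ≠ ∞ := ne_top_of_le_ne_top (ENNReal.mul_ne_top hfin (by simp)) h2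
    have h3 := ENNReal.hasSum_toReal htop
    have h4 := ENNReal.toReal_mono (ENNReal.mul_ne_top hfin (by simp)) h2
    rw [ENNReal.toReal_mul, ENNReal.toReal_ofReal (Real.exp_pos _).le, ← hps.tsum_eq] at h4
    have e : ∀ j, ‖coeff j (map (AddMonoidAlgebra.lift ℝ ℂ ℝ (Et θ) : U →+* ℂ) (S.HU ρ μ))‖ * x ^ j = Real.exp 1 * (‖coeff j (S.psi (Et θ))‖ₑ * ENNReal.ofReal (x * ρ) ^ j).toReal := by
      intro j
      rw [hHn, ENNReal.toReal_mul, ENNReal.toReal_pow, ENNReal.toReal_ofReal hy]; simp; ring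
    simp_rw [e]
    refine ⟨h3.summable.mul_left _, ?_⟩
    rw [tsum_mul_left, h3.tsum_eq]
    have e2 : ∑' j, coeff j f * x ^ j = Real.exp 1 * ∑' j, coeff j S.ps * (x * ρ) ^ j := by
      rw [← tsum_mul_left]; congr 1; ext j; rw [hfps]; ring
    rw [e2, mul_assoc]
    rw [← ENNReal.tsum_toReal_eq (ENNReal.ne_top_of_tsum_ne_top htop)]
    exact mul_le_mul_of_nonneg_left h4 (Real.exp_pos _).le
  refine ⟨ρ, μ, ⟨f, Dj 1 J, Dj 2 J, fun θ => map (AddMonoidAlgebra.lift ℝ ℂ ℝ (Et θ) : U →+* ℂ) (S.HU ρ μ), v, R, K, hR, hK, hfnn, hf0, hf1, hfsum, hvs, ?_, hDv 1 (by norm_num), hDv 2 (by norm_num), ?_, ?_, ?_, fun θ x a b => (hsd θ x a b).1, fun θ x a b => (hsd θ x a b).2⟩, h0, h1, hp, ?_, ?_, ?_, ?_⟩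
  · rw [← hD0]; exact hDv 0 (by norm_num)
  · have e : ∀ j, coeff j (Dj 1 J) = g j - μ * (j * coeff j f) := by
      intro j
      rw [hDj, hfL, hg]
      have := Lf_add (S.aj j) (fun y => y) (fun y => LinearMap.mulLeft ℝ (-(μ * j)) (1:ℝ))
      rw [Lf_smul] at this
      simp only [LinearMap.mulLeft_apply, mul_one] at this
      simp only [pow_one, Nat.factorial_one, Nat.cast_one, div_one, sub_eq_add_neg, smul_eq_mul]
      rw [this]; ring
    simp_rw [e]
    have := hgs.hasSum.sub (hms.hasSum.mul_left μ)
    rwa [hμ, div_mul_cancel₀ _ hm.ne', sub_self, ← hμ] at this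
  · intro θ
    rw [← norm_eq_zero, hHn, psi_zero]; simp
  · intro θ j
    have e : coeff j (map (AddMonoidAlgebra.lift ℝ ℂ ℝ (Et θ) : U →+* ℂ) (S.HU ρ μ)) - (coeff j f + θ * coeff j (Dj 1 J) * Complex.I - θ ^ 2 * coeff j (Dj 2 J)) =
       (Real.exp 1 * ρ ^ j) • Lf (S.aj j) (fun y => Complex.exp ((θ * (y - μ * j) : ℝ) * Complex.I) - 1 - ((θ * (y - μ * j) : ℝ) : ℂ) * Complex.I + ((θ * (y - μ * j) : ℝ) : ℂ) ^ 2 / 2) := by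
      rw [hH, hDj, hDj, hfL]
      unfold Lf Finsupp.sum
      simp only [smul_eq_mul, Complex.real_smul, Finset.mul_sum, Complex.ofReal_sum, Finset.sum_mul]
      rw [← Finset.sum_add_distrib, ← Finset.sum_sub_distrib, ← Finset.sum_sub_distrib]
      refine Finset.sum_congr rfl fun y _ => ?_
      norm_num [Nat.factorial]
      ring
    rw [e]
    refine hvb' j ℂ _ (|θ| ^ 3) 3 (by positivity) le_rfl fun y => (exp_three _).trans (le_of_eq ?_)
    rw [abs_mul, mul_pow]; ring
  · intro n
    have := S.lift_ident E1 ρ 0 n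
    rw [← hfdef] at this
    simpa using this
  · intro n
    have := congrArg (coeff 1) (S.lift_ident EJ ρ μ n)
    rw [← hJ, map_sum, map_sum] at this
    simp only [map_smul, EJ_coeff] at this
    rw [Finset.mul_sum]
    refine Eq.trans (Finset.sum_congr rfl fun T _ => ?_) (this.trans (Finset.sum_congr rfl fun k _ => ?_))
    · simp
    · have h3 := congrArg (coeff n) (Dj1_pow J k)
      rw [hD0, Dj, coeff_mk, map_smul] at h3
      rw [h3]; rfl
  · intro n
    have := congrArg (coeff 2) (S.lift_ident EJ ρ μ n)
    rw [← hJ, map_sum, map_sum] at this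
    simp only [map_smul, EJ_coeff] at this
    rw [Finset.mul_sum]
    refine Eq.trans (Finset.sum_congr rfl fun T _ => ?_) (this.trans (Finset.sum_congr rfl fun k _ => ?_))
    · simp
    · have h3 := congrArg (coeff n) (Dj2_pow J k)
      rw [hD0, Dj, coeff_mk, map_add, map_smul, map_smul] at h3
      rw [h3]; rfl
  · intro θ n
    have := S.lift_ident (Et θ) ρ μ n
    simp only [Et_apply, Complex.real_smul] at this
    rw [Finset.mul_sum]
    exact_mod_cast this
end
end PSys

namespace PSys
open PowerSeries
open scoped ENNReal

noncomputable def ww (n : ℕ) : ℝ := 1 / (((n : ℝ) + 1) * Real.sqrt (n + 1))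

theorem ww_pos (n : ℕ) : 0 < ww n := by unfold ww; positivity

theorem ww_add (i j : ℕ) : ww i ≤ ww (i + j) * ((j : ℝ) + 1) ^ 2 := by
  unfold ww
  have h1 : ((i : ℝ) + j + 1) ≤ (i + 1) * (j + 1) := by nlinarith [mul_nonneg (Nat.cast_nonneg (α := ℝ) i) (Nat.cast_nonneg (α := ℝ) j)]
  have h2 : Real.sqrt ((i : ℝ) + j + 1) ≤ Real.sqrt (i + 1) * (j + 1) := by
    calc _ ≤ Real.sqrt ((i + 1) * (j + 1)) := Real.sqrt_le_sqrt h1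
      _ = Real.sqrt (i + 1) * Real.sqrt (j + 1) := Real.sqrt_mul (by positivity) _
      _ ≤ _ := by
        gcongr
        rw [Real.sqrt_le_left (by positivity)]
        nlinarith [Nat.cast_nonneg (α := ℝ) j]
  rw [div_mul_eq_mul_div, div_le_div_iff₀ (by positivity) (by positivity)]
  push_cast
  calc _ ≤ 1 * (((i + 1) * (j + 1)) * (Real.sqrt (i + 1) * (j + 1))) := by gcongr
    _ = _ := by ring

theorem ww_shift (a : ℕ → ℝ) (j : ℕ) (C : ℝ) (h : ∀ k, |a (k + j)| ≤ C * ww k) : ∃ C', 0 ≤ C' ∧ ∀ k, |a k| ≤ C' * ww k := by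
  have hC : 0 ≤ C := by
    have := (abs_nonneg _).trans (h 0)
    exact nonneg_of_mul_nonneg_left this (ww_pos 0)
  refine ⟨C * ((j : ℝ) + 1) ^ 2 + ∑ k ∈ Finset.range j, |a k| / ww k, ?_, fun k => ?_⟩
  · have := Finset.sum_nonneg (s := Finset.range j) (fun k _ => div_nonneg (abs_nonneg (a k)) (ww_pos k).le)
    positivity
  · have hw := ww_pos k
    have hs : ∀ k, 0 ≤ |a k| / ww k := fun k => div_nonneg (abs_nonneg (a k)) (ww_pos k).le
    rcases lt_or_ge k j with hk | hk
    · have := Finset.single_le_sum (fun k _ => hs k) (Finset.mem_range.2 hk)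
      rw [div_le_iff₀ hw] at this
      refine this.trans ?_
      gcongr
      exact le_add_of_nonneg_left (by positivity)
    · obtain ⟨i, rfl⟩ := Nat.exists_eq_add_of_le' hk
      calc _ ≤ C * ww i := h i
        _ ≤ C * (ww (i + j) * ((j : ℝ) + 1) ^ 2) := by gcongr; exact ww_add i j
        _ = (C * ((j : ℝ) + 1) ^ 2) * ww (i + j) := by ring
        _ ≤ _ := by
          gcongr
          exact le_add_of_nonneg_right (Finset.sum_nonneg fun k _ => hs k)

noncomputable def dd (k : ℕ) : ℝ := k * cc k
noncomputable def rr (k : ℕ) : ℝ := (1 + 1 / (k : ℝ)) ^ k / Real.exp 1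

theorem dd_succ (k : ℕ) (hk : k ≠ 0) : dd (k + 1) = dd k * rr k := by
  unfold dd cc TF.tc rr
  have : (k : ℝ) ≠ 0 := by exact_mod_cast hk
  have e : (1 + 1 / (k : ℝ)) = (k + 1) / k := by field_simp
  rw [e, div_pow, Nat.factorial_succ]
  push_cast
  rw [neg_add, Real.exp_add, Real.exp_neg 1, pow_succ]
  have := Real.exp_pos 1
  field_simp

theorem dd_nonneg (k : ℕ) : 0 ≤ dd k := mul_nonneg (Nat.cast_nonneg _) (cc_nonneg k)
theorem dd_le (k : ℕ) (hk : k ≠ 0) : dd k ≤ 1 / Real.sqrt k := by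
  have h0 : (0 : ℝ) < k := by positivity
  calc dd k ≤ k * (1 / (k * Real.sqrt k)) := by unfold dd; gcongr; exact cc_le k hk
    _ = _ := by field_simp

theorem rr_bd (k : ℕ) (hk : k ≠ 0) : |rr k - 1 + 1 / (2 * k)| ≤ 5 / (k : ℝ) ^ 2 := by
  rcases Nat.lt_or_ge k 2 with h | h
  · obtain rfl : k = 1 := by omega
    unfold rr
    have h1 : 2 ≤ Real.exp 1 := by have := Real.add_one_le_exp 1; linarith
    have h2 : (1 + 1 / ((1:ℕ):ℝ)) ^ 1 / Real.exp 1 ≤ 1 := by rw [div_le_one (by positivity)]; norm_num; exact h1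
    have h3 : 0 ≤ (1 + 1 / ((1:ℕ):ℝ)) ^ 1 / Real.exp 1 := by positivity
    rw [abs_le]; constructor <;> norm_num at * <;> linarith
  have hk0 : (0:ℝ) < k := by positivity
  obtain ⟨x, hx⟩ : ∃ x : ℝ, x = 1 / k := ⟨_, rfl⟩
  have hx0 : 0 < x := by rw [hx]; positivity
  have hx2 : x ≤ 1 / 2 := by rw [hx]; gcongr; exact_mod_cast h
  have hkx : k * x = 1 := by rw [hx]; field_simp
  have hl := Real.abs_log_sub_add_sum_range_le (x := -x) (by rw [abs_neg, abs_of_pos hx0]; linarith) 2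
  rw [abs_neg, abs_of_pos hx0, sub_neg_eq_add] at hl
  norm_num [Finset.sum_range_succ] at hl
  have hl' : |Real.log (1 + x) - x + x ^ 2 / 2| ≤ 2 * x ^ 3 := by
    have h3 : x ^ 3 / (1 - x) ≤ 2 * x ^ 3 := by
      rw [div_le_iff₀ (by linarith)]; nlinarith [pow_pos hx0 3]
    refine le_trans (le_of_eq ?_) (hl.trans h3)
    congr 1; ring
  obtain ⟨y, hy⟩ : ∃ y, y = k * Real.log (1 + x) - 1 := ⟨_, rfl⟩
  have hr : rr k = Real.exp y := by
    rw [hy, Real.exp_sub, mul_comm, Real.exp_mul, Real.exp_log (by positivity), hx]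
    unfold rr; rw [Real.rpow_natCast]
  have hyx : |y + x / 2| ≤ 2 * x ^ 2 := by
    have e : y + x / 2 = k * (Real.log (1 + x) - x + x ^ 2 / 2) := by
      rw [hy]; linear_combination (1 - x / 2) * hkx
    rw [e, abs_mul, abs_of_pos hk0]
    calc _ ≤ k * (2 * x ^ 3) := by gcongr
      _ = (k * x) * (2 * x ^ 2) := by ring
      _ = _ := by rw [hkx, one_mul]
  have hya : |y| ≤ 3 / 2 * x := by
    have : |y| ≤ |y + x / 2| + |x / 2| := by simpa using abs_sub (y + x / 2) (x / 2)
    rw [abs_of_pos (by positivity : 0 < x / 2)] at this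
    nlinarith
  have he := Real.abs_exp_sub_one_sub_id_le (x := y) (by linarith)
  have e2 : rr k - 1 + 1 / (2 * k) = (Real.exp y - 1 - y) + (y + x / 2) := by rw [hr, hx]; field_simp; ring
  rw [e2]
  have e3 : 5 / (k : ℝ) ^ 2 = 5 * x ^ 2 := by rw [hx]; field_simp
  rw [e3]
  have : y ^ 2 ≤ (3 / 2 * x) ^ 2 := by rw [← sq_abs]; gcongr
  calc _ ≤ _ := abs_add_le _ _
    _ ≤ y ^ 2 + 2 * x ^ 2 := add_le_add he hyx
    _ ≤ _ := by nlinarith [sq_nonneg x]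

theorem rr_bd1 (k : ℕ) (hk : k ≠ 0) : |rr k - 1| ≤ 6 / (k : ℝ) := by
  have h := rr_bd k hk
  have h1 : (1:ℝ) ≤ k := by exact_mod_cast Nat.one_le_iff_ne_zero.2 hk
  have h2 : 5 / (k : ℝ) ^ 2 ≤ 5 / k := by gcongr; nlinarith
  have h3 : |rr k - 1| ≤ |rr k - 1 + 1 / (2 * k)| + |1 / (2 * (k:ℝ))| := by simpa using abs_sub (rr k - 1 + 1 / (2 * k)) (1 / (2 * k))
  rw [abs_of_pos (by positivity : 0 < 1 / (2 * (k:ℝ)))] at h3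
  have h4 : 1 / (2 * (k:ℝ)) = (1 / 2) / k := by field_simp
  have h5 : 6 / (k : ℝ) = 5 / k + (1 / 2) / k + (1 / 2) / k := by ring
  have : 0 ≤ (1 / 2) / (k : ℝ) := by positivity
  linarith

def df {R : Type} [Sub R] (a : ℕ → R) : ℕ → R
  | 0 => a 0
  | k + 1 => a (k + 1) - a k

theorem dp_bd : ∃ C, 0 ≤ C ∧ ∀ k, |df (fun k => dd (k + 1)) k| ≤ C * ww k := by
  refine ww_shift _ 1 6 fun k => ?_
  show |dd (k + 1 + 1) - dd (k + 1)| ≤ _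
  rw [dd_succ (k + 1) (by omega), ← mul_sub_one, abs_mul, abs_of_nonneg (dd_nonneg _)]
  calc _ ≤ (1 / Real.sqrt (k + 1 : ℕ)) * (6 / (k + 1 : ℕ)) := by
        gcongr
        · exact dd_le _ (by omega)
        · exact rr_bd1 _ (by omega)
    _ = _ := by unfold ww; push_cast; field_simp

theorem bb_bd : ∃ C, 0 ≤ C ∧ ∀ k, |df (df fun k => (k + 1) * dd (k + 2) / 2) k| ≤ C * ww k := by
  refine ww_shift _ 2 23 fun k => ?_
  show |((((k + 2 : ℕ) : ℝ) + 1) * dd (k + 2 + 2) / 2 - (((k + 1 : ℕ) : ℝ) + 1) * dd (k + 1 + 2) / 2) - ((((k + 1 : ℕ) : ℝ) + 1) * dd (k + 1 + 2) / 2 - ((k : ℝ) + 1) * dd (k + 2) / 2)| ≤ _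
  obtain ⟨j, hj⟩ : ∃ j, j = k + 2 := ⟨_, rfl⟩
  have hkj : (k : ℝ) = j - 2 := by rw [hj]; push_cast; ring
  have hj0 : j ≠ 0 := by omega
  have hjp : (1 : ℝ) ≤ j := by exact_mod_cast Nat.one_le_iff_ne_zero.2 hj0
  rw [show k + 2 + 2 = j + 1 + 1 by omega, show k + 1 + 2 = j + 1 by omega, ← hj, dd_succ (j + 1) (by omega), dd_succ j hj0]
  have b1 := rr_bd1 j hj0
  have b2 := rr_bd j hj0
  have b3 := rr_bd (j + 1) (by omega)
  have t1 : ∀ i : ℕ, i ≠ 0 → |i * (rr i - 1) + 1 - 1 / 2| ≤ 5 / i := by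
    intro i hi
    have hi0 : (0:ℝ) < i := by positivity
    have e : i * (rr i - 1) + 1 - 1 / 2 = i * (rr i - 1 + 1 / (2 * i)) := by field_simp; ring
    rw [e, abs_mul, abs_of_pos hi0]
    calc _ ≤ i * (5 / (i:ℝ) ^ 2) := by gcongr; exact rr_bd i hi
      _ = _ := by field_simp
  obtain ⟨t, ht⟩ : ∃ t, t = j * (rr j - 1) + 1 := ⟨_, rfl⟩
  obtain ⟨t', ht'⟩ : ∃ t', t' = ((j + 1 : ℕ) : ℝ) * (rr (j + 1) - 1) + 1 := ⟨_, rfl⟩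
  have ht1 : |t - 1 / 2| ≤ 5 / j := by rw [ht]; exact t1 j hj0
  have ht2 : |t' - 1 / 2| ≤ 5 / j := by
    rw [ht']; refine (t1 (j + 1) (by omega)).trans ?_
    gcongr; omega
  have ht3 : |t'| ≤ 6 := by
    have : 5 / (j : ℝ) ≤ 5 := div_le_self (by norm_num) hjp
    rw [abs_le] at *; constructor <;> linarith
  have ht4 : |t' - t| ≤ 10 / j := by
    have : 10 / (j:ℝ) = 5 / j + 5 / j := by ring
    rw [this]; rw [abs_le] at *; constructor <;> linarith
  have e : (((j : ℝ) + 1) * (dd j * rr j * rr (j + 1)) / 2 - (((k + 1 : ℕ) : ℝ) + 1) * (dd j * rr j) / 2) - ((((k + 1 : ℕ) : ℝ) + 1) * (dd j * rr j) / 2 - ((k : ℝ) + 1) * dd j / 2) = dd j * ((rr j - 1) * t' + (t' - t)) / 2 := by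
    rw [ht, ht']; push_cast; rw [hkj]; ring
  rw [e, abs_div, abs_mul, abs_of_nonneg (dd_nonneg j), abs_two]
  calc _ ≤ (1 / Real.sqrt j) * (6 / j * 6 + 10 / j) / 2 := by
        gcongr
        · exact dd_le j hj0
        · refine (abs_add_le _ _).trans ?_
          rw [abs_mul]
          gcongr
    _ = 23 * (1 / (j * Real.sqrt j)) := by have : 0 < Real.sqrt j := by positivity
                                           field_simp; norm_num
    _ ≤ _ := by
      unfold ww
      have : (k : ℝ) + 1 ≤ j := by rw [hkj]; linarith
      gcongr

end PSys

namespace PSys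
open PowerSeries
open scoped ENNReal

theorem pow_zero_coeff {R : Type} [CommRing R] {F : R⟦X⟧} (h : coeff 0 F = 0) {n k : ℕ} (hk : n < k) : coeff n (F ^ k) = 0 := by
  have h1 : X ∣ F := X_dvd_iff.2 (by simpa using h)
  exact X_pow_dvd_iff.1 (pow_dvd_pow_of_dvd h1 k) n hk

theorem norm_pow_le {R : Type} [NormedField R] {h : R⟦X⟧} {F : ℝ⟦X⟧} (H : ∀ j, ‖coeff j h‖ ≤ coeff j F) (k n : ℕ) :
    ‖coeff n (h ^ k)‖ ≤ coeff n (F ^ k) := by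
  induction k generalizing n with
  | zero => rw [pow_zero, pow_zero, coeff_one, coeff_one]; split_ifs <;> simp
  | succ k ih =>
    rw [pow_succ, pow_succ, coeff_mul, coeff_mul]
    refine (norm_sum_le _ _).trans (Finset.sum_le_sum fun p _ => ?_)
    rw [norm_mul]
    exact mul_le_mul (ih _) (H _) (norm_nonneg _) ((norm_nonneg _).trans (ih _))

theorem renew_le_one {F : ℝ⟦X⟧} (hF : NN F) (h0 : coeff 0 F = 0) (hs : Summable fun j => coeff j F) (h1 : ∑' j, coeff j F ≤ 1) (N n : ℕ) :
    ∑ k ∈ Finset.range N, coeff n (F ^ k) ≤ 1 := by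
  induction N generalizing n with
  | zero => simp
  | succ N ih =>
    rw [Finset.sum_range_succ']
    rcases Nat.eq_zero_or_pos n with rfl | hn
    · rw [Finset.sum_eq_zero]
      · simp
      · intro k _; exact pow_zero_coeff h0 (by omega)
    · rw [pow_zero, coeff_one, if_neg (by omega), add_zero]
      have : ∀ k, coeff n (F ^ (k + 1)) = ∑ p ∈ Finset.HasAntidiagonal.antidiagonal n, coeff p.1 F * coeff p.2 (F ^ k) := by
        intro k; rw [pow_succ', coeff_mul]
      simp_rw [this]
      rw [Finset.sum_comm]
      calc _ ≤ ∑ p ∈ Finset.HasAntidiagonal.antidiagonal n, coeff p.1 F * 1 := by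
            refine Finset.sum_le_sum fun p _ => ?_
            rw [← Finset.mul_sum]
            exact mul_le_mul_of_nonneg_left (ih _) (hF _)
        _ = ∑ i ∈ Finset.range (n + 1), coeff i F := by
            rw [Finset.Nat.sum_antidiagonal_eq_sum_range_succ_mk]; simp
        _ ≤ _ := (hs.sum_le_tsum _ fun j _ => hF j).trans h1

theorem chern {F : ℝ⟦X⟧} (hF : NN F) {x : ℝ} (hx : 0 ≤ x) (hs : Summable fun j => coeff j F * x ^ j) (n k : ℕ) :
    coeff n (F ^ k) * x ^ n ≤ (∑' j, coeff j F * x ^ j) ^ k := by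
  have h1 := nv_pow_eq (ENNReal.ofReal x) hF k
  rw [real_nv hF hx hs] at h1
  have h2 : na (coeff n (F ^ k)) * (ENNReal.ofReal x) ^ n ≤ nv na (ENNReal.ofReal x) (F ^ k) := ENNReal.le_tsum (f := fun n => na (coeff n (F ^ k)) * (ENNReal.ofReal x) ^ n) n
  have h3 : 0 ≤ ∑' j, coeff j F * x ^ j := tsum_nonneg fun j => mul_nonneg (hF j) (by positivity)
  rw [h1, na_of (hF.pow k n), ← ENNReal.ofReal_pow hx, ← ENNReal.ofReal_mul (hF.pow k n), ← ENNReal.ofReal_pow h3] at h2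
  exact (ENNReal.ofReal_le_ofReal_iff (by positivity)).1 h2

theorem div_one_sub {R : Type} [NormedField R] [CompleteSpace R] (F : R⟦X⟧) (C q : ℝ) (hq : 0 < q) (hq1 : q < 1) (hF : ∀ j, ‖coeff j F‖ ≤ C * q ^ j)
    (hs : HasSum (fun j => coeff j F) 0) : ∃ E : R⟦X⟧, F = (1 - X) * E ∧ ∀ j, ‖coeff j E‖ ≤ C / (1 - q) * q ^ j := by
  refine ⟨PowerSeries.mk fun j => ∑ i ∈ Finset.range (j + 1), coeff i F, ?_, fun j => ?_⟩
  · ext n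
    rw [sub_mul, one_mul, map_sub, coeff_mk]
    cases n with
    | zero => rw [coeff_zero_X_mul]; simp
    | succ n => rw [coeff_succ_X_mul, coeff_mk, Finset.sum_range_succ _ (n + 1)]; ring
  · rw [coeff_mk]
    have h1 : ∑ i ∈ Finset.range (j + 1), coeff i F + ∑' i, coeff (i + (j + 1)) F = 0 := (hs.summable.sum_add_tsum_nat_add (j + 1)).trans hs.tsum_eq
    rw [eq_neg_of_add_eq_zero_left h1, norm_neg]
    have h2 : HasSum (fun i : ℕ => C * q ^ j * q * q ^ i) (C * q ^ j * q * (1 - q)⁻¹) := (hasSum_geometric_of_lt_one hq.le hq1).mul_left _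
    have hC : 0 ≤ C := by have := (norm_nonneg _).trans (hF 0); simpa using this
    have h3 : 0 < 1 - q := by linarith
    refine (tsum_of_norm_bounded h2 fun i => (hF _).trans_eq ?_).trans ?_
    · rw [pow_add, pow_add]; ring
    · calc C * q ^ j * q * (1 - q)⁻¹ ≤ C * q ^ j * 1 * (1 - q)⁻¹ := by gcongr
        _ = _ := by ring

def Gd {R : Type} [NormedField R] (F : R⟦X⟧) : Prop := ∃ q C : ℝ, 0 < q ∧ q < 1 ∧ 0 ≤ C ∧ ∀ j, ‖coeff j F‖ ≤ C * q ^ j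
def Dc (F : ℝ⟦X⟧) : Prop := ∃ C, ∀ n, |coeff n F| ≤ C * ww n

theorem Gd.sum {R : Type} [NormedField R] {F : R⟦X⟧} (h : Gd F) : Summable fun j => ‖coeff j F‖ * ((j : ℝ) + 1) ^ 3 := by
  obtain ⟨q, C, h0, h1, hC, h⟩ := h
  refine Summable.of_nonneg_of_le (fun j => by positivity) (fun j => ?_) ((summ_cube h0 h1).mul_left C)
  calc _ ≤ C * q ^ j * ((j : ℝ) + 1) ^ 3 := by gcongr; exact h j
    _ = _ := by ring

theorem Gd.sum2 {R : Type} [NormedField R] {F : R⟦X⟧} (h : Gd F) : Summable fun j => ‖coeff j F‖ * ((j : ℝ) + 1) ^ 2 := by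
  refine Summable.of_nonneg_of_le (fun j => by positivity) (fun j => ?_) h.sum
  gcongr
  · have := Nat.cast_nonneg (α := ℝ) j; linarith
  · norm_num

theorem Gd.sum0 {R : Type} [NormedField R] {F : R⟦X⟧} (h : Gd F) : Summable fun j => ‖coeff j F‖ := by
  refine Summable.of_nonneg_of_le (fun j => by positivity) (fun j => ?_) h.sum2
  have := Nat.cast_nonneg (α := ℝ) j
  exact le_mul_of_one_le_right (norm_nonneg _) (one_le_pow₀ (by linarith))

theorem Dc.mul {F G : ℝ⟦X⟧} (hG : Gd G) (hF : Dc F) : Dc (G * F) := by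
  obtain ⟨C, hC⟩ := hF
  have hC0 : 0 ≤ C := nonneg_of_mul_nonneg_left ((abs_nonneg _).trans (hC 0)) (ww_pos 0)
  refine ⟨C * ∑' j, ‖coeff j G‖ * ((j : ℝ) + 1) ^ 2, fun n => ?_⟩
  rw [coeff_mul, Finset.Nat.sum_antidiagonal_eq_sum_range_succ_mk]
  have hw := ww_pos n
  calc _ ≤ ∑ i ∈ Finset.range (n + 1), |coeff i G * coeff (n - i) F| := Finset.abs_sum_le_sum_abs _ _
    _ ≤ ∑ i ∈ Finset.range (n + 1), C * ww n * (‖coeff i G‖ * ((i : ℝ) + 1) ^ 2) := by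
      refine Finset.sum_le_sum fun i hi => ?_
      rw [abs_mul]
      have h1 := ww_add (n - i) i
      rw [Nat.sub_add_cancel (by simpa [Nat.lt_succ_iff] using hi)] at h1
      calc _ ≤ |coeff i G| * (C * (ww n * ((i : ℝ) + 1) ^ 2)) := by gcongr; exact (hC _).trans (by gcongr)
        _ = _ := by rw [Real.norm_eq_abs]; ring
    _ ≤ _ := by
      rw [← Finset.mul_sum]
      calc _ ≤ C * ww n * ∑' j, ‖coeff j G‖ * ((j : ℝ) + 1) ^ 2 := by
            gcongr
            exact hG.sum2.sum_le_tsum _ fun j _ => by positivity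
        _ = _ := by ring

theorem bd_mul {G F : ℂ⟦X⟧} (hG : Summable fun j => ‖coeff j G‖) (n : ℕ) (B : ℝ) (hB : 0 ≤ B) (hF : ∀ i ≤ n, ‖coeff i F‖ ≤ B) :
    ∀ i ≤ n, ‖coeff i (G * F)‖ ≤ (∑' j, ‖coeff j G‖) * B := by
  intro i hi
  rw [coeff_mul, Finset.Nat.sum_antidiagonal_eq_sum_range_succ_mk]
  calc _ ≤ ∑ j ∈ Finset.range (i + 1), ‖coeff j G‖ * B := by
        refine norm_sum_le_of_le _ fun j hj => ?_
        rw [norm_mul]; gcongr; exact hF _ (by omega)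
    _ ≤ _ := by rw [← Finset.sum_mul]; gcongr; exact hG.sum_le_tsum _ fun j _ => by positivity

end PSys

namespace PSys
open PowerSeries
open scoped ENNReal

theorem ps_unique (d : ℕ → ℂ) (hd : Summable fun n => ‖d n‖) (h : ∀ z : ℂ, ‖z‖ < 1 → ∑' n, d n * z ^ n = 0) : ∀ n, d n = 0 := by
  have hp : HasFPowerSeriesOnBall (fun _ : ℂ => (0 : ℂ)) (FormalMultilinearSeries.ofScalars ℂ d) 0 1 := by
    refine ⟨?_, by norm_num, fun {y} hy => ?_⟩
    · have := (FormalMultilinearSeries.ofScalars ℂ d).le_radius_of_summable (r := 1) (by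
        simpa [FormalMultilinearSeries.ofScalars_norm] using hd)
      simpa using this
    · have hy' : ‖y‖ < 1 := by
        have h2 : ‖y‖ₑ < 1 := by simpa using hy
        rw [← ofReal_norm, ENNReal.ofReal_lt_one] at h2; exact h2
      have hs : Summable fun n => d n * y ^ n := by
        refine Summable.of_norm_bounded hd fun n => ?_
        rw [norm_mul, norm_pow]
        exact mul_le_of_le_one_right (norm_nonneg _) (pow_le_one₀ (norm_nonneg _) hy'.le)
      have := hs.hasSum
      rw [h y hy'] at this
      refine this.congr_fun fun n => ?_
      simp [FormalMultilinearSeries.ofScalars_apply_eq, mul_comm]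
  have := hp.hasFPowerSeriesAt.eq_zero
  intro n
  rw [FormalMultilinearSeries.ofScalars_series_eq_zero] at this
  exact congrFun this n

theorem tsum_mul_ps {F G : ℂ⟦X⟧} {z : ℂ} (hF : Summable fun j => ‖coeff j F * z ^ j‖) (hG : Summable fun j => ‖coeff j G * z ^ j‖) :
    (Summable fun j => ‖coeff j (F * G) * z ^ j‖) ∧ ∑' j, coeff j (F * G) * z ^ j = (∑' j, coeff j F * z ^ j) * ∑' j, coeff j G * z ^ j := by
  have e : ∀ n, coeff n (F * G) * z ^ n = ∑ p ∈ Finset.HasAntidiagonal.antidiagonal n, (coeff p.1 F * z ^ p.1) * (coeff p.2 G * z ^ p.2) := by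
    intro n
    rw [coeff_mul, Finset.sum_mul]
    refine Finset.sum_congr rfl fun p hp => ?_
    rw [← Finset.HasAntidiagonal.mem_antidiagonal.1 hp, pow_add]; ring
  simp_rw [e]
  obtain ⟨a, ha⟩ : ∃ a : ℕ → ℂ, a = fun j => coeff j F * z ^ j := ⟨_, rfl⟩
  obtain ⟨b, hb⟩ : ∃ b : ℕ → ℂ, b = fun j => coeff j G * z ^ j := ⟨_, rfl⟩
  have ha' : ∀ j, coeff j F * z ^ j = a j := fun j => by rw [ha]
  have hb' : ∀ j, coeff j G * z ^ j = b j := fun j => by rw [hb]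
  simp_rw [ha', hb'] at *
  exact ⟨summable_norm_sum_mul_antidiagonal_of_summable_norm hF hG, (tsum_mul_tsum_eq_tsum_sum_antidiagonal_of_summable_norm hF hG).symm⟩

theorem inv_decay (Q : ℝ⟦X⟧) (hQ : Gd Q) (h0 : coeff 0 Q ≠ 0) (hz : ∀ z : ℂ, ‖z‖ ≤ 1 → ∑' j, ((coeff j Q : ℝ) : ℂ) * z ^ j ≠ 0) :
    ∃ W : ℝ⟦X⟧, Q * W = 1 ∧ Gd W ∧ ∑' j, coeff j W ≠ 0 := by
  obtain ⟨q, C, hq, hq1, hC, hb⟩ := hQ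
  obtain ⟨r0, hr01, hr0q⟩ : ∃ r0, 1 < r0 ∧ r0 < 1 / q := exists_between (by rw [lt_div_iff₀ hq]; linarith)
  have hr0p : 0 < r0 := by linarith
  have hqr : q * r0 < 1 := by rw [lt_div_iff₀ hq] at hr0q; linarith
  obtain ⟨G, hG⟩ : ∃ G : ℂ → ℂ, G = fun z => ∑' j, ((coeff j Q : ℝ) : ℂ) * z ^ j := ⟨_, rfl⟩
  have hsum : Summable fun j : ℕ => C * (q * r0) ^ j := (summable_geometric_of_lt_one (by positivity) hqr).mul_left C
  have hle : ∀ (j : ℕ) (z : ℂ), ‖z‖ ≤ r0 → ‖((coeff j Q : ℝ) : ℂ) * z ^ j‖ ≤ C * (q * r0) ^ j := by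
    intro j z hz
    rw [norm_mul, norm_pow, Complex.norm_real]
    calc _ ≤ (C * q ^ j) * r0 ^ j := by gcongr; exact hb j
      _ = _ := by rw [mul_pow]; ring
  have hGd : DifferentiableOn ℂ G (Metric.ball 0 r0) := by
    rw [hG]
    exact Complex.differentiableOn_tsum_of_summable_norm hsum (fun j => by fun_prop) Metric.isOpen_ball (fun j z hz => hle j z (by simp at hz; exact hz.le))
  have hGc : ContinuousOn G (Metric.closedBall 0 r0) := by
    rw [hG]
    exact continuousOn_tsum (fun j => by fun_prop) hsum (fun j z hz => hle j z (by simpa using hz))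
  obtain ⟨r, hr1, hrr, hr⟩ : ∃ r, 1 < r ∧ r < r0 ∧ ∀ z : ℂ, ‖z‖ ≤ r → G z ≠ 0 := by
    by_cases he : (Metric.closedBall (0:ℂ) r0 ∩ G ⁻¹' {0}).Nonempty
    · have hcl : IsCompact (Metric.closedBall (0:ℂ) r0 ∩ G ⁻¹' {0}) :=
        (isCompact_closedBall 0 r0).of_isClosed_subset (hGc.preimage_isClosed_of_isClosed Metric.isClosed_closedBall isClosed_singleton) Set.inter_subset_left
      obtain ⟨z0, hz0, hmin⟩ := hcl.exists_isMinOn he continuous_norm.continuousOn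
      have h1 : 1 < ‖z0‖ := by
        by_contra hcon
        push Not at hcon
        have := hz z0 hcon
        apply this
        have h2 := hz0.2
        rw [hG] at h2
        exact h2
      have h2 : ‖z0‖ ≤ r0 := by simpa using hz0.1
      refine ⟨(1 + ‖z0‖) / 2, by linarith, by linarith, fun z hz' hGz => ?_⟩
      have : ‖z0‖ ≤ ‖z‖ := hmin (show z ∈ _ from ⟨by simp; linarith, hGz⟩)
      linarith
    · refine ⟨(1 + r0) / 2, by linarith, by linarith, fun z hz' hGz => he ⟨z, by simp; linarith, hGz⟩⟩
  have hr0' : 0 < r := by linarith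
  obtain ⟨rn, hrn⟩ : ∃ rn : NNReal, (rn : ℝ) = r := ⟨⟨r, hr0'.le⟩, rfl⟩
  have hI : DifferentiableOn ℂ (fun z => (G z)⁻¹) (Metric.closedBall 0 rn) := by
    refine DifferentiableOn.inv (hGd.mono fun z hz => ?_) fun z hz => hr z ?_
    · rw [hrn] at hz; simp at hz ⊢; linarith
    · rw [hrn] at hz; simpa using hz
  have hP := hI.hasFPowerSeriesOnBall (by rw [← NNReal.coe_pos, hrn]; exact hr0')
  obtain ⟨p, hp⟩ : ∃ p : FormalMultilinearSeries ℂ ℂ ℂ, p = cauchyPowerSeries (fun z => (G z)⁻¹) 0 rn := ⟨_, rfl⟩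
  rw [← hp] at hP
  obtain ⟨r1, hr11, hr1r⟩ := exists_between hr1
  have hr1p : 0 < r1 := by linarith
  obtain ⟨C1, hC1, hpb⟩ : ∃ C1 > 0, ∀ n, ‖p n‖ ≤ C1 / r1 ^ n := by
    have := p.norm_le_div_pow_of_pos_of_lt_radius (r := Real.toNNReal r1) (by simpa using hr1p) (lt_of_lt_of_le (by
      rw [ENNReal.coe_lt_coe, ← NNReal.coe_lt_coe, hrn, Real.coe_toNNReal _ hr1p.le]; exact hr1r) hP.r_le)
    rwa [Real.coe_toNNReal _ hr1p.le] at this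
  have hpc : ∀ n, ‖p.coeff n‖ ≤ C1 * (1 / r1) ^ n := by
    intro n
    rw [← FormalMultilinearSeries.norm_apply_eq_norm_coef, one_div, inv_pow]
    exact hpb n
  have hq' : 1 / r1 < 1 := by rw [div_lt_one hr1p]; exact hr11
  have hsP : Summable fun n => ‖p.coeff n‖ := Summable.of_nonneg_of_le (fun n => norm_nonneg _) hpc ((summable_geometric_of_lt_one (by positivity) hq').mul_left C1)
  obtain ⟨P, hPd⟩ : ∃ P : ℂ⟦X⟧, P = PowerSeries.mk p.coeff := ⟨_, rfl⟩
  obtain ⟨Qc, hQc⟩ : ∃ Qc : ℂ⟦X⟧, Qc = map Complex.ofRealHom Q := ⟨_, rfl⟩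
  have hQcc : ∀ j, coeff j Qc = ((coeff j Q : ℝ) : ℂ) := fun j => by rw [hQc, coeff_map]; rfl
  have hs1 : ∀ z : ℂ, ‖z‖ ≤ 1 → Summable fun j => ‖coeff j Qc * z ^ j‖ := by
    intro z hz
    refine Summable.of_nonneg_of_le (fun n => norm_nonneg _) (fun j => ?_) hsum
    rw [hQcc]; exact hle j z (by linarith)
  have hs2 : ∀ z : ℂ, ‖z‖ ≤ 1 → Summable fun j => ‖coeff j P * z ^ j‖ := by
    intro z hz
    refine Summable.of_nonneg_of_le (fun n => norm_nonneg _) (fun j => ?_) hsP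
    rw [hPd, coeff_mk, norm_mul, norm_pow]
    exact mul_le_of_le_one_right (norm_nonneg _) (pow_le_one₀ (norm_nonneg _) hz)
  have hPs : ∀ z : ℂ, ‖z‖ ≤ 1 → ∑' j, coeff j P * z ^ j = (G z)⁻¹ := by
    intro z hz
    have := hP.hasSum (y := z) (by
      simp [Metric.mem_eball, edist_zero_right]
      rw [hrn]; linarith)
    rw [zero_add] at this
    rw [← this.tsum_eq]
    congr 1; ext n
    rw [hPd, coeff_mk]
    simp [mul_comm]
  have hprod : ∀ z : ℂ, ‖z‖ ≤ 1 → ∑' j, coeff j (Qc * P) * z ^ j = 1 := by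
    intro z hz'
    rw [(tsum_mul_ps (hs1 z hz') (hs2 z hz')).2, hPs z hz']
    have : ∑' j, coeff j Qc * z ^ j = G z := by rw [hG]; simp_rw [hQcc]
    rw [this]
    exact mul_inv_cancel₀ (hr z (by linarith))
  have hone : Qc * P = 1 := by
    have h1 : ∀ z : ℂ, HasSum (fun j => coeff j (1 : ℂ⟦X⟧) * z ^ j) 1 := by
      intro z
      have := hasSum_ite_eq (0:ℕ) (1:ℂ)
      refine this.congr_fun fun j => ?_
      rw [coeff_one]; by_cases hj : j = 0 <;> simp [hj]
    have h2 := ps_unique (fun n => coeff n (Qc * P) - coeff n (1 : ℂ⟦X⟧)) ?_ ?_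
    · ext n; exact sub_eq_zero.1 (h2 n)
    · have a := (tsum_mul_ps (hs1 1 (by simp)) (hs2 1 (by simp))).1
      simp only [one_pow, mul_one] at a
      have b : Summable fun n => ‖coeff n (1 : ℂ⟦X⟧)‖ := by
        refine summable_of_ne_finset_zero (s := {0}) fun n hn => ?_
        rw [coeff_one, if_neg (by simpa using hn), norm_zero]
      exact Summable.of_nonneg_of_le (fun n => norm_nonneg _) (fun n => norm_sub_le _ _) (a.add b)
    · intro z hz'
      have a := (tsum_mul_ps (hs1 z hz'.le) (hs2 z hz'.le)).1.of_norm.hasSum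
      rw [hprod z hz'.le] at a
      have := (a.sub (h1 z)).tsum_eq
      rw [sub_self] at this
      rw [← this]
      congr 1; ext n; ring
  have hW : Q * Q⁻¹ = 1 := PowerSeries.mul_inv_cancel _ (by simpa using h0)
  have hPW : P = map Complex.ofRealHom Q⁻¹ := by
    have h1 : Qc * map Complex.ofRealHom Q⁻¹ = 1 := by rw [hQc, ← map_mul, hW, map_one]
    calc P = (Qc * map Complex.ofRealHom Q⁻¹) * P := by rw [h1, one_mul]
      _ = (Qc * P) * map Complex.ofRealHom Q⁻¹ := by ring
      _ = _ := by rw [hone, one_mul]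
  have hWc : ∀ j, ((coeff j Q⁻¹ : ℝ) : ℂ) = coeff j P := fun j => by rw [hPW, coeff_map]; rfl
  refine ⟨Q⁻¹, hW, ⟨1 / r1, C1, by positivity, hq', hC1.le, fun j => ?_⟩, fun hcon => ?_⟩
  · rw [← Complex.norm_real, hWc, hPd, coeff_mk]; exact hpc j
  · have := hPs 1 (by simp)
    simp only [one_pow, mul_one, ← hWc] at this
    rw [← Complex.ofReal_tsum, hcon, Complex.ofReal_zero] at this
    exact inv_ne_zero (hr 1 (by simp; linarith)) this.symm

end PSys

namespace PSys
open PowerSeries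
open scoped ENNReal

noncomputable def cp {R : Type} [CommRing R] (f : R⟦X⟧) (a : ℕ → R) : R⟦X⟧ := PowerSeries.mk fun n => ∑ k ∈ Finset.range (n + 1), a k * coeff n (f ^ k)

theorem cp_coeff {R : Type} [CommRing R] {f : R⟦X⟧} (h : coeff 0 f = 0) (a : ℕ → R) (n N : ℕ) (hN : n < N) :
    coeff n (cp f a) = ∑ k ∈ Finset.range N, a k * coeff n (f ^ k) := by
  unfold cp
  rw [coeff_mk]
  refine Finset.sum_subset (fun k hk => by simp at *; omega) fun k _ hk => ?_
  rw [pow_zero_coeff h (by simp at hk; omega), mul_zero]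

theorem cp_mul {R : Type} [CommRing R] {f : R⟦X⟧} (h : coeff 0 f = 0) (a : ℕ → R) (G : R⟦X⟧) (n N : ℕ) (hN : n < N) :
    coeff n (cp f a * G) = ∑ k ∈ Finset.range N, a k * coeff n (f ^ k * G) := by
  simp_rw [coeff_mul, Finset.mul_sum]
  rw [Finset.sum_comm]
  refine Finset.sum_congr rfl fun p hp => ?_
  have := Finset.HasAntidiagonal.mem_antidiagonal.1 hp
  rw [cp_coeff h a p.1 N (by omega), Finset.sum_mul]
  exact Finset.sum_congr rfl fun k _ => by ring

theorem cp_df {R : Type} [CommRing R] {f : R⟦X⟧} (h : coeff 0 f = 0) (a : ℕ → R) : (1 - f) * cp f a = cp f (df a) := by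
  ext n
  rw [mul_comm, mul_sub, mul_one, map_sub, cp_mul h a f n (n + 1) (by omega), cp_coeff h a n (n + 2) (by omega), cp_coeff h (df a) n (n + 2) (by omega),
    Finset.sum_range_succ', Finset.sum_range_succ' _ (n + 1)]
  simp_rw [df, sub_mul, Finset.sum_sub_distrib, pow_succ]
  ring

namespace Ren
variable (D : Ren)

noncomputable def m : ℝ := ∑' j : ℕ, (j : ℝ) * coeff j D.f
noncomputable def fv (x : ℝ) : ℝ := ∑' j, coeff j D.f * x ^ j
noncomputable def V : ℝ := ∑' j, D.v j * D.R ^ j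
noncomputable def q : ℝ := 1 / D.R

theorem R_pos : 0 < D.R := by have := D.hR; linarith
theorem q_pos : 0 < D.q := one_div_pos.2 D.R_pos
theorem q_lt : D.q < 1 := by unfold q; rw [div_lt_one D.R_pos]; exact D.hR
theorem v_nn (j : ℕ) : 0 ≤ D.v j := (abs_nonneg _).trans (D.f_v j)
theorem v_le (j : ℕ) : D.v j ≤ D.V * D.q ^ j := by
  have hR := D.R_pos
  have := D.v_sum.le_tsum j fun i _ => mul_nonneg (D.v_nn i) (by positivity)
  unfold V q
  rw [one_div, inv_pow, ← div_eq_mul_inv, le_div_iff₀ (by positivity)]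
  exact this
theorem V_nn : 0 ≤ D.V := tsum_nonneg fun i => mul_nonneg (D.v_nn i) (by have := D.R_pos; positivity)

theorem gd_of {F : ℝ⟦X⟧} (h : ∀ j, |coeff j F| ≤ D.v j) : Gd F := ⟨D.q, D.V, D.q_pos, D.q_lt, D.V_nn, fun j => (h j).trans (D.v_le j)⟩

theorem W_ex : ∃ W : ℝ⟦X⟧, Gd W ∧ (1 - X) = W * (1 - D.f) ∧ ∑' j, coeff j W ≠ 0 := by
  have hq := D.q_pos
  have h1 : HasSum (fun j => coeff j (1 : ℝ⟦X⟧)) 1 := by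
    refine (hasSum_ite_eq (0:ℕ) (1:ℝ)).congr_fun fun j => ?_
    rw [coeff_one]
  have hs : HasSum (fun j => coeff j (1 - D.f)) 0 := by
    have := h1.sub D.f_sum
    rw [sub_self] at this
    simpa using this
  obtain ⟨Q, hQ, hb⟩ := div_one_sub (1 - D.f) (1 + D.V) D.q D.q_pos D.q_lt (fun j => by
    rw [map_sub, coeff_one]
    refine (norm_sub_le _ _).trans ?_
    rw [add_mul]
    refine add_le_add ?_ ((D.f_v j).trans (D.v_le j))
    split_ifs with hj
    · simp [hj]
    · simp; positivity) hs
  have hq1 : 0 < 1 - D.q := by have := D.q_lt; linarith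
  have hV := D.V_nn
  have hG : Gd Q := ⟨D.q, _, D.q_pos, D.q_lt, by positivity, hb⟩
  have hQ0 : coeff 0 Q = 1 := by
    have := congrArg (coeff 0) hQ
    have h2 := D.f_0
    simp [sub_mul] at this h2 ⊢
    rw [← this, h2, sub_zero]
  have hfs : ∀ z : ℂ, ‖z‖ ≤ 1 → HasSum (fun j => coeff j D.f * (1 - (z ^ j).re)) (1 - (∑' j, ((coeff j D.f : ℝ) : ℂ) * z ^ j).re) := by
    intro z hz
    have hs : Summable fun j => ((coeff j D.f : ℝ) : ℂ) * z ^ j := by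
      refine Summable.of_norm_bounded D.f_sum.summable fun j => ?_
      rw [norm_mul, norm_pow, Complex.norm_real, Real.norm_eq_abs, abs_of_nonneg (D.f_nn j)]
      exact mul_le_of_le_one_right (D.f_nn j) (pow_le_one₀ (norm_nonneg _) hz)
    have h2 := D.f_sum.sub (Complex.hasSum_re hs.hasSum)
    refine h2.congr_fun fun j => ?_
    rw [Complex.re_ofReal_mul]; ring
  have hQz : ∀ z : ℂ, ‖z‖ ≤ 1 → Summable fun j => ‖((coeff j Q : ℝ) : ℂ) * z ^ j‖ := by
    intro z hz
    refine Summable.of_nonneg_of_le (fun j => norm_nonneg _) (fun j => ?_) hG.sum0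
    rw [norm_mul, norm_pow, Complex.norm_real]
    exact mul_le_of_le_one_right (norm_nonneg _) (pow_le_one₀ (norm_nonneg _) hz)
  obtain ⟨W, hW, hWG, hW0⟩ := inv_decay Q hG (by rw [hQ0]; norm_num) (by
    intro z hz h0
    by_cases hz1 : z = 1
    · subst hz1
      have hQnn : ∀ j, 0 ≤ coeff j Q := by
        have hr : ∀ j, coeff (j + 1) Q = coeff j Q - coeff (j + 1) D.f := by
          intro j
          have := congrArg (coeff (j + 1)) hQ
          rw [sub_mul, one_mul, map_sub, map_sub, coeff_succ_X_mul, coeff_one, if_neg (by omega)] at this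
          linarith
        have : ∀ j, coeff j Q = 1 - ∑ i ∈ Finset.range (j + 1), coeff i D.f := by
          intro j
          induction j with
          | zero => simp [hQ0, D.f_0]
          | succ j ih => rw [hr, ih, Finset.sum_range_succ _ (j + 1)]; ring
        intro j
        rw [this]
        have := sum_le_hasSum (Finset.range (j + 1)) (fun i _ => D.f_nn i) D.f_sum
        linarith
      have hs0 : Summable fun j => coeff j Q := hG.sum0.of_norm
      simp only [one_pow, mul_one] at h0
      rw [← Complex.ofReal_tsum, Complex.ofReal_eq_zero] at h0
      have := hs0.le_tsum 0 fun i _ => hQnn i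
      rw [h0, hQ0] at this
      norm_num at this
    · have h2 := hfs z hz
      have h3 : ∑' j, ((coeff j D.f : ℝ) : ℂ) * z ^ j = 1 := by
        have e : map Complex.ofRealHom (1 - D.f) = (1 - X) * map Complex.ofRealHom Q := by rw [hQ, map_mul]; simp
        have hX : HasSum (fun j => coeff j (1 - X : ℂ⟦X⟧) * z ^ j) (1 - z) := by
          have a := hasSum_ite_eq (0:ℕ) (1:ℂ)
          have b := hasSum_ite_eq (1:ℕ) (z:ℂ)
          refine (a.sub b).congr_fun fun j => ?_
          rw [map_sub, coeff_one, coeff_X]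
          by_cases h0 : j = 0
          · simp [h0]
          · by_cases h1 : j = 1 <;> simp [h0, h1]
        have hXs : Summable fun j => ‖coeff j (1 - X : ℂ⟦X⟧) * z ^ j‖ := by
          refine summable_of_ne_finset_zero (s := Finset.range 2) fun j hj => ?_
          simp at hj
          rw [map_sub, coeff_one, coeff_X, if_neg (by omega), if_neg (by omega)]; simp
        have h4 := (tsum_mul_ps hXs (G := map Complex.ofRealHom Q) (z := z) (by simpa [coeff_map] using hQz z hz)).2
        rw [← e] at h4
        have h5 : ∑' j, coeff j (map Complex.ofRealHom Q) * z ^ j = 0 := by simpa [coeff_map] using h0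
        rw [h5, mul_zero] at h4
        have hs : Summable fun j => ((coeff j D.f : ℝ) : ℂ) * z ^ j := by
          refine Summable.of_norm_bounded D.f_sum.summable fun j => ?_
          rw [norm_mul, norm_pow, Complex.norm_real, Real.norm_eq_abs, abs_of_nonneg (D.f_nn j)]
          exact mul_le_of_le_one_right (D.f_nn j) (pow_le_one₀ (norm_nonneg _) hz)
        have h6 : HasSum (fun j => coeff j (map Complex.ofRealHom (1 - D.f)) * z ^ j) (1 - ∑' j, ((coeff j D.f : ℝ) : ℂ) * z ^ j) := by
          refine ((hasSum_ite_eq (0:ℕ) (1:ℂ)).sub hs.hasSum).congr_fun fun j => ?_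
          rw [coeff_map, map_sub, coeff_one]
          by_cases h0 : j = 0 <;> simp [h0, sub_mul]
        rw [h6.tsum_eq] at h4
        exact (sub_eq_zero.1 h4).symm
      rw [h3] at h2
      simp only [Complex.one_re, sub_self] at h2
      have hre : ∀ j, (z ^ j).re ≤ 1 := fun j => (Complex.re_le_norm _).trans (by rw [norm_pow]; exact pow_le_one₀ (norm_nonneg _) hz)
      have h7 := (hasSum_zero_iff_of_nonneg (fun j => mul_nonneg (D.f_nn j) (by have := hre j; linarith))).1 h2
      have h8 := congrFun h7 1
      simp only [Pi.zero_apply, mul_eq_zero, D.f_1.ne', false_or, pow_one] at h8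
      apply hz1
      have h9 : z.re = 1 := by linarith
      have h10 : z.re ^ 2 + z.im ^ 2 ≤ 1 := by
        have := Complex.sq_norm z
        rw [Complex.normSq_apply] at this
        nlinarith [norm_nonneg z]
      refine Complex.ext (by simp [h9]) ?_
      rw [h9] at h10
      simp; nlinarith)
  refine ⟨W, hWG, ?_, hW0⟩
  calc (1 - X : ℝ⟦X⟧) = (1 - X) * (Q * W) := by rw [hW, mul_one]
    _ = W * ((1 - X) * Q) := by ring
    _ = _ := by rw [← hQ]

end Ren
end PSys

namespace PSys
open PowerSeries
open scoped ENNReal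
namespace Ren
variable (D : Ren)

theorem mf_sum : Summable fun j : ℕ => (j : ℝ) * coeff j D.f := by
  refine Summable.of_nonneg_of_le (fun j => mul_nonneg (Nat.cast_nonneg _) (D.f_nn j)) (fun j => ?_) (D.gd_of D.f_v).sum2
  rw [Real.norm_eq_abs, abs_of_nonneg (D.f_nn j), mul_comm]
  have := Nat.cast_nonneg (α := ℝ) j
  exact mul_le_mul_of_nonneg_left (by nlinarith) (D.f_nn j)

theorem m_pos : 0 < D.m := by
  have := D.mf_sum.le_tsum 1 fun j _ => mul_nonneg (Nat.cast_nonneg _) (D.f_nn j)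
  have h := D.f_1
  unfold m; simp at this; linarith

theorem fv_summ {x : ℝ} (h0 : 0 ≤ x) (h1 : x ≤ D.R) : Summable fun j => coeff j D.f * x ^ j := by
  refine Summable.of_nonneg_of_le (fun j => mul_nonneg (D.f_nn j) (by positivity)) (fun j => ?_) D.v_sum
  have := D.v_nn j
  gcongr
  exact (le_abs_self _).trans (D.f_v j)

theorem fv_pos {x : ℝ} (h0 : 0 < x) (h1 : x ≤ D.R) : 0 < D.fv x := by
  have := (D.fv_summ h0.le h1).le_tsum 1 fun j _ => mul_nonneg (D.f_nn j) (by positivity)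
  have h : 0 < coeff 1 D.f * x ^ 1 := mul_pos D.f_1 (by positivity)
  exact h.trans_le this

theorem fv_one : D.fv 1 = 1 := by unfold fv; simpa using D.f_sum.tsum_eq

theorem fv_mono {x y : ℝ} (h0 : 0 ≤ x) (h : x ≤ y) (h1 : y ≤ D.R) : D.fv x ≤ D.fv y :=
  (D.fv_summ h0 (h.trans h1)).tsum_le_tsum (fun j => mul_le_mul_of_nonneg_left (by gcongr) (D.f_nn j)) (D.fv_summ (h0.trans h) h1)

theorem fv_deriv : HasDerivAt D.fv D.m 1 := by
  have hR := D.hR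
  obtain ⟨r, h1, h2⟩ := exists_between D.hR
  have hq : r * D.q < 1 := by unfold q; rw [mul_one_div, div_lt_one D.R_pos]; exact h2
  have hq0 := D.q_pos
  have hu := (summ_cube (q := r * D.q) (by positivity) hq).mul_left D.V
  have hV := D.V_nn
  have := hasDerivAt_tsum_of_isPreconnected (t := Set.Ioo 0 r) (y₀ := 1) (y := 1) (g := fun j x => coeff j D.f * x ^ j) (g' := fun j x => coeff j D.f * (j * x ^ (j - 1))) hu isOpen_Ioo isPreconnected_Ioo
    (fun j y hy => (hasDerivAt_pow j y).const_mul _) (fun j y hy => by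
      rw [norm_mul, Real.norm_eq_abs, Real.norm_eq_abs, abs_of_nonneg (by have := hy.1; positivity : 0 ≤ (j : ℝ) * y ^ (j - 1))]
      have hj := Nat.cast_nonneg (α := ℝ) j
      have a : (j : ℝ) ≤ (j + 1) ^ 3 := by nlinarith [sq_nonneg (j : ℝ), mul_nonneg hj (sq_nonneg (j : ℝ))]
      have b : y ^ (j - 1) ≤ r ^ j := by
        calc y ^ (j - 1) ≤ r ^ (j - 1) := pow_le_pow_left₀ hy.1.le hy.2.le _
          _ ≤ r ^ j := pow_le_pow_right₀ h1.le (by omega)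
      have hy0 := hy.1.le
      calc _ ≤ D.V * D.q ^ j * ((j + 1) ^ 3 * r ^ j) := by
            gcongr
            exact (D.f_v j).trans (D.v_le j)
        _ = _ := by rw [mul_pow]; ring) ⟨by norm_num, h1⟩ (by simpa using D.f_sum.summable) ⟨by norm_num, h1⟩
  refine this.congr_deriv ?_
  unfold m
  congr 1; ext j; simp; ring

theorem phi_deriv (c : ℝ) : HasDerivAt (fun x => D.fv x ^ c / x) (c * D.m - 1) 1 := by
  have h1 := (D.fv_deriv.rpow_const (p := c) (Or.inl (by rw [D.fv_one]; norm_num))).div (hasDerivAt_id 1) (by norm_num)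
  refine h1.congr_deriv ?_
  simp [D.fv_one]; ring

theorem chern_eta {ε : ℝ} (hε : 0 < ε) (hε1 : ε < 1) : ∃ η, 0 < η ∧ η < 1 ∧ ∀ n k : ℕ, ε * n ≤ |n - k * D.m| → ∃ x, 0 < x ∧ x ≤ D.R ∧ D.fv x ^ k ≤ (η * x) ^ n := by
  have hm := D.m_pos
  have hR := D.hR
  obtain ⟨x1, h1, h1R, hx1⟩ : ∃ x, 1 < x ∧ x < D.R ∧ D.fv x ^ ((1 - ε) / D.m) / x < 1 := by
    have hd := hasDerivAt_iff_tendsto_slope.1 (D.phi_deriv ((1 - ε) / D.m))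
    have h2 := (hd.mono_left (nhdsWithin_mono 1 (s := Set.Ioi 1) fun x hx => ne_of_gt hx)).eventually_lt_const (u := 0) (by rw [div_mul_cancel₀ _ hm.ne']; linarith)
    obtain ⟨x, hx, hx2⟩ := (h2.and (Ioo_mem_nhdsGT hR)).exists
    refine ⟨x, hx2.1, hx2.2, ?_⟩
    rw [slope_def_field, div_lt_iff₀ (by linarith [hx2.1]), D.fv_one] at hx
    simp at hx; linarith
  obtain ⟨x2, h2, h21, hx2⟩ : ∃ x, 0 < x ∧ x < 1 ∧ D.fv x ^ ((1 + ε) / D.m) / x < 1 := by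
    have hd := hasDerivAt_iff_tendsto_slope.1 (D.phi_deriv ((1 + ε) / D.m))
    have h2 := (hd.mono_left (nhdsWithin_mono 1 (s := Set.Iio 1) fun x hx => ne_of_lt hx)).eventually (lt_mem_nhds (a := 0) (by rw [div_mul_cancel₀ _ hm.ne']; linarith))
    obtain ⟨x, hx, hx2⟩ := (h2.and (Ioo_mem_nhdsLT (zero_lt_one (α := ℝ)))).exists
    refine ⟨x, hx2.1, hx2.2, ?_⟩
    rw [slope_def_field, lt_div_iff_of_neg (by linarith [hx2.2]), D.fv_one] at hx
    simp at hx; linarith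
  have p1 := D.fv_pos (by linarith : 0 < x1) h1R.le
  have p2 := D.fv_pos h2 (by linarith)
  have key : ∀ (x c : ℝ) (n k : ℕ), 0 < x → 0 < D.fv x → D.fv x ^ (k : ℝ) ≤ D.fv x ^ (c * n) → D.fv x ^ k ≤ ((D.fv x ^ c / x) * x) ^ n := by
    intro x c n k hx hp h
    rw [Real.rpow_natCast] at h
    rw [div_mul_cancel₀ _ hx.ne', ← Real.rpow_natCast, ← Real.rpow_natCast, ← Real.rpow_mul hp.le]
    simpa using h
  refine ⟨max (D.fv x1 ^ ((1 - ε) / D.m) / x1) (D.fv x2 ^ ((1 + ε) / D.m) / x2), lt_max_of_lt_left (by positivity), max_lt hx1 hx2, fun n k h => ?_⟩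
  rcases le_abs.1 h with h | h
  · refine ⟨x1, by linarith, h1R.le, (key x1 ((1 - ε) / D.m) n k (by linarith) p1 ?_).trans ?_⟩
    · refine Real.rpow_le_rpow_of_exponent_le (by rw [← D.fv_one]; exact D.fv_mono (by norm_num) h1.le h1R.le) ?_
      rw [div_mul_eq_mul_div, le_div_iff₀ hm]; linarith
    · have : 0 < x1 := by linarith
      gcongr; exact le_max_left _ _
  · refine ⟨x2, h2, by linarith, (key x2 ((1 + ε) / D.m) n k h2 p2 ?_).trans ?_⟩
    · refine Real.rpow_le_rpow_of_exponent_ge p2 (by rw [← D.fv_one]; exact D.fv_mono h2.le h21.le hR.le) ?_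
      rw [div_mul_eq_mul_div, div_le_iff₀ hm]; linarith
    · gcongr; exact le_max_right _ _

theorem chern_h {η : ℝ} {n k : ℕ} (h : ∃ x, 0 < x ∧ x ≤ D.R ∧ D.fv x ^ k ≤ (η * x) ^ n) (θ : ℝ) :
    ‖coeff n (D.h θ ^ k)‖ ≤ η ^ n * Real.exp (D.K * θ ^ 2) ^ k := by
  obtain ⟨x, h0, hR, hx⟩ := h
  obtain ⟨F, hF⟩ : ∃ F : ℝ⟦X⟧, F = PowerSeries.mk fun j => ‖coeff j (D.h θ)‖ := ⟨_, rfl⟩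
  have hFc : ∀ j, coeff j F = ‖coeff j (D.h θ)‖ := fun j => by rw [hF, coeff_mk]
  refine (norm_pow_le (F := F) (fun j => (hFc j).ge) k n).trans ?_
  have hs := D.h_sum θ x h0.le hR
  have hd := D.h_dom θ x h0.le hR
  have h1 := chern (F := F) (fun j => by rw [hFc]; positivity) h0.le (by simpa [hFc] using hs) n k
  simp_rw [hFc] at h1
  have hp := D.fv_pos h0 hR
  refine le_of_mul_le_mul_right (h1.trans ?_) (pow_pos h0 n)
  calc _ ≤ (D.fv x * Real.exp (D.K * θ ^ 2)) ^ k := by gcongr; exact hd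
    _ ≤ (η * x) ^ n * Real.exp (D.K * θ ^ 2) ^ k := by rw [mul_pow]; gcongr
    _ = _ := by rw [mul_pow]; ring

theorem h_zero : D.h 0 = map Complex.ofRealHom D.f := by
  ext j
  have := D.h_v 0 j
  simp [sub_eq_zero] at this
  rw [this, coeff_map]; rfl

theorem h_zero_pow (n k : ℕ) : coeff n (D.h 0 ^ k) = ((coeff n (D.f ^ k) : ℝ) : ℂ) := by
  rw [D.h_zero, ← map_pow, coeff_map]; rfl

theorem chern_f {η : ℝ} {n k : ℕ} (h : ∃ x, 0 < x ∧ x ≤ D.R ∧ D.fv x ^ k ≤ (η * x) ^ n) : coeff n (D.f ^ k) ≤ η ^ n := by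
  have := D.chern_h h 0
  rw [D.h_zero_pow, Complex.norm_real] at this
  simpa using (le_abs_self _).trans this

theorem renew_h (θ : ℝ) (N n : ℕ) : ∑ k ∈ Finset.range (N + 1), ‖coeff n (D.h θ ^ k)‖ ≤ Real.exp (D.K * θ ^ 2) ^ N := by
  obtain ⟨E, hE⟩ : ∃ E, E = Real.exp (D.K * θ ^ 2) := ⟨_, rfl⟩
  have hE1 : 1 ≤ E := by rw [hE]; exact Real.one_le_exp (mul_nonneg D.hK (sq_nonneg _))
  rw [← hE]
  obtain ⟨F, hF⟩ : ∃ F : ℝ⟦X⟧, F = PowerSeries.mk fun j => E⁻¹ * ‖coeff j (D.h θ)‖ := ⟨_, rfl⟩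
  have hFc : ∀ j, coeff j F = E⁻¹ * ‖coeff j (D.h θ)‖ := fun j => by rw [hF, coeff_mk]
  have hs := D.h_sum θ 1 (by norm_num) D.hR.le
  have hd := D.h_dom θ 1 (by norm_num) D.hR.le
  simp only [one_pow, mul_one] at hs hd
  rw [D.f_sum.tsum_eq, one_mul, ← hE] at hd
  have h1 := renew_le_one (F := F) (fun j => by rw [hFc]; positivity) (by rw [hFc, D.h_0]; simp) (by simp_rw [hFc]; exact hs.mul_left _)
    (by simp_rw [hFc]; rw [tsum_mul_left, inv_mul_le_one₀ (by positivity)]; exact hd) (N + 1) n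
  calc _ ≤ ∑ k ∈ Finset.range (N + 1), E ^ N * coeff n (F ^ k) := by
        refine Finset.sum_le_sum fun k hk => ?_
        have h2 := norm_pow_le (h := D.h θ) (F := (E : ℝ) • F) (fun j => by rw [coeff_smul, hFc, smul_eq_mul, mul_inv_cancel_left₀ (by positivity)]) k n
        rw [smul_pow, coeff_smul, smul_eq_mul] at h2
        refine h2.trans (mul_le_mul_of_nonneg_right (pow_le_pow_right₀ hE1 (by simp at hk; omega)) ?_)
        exact NN.pow (fun j => by rw [hFc]; positivity) k n
    _ ≤ _ := by rw [← Finset.mul_sum]; exact mul_le_of_le_one_right (by positivity) h1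

theorem renew_f (N n : ℕ) : ∑ k ∈ Finset.range (N + 1), coeff n (D.f ^ k) ≤ 1 := by
  have := D.renew_h 0 N n
  simp_rw [D.h_zero_pow, Complex.norm_real] at this
  refine (Finset.sum_le_sum fun k _ => le_abs_self _).trans (this.trans ?_)
  simp

theorem Dc_cp (a : ℕ → ℝ) (C : ℝ) (hC : 0 ≤ C) (ha : ∀ k, |a k| ≤ C * ww k) : Dc (cp D.f a) := by
  obtain ⟨η, h0, h1, hη⟩ := D.chern_eta (ε := 1 / 2) (by norm_num) (by norm_num)
  obtain ⟨B, hB0, hB⟩ : ∃ B, 0 ≤ B ∧ ∀ n : ℕ, ((n : ℝ) + 1) ^ 3 * η ^ n ≤ B := ⟨_, tsum_nonneg fun i => by positivity, fun j => (summ_cube h0 h1).le_tsum j (fun i _ => by positivity)⟩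
  obtain ⟨M, hM⟩ := exists_nat_ge (2 * D.m)
  refine ⟨C * B + C * (M + 1) ^ 2, fun n => ?_⟩
  unfold cp
  rw [coeff_mk]
  have hw := ww_pos n
  have hw1 : ∀ k, ww k ≤ 1 := by
    intro k; unfold ww
    rw [div_le_one (by positivity)]
    have : (1:ℝ) ≤ (k : ℝ) + 1 := by have := Nat.cast_nonneg (α := ℝ) k; linarith
    exact one_le_mul_of_one_le_of_one_le this (Real.one_le_sqrt.2 this)
  have hwn : 1 / ((n : ℝ) + 1) ^ 2 ≤ ww n := by
    unfold ww
    rw [sq]; gcongr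
    rw [Real.sqrt_le_left (by positivity)]
    have := Nat.cast_nonneg (α := ℝ) n
    nlinarith
  calc _ ≤ ∑ k ∈ Finset.range (n + 1), |a k * coeff n (D.f ^ k)| := Finset.abs_sum_le_sum_abs _ _
    _ ≤ ∑ k ∈ Finset.range (n + 1), (C * η ^ n + C * (M + 1) ^ 2 * ww n * coeff n (D.f ^ k)) := by
      refine Finset.sum_le_sum fun k _ => ?_
      have hf := D.f_nn.pow k n
      rw [abs_mul, abs_of_nonneg hf]
      by_cases hk : 1 / 2 * (n : ℝ) ≤ |n - k * D.m|
      · have h2 := D.chern_f (hη n k hk)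
        have : |a k| ≤ C := (ha k).trans (mul_le_of_le_one_right hC (hw1 k))
        have h3 : |a k| * coeff n (D.f ^ k) ≤ C * η ^ n := by gcongr
        have h4 : 0 ≤ C * (M + 1) ^ 2 * ww n * coeff n (D.f ^ k) := by positivity
        linarith
      · push Not at hk
        have h5 : (n : ℝ) + 1 ≤ (M + 1) * (k + 1) := by
          have := (abs_lt.1 hk).2
          have := mul_le_mul_of_nonneg_right hM (Nat.cast_nonneg (α := ℝ) k)
          nlinarith [Nat.cast_nonneg (α := ℝ) k, Nat.cast_nonneg (α := ℝ) M]
        have h6 : ww k ≤ (M + 1) ^ 2 * ww n := by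
          have := ww_add k (k * M + M)
          have h8 : n ≤ k + (k * M + M) := by
            have : n + 1 ≤ (M + 1) * (k + 1) := by exact_mod_cast h5
            nlinarith
          unfold ww
          rw [← mul_div_assoc, mul_one, div_le_div_iff₀ (by positivity) (by positivity), one_mul]
          have h9 : Real.sqrt ((n : ℝ) + 1) ≤ (M + 1) * Real.sqrt (k + 1) := by
            refine (Real.sqrt_le_sqrt h5).trans ?_
            rw [Real.sqrt_mul (by positivity)]
            gcongr
            rw [Real.sqrt_le_left (by positivity)]
            have := Nat.cast_nonneg (α := ℝ) M
            nlinarith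
          calc _ ≤ ((M + 1) * ((k:ℝ) + 1)) * ((M + 1) * Real.sqrt (k + 1)) := by gcongr
            _ = _ := by ring
        have : 0 ≤ C * η ^ n := by positivity
        calc _ ≤ C * ((M + 1) ^ 2 * ww n) * coeff n (D.f ^ k) := by gcongr; exact (ha k).trans (by gcongr)
          _ = C * (M + 1) ^ 2 * ww n * coeff n (D.f ^ k) := by ring
          _ ≤ _ := by linarith
    _ ≤ C * (B * ww n) + C * (M + 1) ^ 2 * ww n * 1 := by
      rw [Finset.sum_add_distrib, ← Finset.mul_sum, Finset.sum_const, Finset.card_range, nsmul_eq_mul]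
      have h7 : ((n : ℝ) + 1) * η ^ n ≤ B * ww n := by
        calc ((n : ℝ) + 1) * η ^ n = (((n : ℝ) + 1) ^ 3 * η ^ n) * (1 / ((n : ℝ) + 1) ^ 2) := by field_simp
          _ ≤ B * ww n := by gcongr; exact hB n
      have h8 := D.renew_f n n
      push_cast
      calc _ = C * (((n : ℝ) + 1) * η ^ n) + C * (M + 1) ^ 2 * ww n * ∑ k ∈ Finset.range (n + 1), coeff n (D.f ^ k) := by rw [Finset.mul_sum (Finset.range (n+1)) _ (C * (M + 1) ^ 2 * ww n)]; try ring
        _ ≤ _ := by gcongr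
    _ = _ := by ring

end Ren
end PSys

namespace PSys
open PowerSeries
open scoped ENNReal

theorem zero_of_small {a v : ℝ} (h : ∀ θ : ℝ, 0 < θ → θ < 1 → |a| ≤ θ * v) : a = 0 := by
  by_contra ha
  have h0 := abs_pos.2 ha
  have h1 := h (1/2) (by norm_num) (by norm_num)
  have hv : 0 < v := by linarith
  have h2 := h (min (1/2) (|a| / (2 * v))) (by positivity) (by have := min_le_left (1/2) (|a| / (2 * v)); linarith)
  have h3 : min (1/2) (|a| / (2 * v)) * v ≤ |a| / (2 * v) * v := by gcongr; exact min_le_right _ _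
  have h4 : |a| / (2 * v) * v = |a| / 2 := by field_simp
  linarith

theorem coeff_fG {R : Type} [CommRing R] {f G : R⟦X⟧} (h : coeff 0 f = 0) (h' : coeff 0 G = 0) {n a b : ℕ} (hn : n < a + b) : coeff n (f ^ a * G ^ b) = 0 := by
  have h1 : X ∣ f := X_dvd_iff.2 (by simpa using h)
  have h2 : X ∣ G := X_dvd_iff.2 (by simpa using h')
  have := mul_dvd_mul (pow_dvd_pow_of_dvd h1 a) (pow_dvd_pow_of_dvd h2 b)
  rw [← pow_add] at this
  exact X_pow_dvd_iff.1 this n hn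

theorem Dc.add {F G : ℝ⟦X⟧} (hF : Dc F) (hG : Dc G) : Dc (F + G) := by
  obtain ⟨C, hC⟩ := hF
  obtain ⟨C', hC'⟩ := hG
  refine ⟨C + C', fun n => ?_⟩
  rw [map_add, add_mul]
  exact (abs_add_le _ _).trans (add_le_add (hC n) (hC' n))

namespace Ren
variable (D : Ren)

noncomputable def s2 : ℝ := 2 * (∑' j, coeff j D.f2) / D.m

theorem f1_0 : coeff 0 D.f1 = 0 := by
  refine zero_of_small (v := D.v 0) fun θ h0 h1 => ?_
  have h := (Complex.abs_im_le_norm _).trans (D.h_v θ 0)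
  rw [D.h_0, D.f_0] at h
  simp [← Complex.ofReal_pow] at h
  rw [abs_of_pos h0] at h
  have hv := D.v_nn 0
  have : θ * |coeff 0 D.f1| ≤ θ * (θ * D.v 0) := by
    simp only [coeff_zero_eq_constantCoeff] at *
    refine h.trans ?_
    have : θ ^ 3 ≤ θ ^ 2 := pow_le_pow_of_le_one h0.le h1.le (by norm_num)
    calc _ ≤ θ ^ 2 * D.v 0 := by gcongr
      _ = _ := by ring
  exact le_of_mul_le_mul_left this h0

theorem f2_0 : coeff 0 D.f2 = 0 := by
  refine zero_of_small (v := D.v 0) fun θ h0 h1 => ?_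
  have h := (Complex.abs_re_le_norm _).trans (D.h_v θ 0)
  rw [D.h_0, D.f_0, D.f1_0] at h
  simp [← Complex.ofReal_pow] at h
  rw [abs_of_pos h0] at h
  simp only [coeff_zero_eq_constantCoeff] at *
  exact le_of_mul_le_mul_left (a := θ ^ 2) (by linarith) (by positivity)

theorem mom_lin (G : ℝ⟦X⟧) (hG : Gd G) (h0 : coeff 0 G = 0) (hs : HasSum (fun j => coeff j G) 0) :
    Dc (PowerSeries.mk fun n => ∑ k ∈ Finset.range (n + 1), cc k * (k * coeff n (D.f ^ (k - 1) * G))) := by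
  obtain ⟨W, hW, hWe, -⟩ := D.W_ex
  obtain ⟨q, C, hq, hq1, hC, hb⟩ := hG
  obtain ⟨E, hE, hEb⟩ := div_one_sub G C q hq hq1 hb hs
  have hEG : Gd E := ⟨q, _, hq, hq1, div_nonneg hC (by linarith), hEb⟩
  obtain ⟨B, hB, hdp⟩ := dp_bd
  have key : (PowerSeries.mk fun n => ∑ k ∈ Finset.range (n + 1), cc k * (k * coeff n (D.f ^ (k - 1) * G))) = E * (W * cp D.f (df fun k => dd (k + 1))) := by
    rw [← cp_df D.f_0]
    have : E * (W * ((1 - D.f) * cp D.f fun k => dd (k + 1))) = (cp D.f fun k => dd (k + 1)) * G := by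
      calc _ = E * (W * (1 - D.f)) * (cp D.f fun k => dd (k + 1)) := by ring
        _ = _ := by rw [← hWe, hE]; ring
    rw [this]
    ext n
    rw [coeff_mk, cp_mul D.f_0 _ _ n (n + 1) (by omega)]
    have h1 : ∑ k ∈ Finset.range (n + 2), cc k * (k * coeff n (D.f ^ (k - 1) * G)) = ∑ k ∈ Finset.range (n + 1), cc k * (k * coeff n (D.f ^ (k - 1) * G)) := by
      rw [Finset.sum_range_succ]
      have := coeff_fG D.f_0 h0 (n := n) (a := n) (b := 1) (by omega)
      rw [pow_one] at this
      simp [this]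
    rw [← h1, Finset.sum_range_succ']
    simp [dd, mul_assoc, mul_left_comm]
  rw [key]
  exact (Dc.mul hEG (Dc.mul hW (D.Dc_cp _ B hB hdp)))

theorem mom1 : ∃ C, ∀ n, |∑ k ∈ Finset.range (n + 1), cc k * (k * coeff n (D.f ^ (k - 1) * D.f1))| ≤ C * ww n := by
  obtain ⟨C, h⟩ := D.mom_lin D.f1 (D.gd_of D.f1_v) D.f1_0 D.f1_sum
  exact ⟨C, fun n => by simpa using h n⟩

theorem quad : Dc (PowerSeries.mk fun n => ∑ k ∈ Finset.range (n + 1), cc k * ((k : ℝ) * (k - 1) / 2 * coeff n (D.f ^ (k - 2) * D.f1 ^ 2))) := by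
  obtain ⟨W, hW, hWe, -⟩ := D.W_ex
  obtain ⟨q, C, hq, hq1, hC, hb⟩ := D.gd_of D.f1_v
  obtain ⟨E, hE, hEb⟩ := div_one_sub D.f1 C q hq hq1 hb D.f1_sum
  have hEG : Gd E := ⟨q, _, hq, hq1, div_nonneg hC (by linarith), hEb⟩
  obtain ⟨B, hB, hdp⟩ := bb_bd
  obtain ⟨b, hbb⟩ : ∃ b : ℕ → ℝ, b = fun k => (k + 1) * dd (k + 2) / 2 := ⟨_, rfl⟩
  have key : (PowerSeries.mk fun n => ∑ k ∈ Finset.range (n + 1), cc k * ((k : ℝ) * (k - 1) / 2 * coeff n (D.f ^ (k - 2) * D.f1 ^ 2))) = E * (E * (W * (W * cp D.f (df (df b))))) := by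
    rw [← cp_df D.f_0, ← cp_df D.f_0]
    have : E * (E * (W * (W * ((1 - D.f) * ((1 - D.f) * cp D.f b))))) = (cp D.f b) * D.f1 ^ 2 := by
      calc _ = E ^ 2 * (W * (1 - D.f)) ^ 2 * (cp D.f b) := by ring
        _ = _ := by rw [← hWe, hE]; ring
    rw [this]
    ext n
    rw [coeff_mk, cp_mul D.f_0 _ _ n (n + 1) (by omega)]
    have h1 : ∑ k ∈ Finset.range (n + 3), cc k * ((k : ℝ) * (k - 1) / 2 * coeff n (D.f ^ (k - 2) * D.f1 ^ 2)) = ∑ k ∈ Finset.range (n + 1), cc k * ((k : ℝ) * (k - 1) / 2 * coeff n (D.f ^ (k - 2) * D.f1 ^ 2)) := by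
      rw [Finset.sum_range_succ, Finset.sum_range_succ]
      have h2 := coeff_fG D.f_0 D.f1_0 (n := n) (a := n + 2 - 2) (b := 2) (by omega)
      rw [h2, coeff_fG D.f_0 D.f1_0 (n := n) (a := n + 1 - 2) (b := 2) (by omega)]
      simp
    rw [← h1, Finset.sum_range_succ', Finset.sum_range_succ']
    simp only [Nat.cast_zero, zero_mul, zero_div, mul_zero, add_zero, Nat.cast_add, Nat.cast_one, zero_add, sub_self, hbb, dd]
    refine Finset.sum_congr rfl fun k _ => ?_
    rw [show k + 1 + 1 - 2 = k by omega]
    push_cast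
    ring
  rw [key, hbb]
  exact Dc.mul hEG (Dc.mul hEG (Dc.mul hW (Dc.mul hW (D.Dc_cp _ B hB hdp))))

theorem mom2 : ∃ C, ∀ n : ℕ, |∑ k ∈ Finset.range (n + 1), cc k * (k * coeff n (D.f ^ (k - 1) * D.f2) + (k : ℝ) * (k - 1) / 2 * coeff n (D.f ^ (k - 2) * D.f1 ^ 2))
    - D.s2 / 2 * n * ∑ k ∈ Finset.range (n + 1), cc k * coeff n (D.f ^ k)| ≤ C * ww n := by
  have hm := D.m_pos
  obtain ⟨c, hc⟩ : ∃ c, c = D.s2 / 2 := ⟨_, rfl⟩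
  obtain ⟨t, ht⟩ : ∃ t : ℝ⟦X⟧, t = X * derivative ℝ D.f := ⟨_, rfl⟩
  have hX : ∀ (F : ℝ⟦X⟧) (n : ℕ), coeff n (X * derivative ℝ F) = n * coeff n F := by
    intro F n
    cases n with
    | zero => simp
    | succ n => rw [coeff_succ_X_mul, coeff_derivative]; push_cast; ring
  have htc : ∀ j, coeff j t = j * coeff j D.f := fun j => by rw [ht, hX]
  have hpow : ∀ n k : ℕ, (n : ℝ) * coeff n (D.f ^ k) = k * coeff n (D.f ^ (k - 1) * t) := by
    intro n k
    rw [← hX, derivative_pow, ht]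
    rw [show X * ((k : ℝ⟦X⟧) * D.f ^ (k - 1) * derivative ℝ D.f) = C (k : ℝ) * (D.f ^ (k - 1) * (X * derivative ℝ D.f)) by rw [map_natCast]; ring, coeff_C_mul]
  have hG : Gd (D.f2 - C c * t) := by
    obtain ⟨r, h1, h2⟩ := exists_between D.q_lt
    have hq := D.q_pos
    have hV := D.V_nn
    have hr : 0 < r := by linarith
    have hqr : D.q / r < 1 := (div_lt_one hr).2 h1
    obtain ⟨B, hB0, hB⟩ : ∃ B, 0 ≤ B ∧ ∀ n : ℕ, ((n : ℝ) + 1) ^ 3 * (D.q / r) ^ n ≤ B := ⟨_, tsum_nonneg fun i => by positivity, fun j => (summ_cube (by positivity) hqr).le_tsum j (fun i _ => by positivity)⟩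
    refine ⟨r, D.V + |c| * (D.V * B), hr, h2, by positivity, fun j => ?_⟩
    rw [map_sub, coeff_C_mul, htc]
    have hj := Nat.cast_nonneg (α := ℝ) j
    have a : (j : ℝ) ≤ (j + 1) ^ 3 := by nlinarith [sq_nonneg (j : ℝ), mul_nonneg hj (sq_nonneg (j : ℝ))]
    have b : (j : ℝ) * D.q ^ j ≤ B * r ^ j := by
      have := hB j
      rw [div_pow, ← mul_div_assoc, div_le_iff₀ (by positivity)] at this
      refine le_trans ?_ this
      gcongr
    calc _ ≤ ‖coeff j D.f2‖ + ‖c * (j * coeff j D.f)‖ := norm_sub_le _ _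
      _ = |coeff j D.f2| + |c| * (j * |coeff j D.f|) := by simp
      _ ≤ D.V * D.q ^ j + |c| * (j * (D.V * D.q ^ j)) := by
        gcongr
        · exact (D.f2_v j).trans (D.v_le j)
        · exact (D.f_v j).trans (D.v_le j)
      _ = D.V * D.q ^ j + |c| * (D.V * (j * D.q ^ j)) := by ring
      _ ≤ D.V * r ^ j + |c| * (D.V * (B * r ^ j)) := by gcongr
      _ = _ := by ring
  have hs : HasSum (fun j => coeff j (D.f2 - C c * t)) 0 := by
    have h1 := (D.gd_of D.f2_v).sum0.of_norm.hasSum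
    have h2 := h1.sub (D.mf_sum.hasSum.mul_left c)
    have h3 : ∑' j, coeff j D.f2 - c * ∑' j : ℕ, (j : ℝ) * coeff j D.f = 0 := by
      change _ - c * D.m = 0
      rw [hc, s2]; field_simp; ring
    rw [h3] at h2
    refine h2.congr_fun fun j => ?_
    rw [map_sub, coeff_C_mul, htc]
  obtain ⟨B, hB⟩ := (D.mom_lin _ hG (by rw [map_sub, coeff_C_mul, htc, D.f2_0]; simp) hs).add D.quad
  refine ⟨B, fun n => ?_⟩
  refine le_trans (le_of_eq ?_) (hB n)
  congr 1
  rw [map_add, coeff_mk, coeff_mk, Finset.mul_sum, ← Finset.sum_sub_distrib, ← Finset.sum_add_distrib]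
  refine Finset.sum_congr rfl fun k _ => ?_
  rw [← hc, mul_sub (D.f ^ (k - 1)), map_sub, show D.f ^ (k - 1) * (C c * t) = C c * (D.f ^ (k - 1) * t) by ring, coeff_C_mul]
  linear_combination (-c * cc k) * hpow n k

end Ren
end PSys

namespace PSys
open PowerSeries
open scoped ENNReal

theorem stir_pos (k : ℕ) (hk : k ≠ 0) : 0 < Stirling.stirlingSeq k := by
  obtain ⟨j, rfl⟩ := Nat.exists_eq_succ_of_ne_zero hk
  exact Stirling.stirlingSeq'_pos j

theorem th_lim (s : ℝ) : Filter.Tendsto (fun n : ℕ => s / Real.sqrt n) Filter.atTop (nhds 0) :=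
  tendsto_const_nhds.div_atTop (Real.tendsto_sqrt_atTop.comp tendsto_natCast_atTop_atTop)

namespace Ren
variable (D : Ren)

noncomputable def L (θ : ℝ) : ℂ := ∑' j, coeff j (D.h θ)
noncomputable def V1 : ℝ := ∑' j, D.v j
noncomputable def A : ℝ := ∑' j, coeff j D.f2

theorem v_summ : Summable D.v := by
  refine Summable.of_nonneg_of_le D.v_nn (fun j => ?_) D.v_sum
  exact le_mul_of_one_le_right (D.v_nn j) (one_le_pow₀ D.hR.le)

theorem V1_nn : 0 ≤ D.V1 := tsum_nonneg D.v_nn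

theorem h_hasSum (θ : ℝ) : HasSum (fun j => coeff j (D.h θ)) (D.L θ) := by
  have := D.h_sum θ 1 (by norm_num) D.hR.le
  simp only [one_pow, mul_one] at this
  exact this.of_norm.hasSum

theorem lam3 (θ : ℝ) : ‖D.L θ - 1 + θ ^ 2 * D.A‖ ≤ |θ| ^ 3 * D.V1 := by
  have hA := (D.gd_of D.f2_v).sum0.of_norm.hasSum
  have h1 := ((D.h_hasSum θ).sub (((Complex.hasSum_ofReal.2 D.f_sum).add (((Complex.hasSum_ofReal.2 D.f1_sum).mul_left (θ : ℂ)).mul_right Complex.I)).sub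
    ((Complex.hasSum_ofReal.2 hA).mul_left ((θ : ℂ) ^ 2))))
  have h2 := tsum_of_norm_bounded (D.v_summ.hasSum.mul_left (|θ| ^ 3)) (D.h_v θ)
  rw [h1.tsum_eq] at h2
  refine le_trans (le_of_eq ?_) h2
  congr 1
  unfold A
  push_cast; ring

theorem lam2 : ∃ B, 0 ≤ B ∧ ∀ θ, |θ| ≤ 1 → ‖D.L θ - 1‖ ≤ B * θ ^ 2 := by
  refine ⟨|D.A| + D.V1, add_nonneg (abs_nonneg _) D.V1_nn, fun θ hθ => ?_⟩
  have h1 := D.lam3 θ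
  have hV := D.V1_nn
  have h2 : |θ| ^ 3 ≤ θ ^ 2 := by
    rw [← sq_abs]; exact pow_le_pow_of_le_one (abs_nonneg _) hθ (by norm_num)
  calc ‖D.L θ - 1‖ = ‖(D.L θ - 1 + θ ^ 2 * D.A) - ((θ ^ 2 * D.A : ℝ) : ℂ)‖ := by push_cast; congr 1; ring
    _ ≤ ‖D.L θ - 1 + θ ^ 2 * D.A‖ + ‖((θ ^ 2 * D.A : ℝ) : ℂ)‖ := norm_sub_le _ _
    _ ≤ θ ^ 2 * D.V1 + θ ^ 2 * |D.A| := by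
      rw [Complex.norm_real, Real.norm_eq_abs, abs_mul, abs_of_nonneg (sq_nonneg θ)]
      gcongr
      exact h1.trans (by gcongr)
    _ = _ := by ring

theorem sq_th (s : ℝ) (n : ℕ) : (s / Real.sqrt n) ^ 2 = s ^ 2 / n := by
  rw [div_pow, Real.sq_sqrt (Nat.cast_nonneg n)]

theorem lam_lim (s : ℝ) : Filter.Tendsto (fun n : ℕ => (n : ℂ) * (D.L (s / Real.sqrt n) - 1)) Filter.atTop (nhds (-(s ^ 2 * D.A : ℝ))) := by
  rw [← tendsto_sub_nhds_zero_iff, tendsto_zero_iff_norm_tendsto_zero]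
  have h0 := ((th_lim s).abs.mul_const (s ^ 2 * D.V1))
  rw [abs_zero, zero_mul] at h0
  refine squeeze_zero' (Filter.Eventually.of_forall fun n => norm_nonneg _) ?_ h0
  filter_upwards [Filter.eventually_gt_atTop 0] with n hn
  have hn' : (n : ℝ) ≠ 0 := by positivity
  have h1 := D.lam3 (s / Real.sqrt n)
  calc _ = ‖(n : ℂ) * (D.L (s / Real.sqrt n) - 1 + ((s / Real.sqrt n : ℝ) : ℂ) ^ 2 * D.A)‖ := by
        congr 1
        rw [← Complex.ofReal_pow, sq_th]
        push_cast
        have : (n : ℂ) ≠ 0 := by exact_mod_cast hn'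
        field_simp
        ring
    _ ≤ n * (|s / Real.sqrt n| ^ 3 * D.V1) := by
        rw [norm_mul, Complex.norm_natCast]; gcongr
    _ = _ := by
        rw [pow_succ, sq_abs, sq_th]; field_simp

theorem lam_inv (s : ℝ) : ∃ M, 0 ≤ M ∧ ∀ᶠ n : ℕ in Filter.atTop, D.L (s / Real.sqrt n) ≠ 0 ∧ ‖(D.L (s / Real.sqrt n))⁻¹ - 1‖ ≤ M / n ∧ ∀ k ≤ n, ‖(D.L (s / Real.sqrt n))⁻¹‖ ^ k ≤ Real.exp M := by
  obtain ⟨B, hB, h⟩ := D.lam2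
  refine ⟨2 * B * s ^ 2, by positivity, ?_⟩
  have hl := (th_lim s).abs
  rw [abs_zero] at hl
  have h4 : Filter.Tendsto (fun n : ℕ => B * (s / Real.sqrt n) ^ 2) Filter.atTop (nhds 0) := by
    have := ((th_lim s).pow 2).const_mul B
    simpa using this
  filter_upwards [Filter.eventually_gt_atTop 0, hl.eventually_lt_const (u := 1) one_pos, h4.eventually_lt_const (u := 1/2) (by norm_num)] with n hn h1 h2
  have h3 := h _ h1.le
  obtain ⟨l, hl⟩ : ∃ l, l = D.L (s / Real.sqrt n) := ⟨_, rfl⟩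
  rw [← hl] at h3 ⊢
  have hn' : (0:ℝ) < n := by positivity
  have h5 : 1 / 2 ≤ ‖l‖ := by
    have := norm_sub_norm_le (1:ℂ) l
    rw [norm_sub_rev, norm_one] at this
    linarith
  have h0 : l ≠ 0 := by rw [← norm_pos_iff]; linarith
  have h6 : ‖l⁻¹ - 1‖ ≤ 2 * B * s ^ 2 / n := by
    rw [show l⁻¹ - 1 = -((l - 1) * l⁻¹) by field_simp; ring, norm_neg, norm_mul, norm_inv]
    rw [sq_th] at h3
    calc _ ≤ B * (s ^ 2 / n) * (1 / 2 : ℝ)⁻¹ := by gcongr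
      _ = _ := by ring
  refine ⟨h0, h6, fun k hk => ?_⟩
  have h7 : ‖l⁻¹‖ ≤ Real.exp (2 * B * s ^ 2 / n) := by
    have := norm_le_norm_add_norm_sub (1 : ℂ) l⁻¹
    have h8 := Real.add_one_le_exp (2 * B * s ^ 2 / n)
    have h9 := norm_sub_norm_le l⁻¹ 1
    rw [norm_one] at h9
    linarith
  calc ‖l⁻¹‖ ^ k ≤ Real.exp (2 * B * s ^ 2 / n) ^ k := by gcongr
    _ = Real.exp (k * (2 * B * s ^ 2 / n)) := by rw [← Real.exp_nat_mul]
    _ ≤ _ := by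
      refine Real.exp_le_exp.2 ?_
      rw [mul_div_assoc', div_le_iff₀ hn', mul_comm]
      gcongr

noncomputable def c0 : ℝ := 1 / (Real.sqrt 2 * ((1 / D.m) * Real.sqrt (1 / D.m)) * Real.sqrt Real.pi)

theorem c0_pos : 0 < D.c0 := by have := D.m_pos; have := Real.pi_pos; unfold c0; positivity

theorem window (s : ℝ) (δ : ℝ) (hδ : 0 < δ) : ∃ ε, 0 < ε ∧ ε < 1 ∧ ∀ᶠ n : ℕ in Filter.atTop, ∀ k : ℕ, |n - k * D.m| < ε * n →
    ‖(((n * Real.sqrt n) * cc k : ℝ) : ℂ) * D.L (s / Real.sqrt n) ^ k - ((D.c0 * Real.exp (-(D.s2 * s ^ 2 / 2)) : ℝ) : ℂ)‖ < δ := by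
  have hm := D.m_pos
  obtain ⟨l, hl⟩ : ∃ l : Filter (ℕ × ℕ), l = Filter.comap (fun p : ℕ × ℕ => (p.1, (p.2 : ℝ) / p.1)) (Filter.atTop ×ˢ nhds (1 / D.m)) := ⟨_, rfl⟩
  have t0 : Filter.Tendsto (fun p : ℕ × ℕ => (p.1, (p.2 : ℝ) / p.1)) l (Filter.atTop ×ˢ nhds (1 / D.m)) := by rw [hl]; exact Filter.tendsto_comap
  have t1 : Filter.Tendsto (fun p : ℕ × ℕ => p.1) l Filter.atTop := t0.fst
  have t2 : Filter.Tendsto (fun p : ℕ × ℕ => (p.2 : ℝ) / p.1) l (nhds (1 / D.m)) := t0.snd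
  have hmi : 0 < 1 / D.m := by positivity
  have t3 : Filter.Tendsto (fun p : ℕ × ℕ => p.2) l Filter.atTop := by
    have h1 : Filter.Tendsto (fun p : ℕ × ℕ => ((p.2 : ℝ) / p.1) * p.1) l Filter.atTop := t2.pos_mul_atTop hmi (tendsto_natCast_atTop_atTop.comp t1)
    refine tendsto_natCast_atTop_iff (R := ℝ) |>.1 (h1.congr' ?_)
    filter_upwards [t1.eventually_gt_atTop 0] with p hp
    have : (p.1 : ℝ) ≠ 0 := by positivity
    field_simp
  have ha : Filter.Tendsto (fun p : ℕ × ℕ => (p.1 * Real.sqrt p.1) * cc p.2) l (nhds D.c0) := by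
    have h1 : Filter.Tendsto (fun p : ℕ × ℕ => 1 / (Real.sqrt 2 * (((p.2 : ℝ) / p.1) * Real.sqrt ((p.2 : ℝ) / p.1)) * Stirling.stirlingSeq p.2)) l (nhds D.c0) := by
      unfold c0
      have hp := Real.pi_pos
      refine tendsto_const_nhds.div ((tendsto_const_nhds.mul (t2.mul t2.sqrt)).mul (Stirling.tendsto_stirlingSeq_sqrt_pi.comp t3)) (by positivity)
    refine h1.congr' ?_
    filter_upwards [t1.eventually_gt_atTop 0, t3.eventually_gt_atTop 0] with p h1 h2
    have h1' : (0 : ℝ) < p.1 := by positivity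
    have h2' : (0 : ℝ) < p.2 := by positivity
    have h3 := stir_pos p.2 (by omega)
    rw [cc_eq p.2 (by omega), Real.sqrt_div h2'.le]
    have h4 : 0 < Real.sqrt p.1 := by positivity
    have h5 : 0 < Real.sqrt p.2 := by positivity
    field_simp
  have hb : Filter.Tendsto (fun p : ℕ × ℕ => D.L (s / Real.sqrt p.1) ^ p.2) l (nhds ((Real.exp (-(D.s2 * s ^ 2 / 2)) : ℝ) : ℂ)) := by
    have h1 := Complex.tendsto_nat_mul_log_one_add_of_tendsto (D.lam_lim s)
    have h2 := ((Complex.continuous_ofReal.tendsto _).comp t2).mul (h1.comp t1)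
    have h3 := (Complex.continuous_exp.tendsto _).comp h2
    have e : Complex.exp (((1 / D.m : ℝ) : ℂ) * (-(s ^ 2 * D.A : ℝ))) = ((Real.exp (-(D.s2 * s ^ 2 / 2)) : ℝ) : ℂ) := by
      rw [Complex.ofReal_exp]
      congr 1
      rw [← Complex.ofReal_neg, ← Complex.ofReal_mul]
      congr 1
      unfold s2 A
      field_simp
    rw [e] at h3
    refine h3.congr' ?_
    obtain ⟨M, -, hM⟩ := D.lam_inv s
    filter_upwards [t1.eventually hM, t1.eventually_gt_atTop 0] with p hp h1
    have h1' : (p.1 : ℂ) ≠ 0 := by exact_mod_cast h1.ne'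
    simp only [Function.comp_apply]
    rw [← mul_assoc, add_sub_cancel]
    rw [show (((p.2 : ℝ) / p.1 : ℝ) : ℂ) * p.1 = p.2 by push_cast; field_simp, Complex.exp_nat_mul, Complex.exp_log hp.1]
  have hab := (((Complex.continuous_ofReal.tendsto _).comp ha).mul hb).sub_const ((D.c0 * Real.exp (-(D.s2 * s ^ 2 / 2)) : ℝ) : ℂ)
  rw [Complex.ofReal_mul, sub_self] at hab
  have hev := hab.norm.eventually_lt_const (u := δ) (by rwa [norm_zero])
  rw [hl, Filter.eventually_comap, Filter.eventually_prod_iff] at hev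
  obtain ⟨pa, hpa, pb, hpb, hh⟩ := hev
  obtain ⟨ε, hε, he⟩ := Metric.eventually_nhds_iff.1 hpb
  refine ⟨min (1 / 2) (ε * D.m), by positivity, by have := min_le_left (1/2) (ε * D.m); linarith, ?_⟩
  filter_upwards [hpa, Filter.eventually_gt_atTop 0] with n h1 h2 k hk
  have hn : (0 : ℝ) < n := by positivity
  have := hh h1 (he (y := (k : ℝ) / n) (by
    rw [Real.dist_eq, show (k : ℝ) / n - 1 / D.m = -((n - k * D.m) / (n * D.m)) by field_simp; ring, abs_neg, abs_div, abs_of_pos (mul_pos hn hm), div_lt_iff₀ (by positivity)]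
    refine hk.trans_le ?_
    calc _ ≤ ε * D.m * n := by gcongr; exact min_le_right _ _
      _ = _ := by ring)) (n, k) rfl
  simpa using this

end Ren
end PSys

namespace PSys
open PowerSeries
open scoped ENNReal

theorem cp_one {R : Type} [CommRing R] {f : R⟦X⟧} (h : coeff 0 f = 0) : (1 - f) * cp f (fun _ => 1) = 1 := by
  rw [cp_df h]
  ext n
  rw [cp_coeff h _ n (n + 1) (by omega), Finset.sum_range_succ']
  simp [df]

theorem coeff_Cpow {R : Type} [CommRing R] (l : R) (f : R⟦X⟧) (n k : ℕ) : coeff n ((C l * f) ^ k) = l ^ k * coeff n (f ^ k) := by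
  rw [mul_pow, ← map_pow, coeff_C_mul]

namespace Ren
variable (D : Ren)

theorem Msum (s : ℝ) : ∃ M, 0 ≤ M ∧ ∀ᶠ n : ℕ in Filter.atTop, ∀ i, ∑ k ∈ Finset.range (n + 1), ‖coeff i ((C (D.L (s / Real.sqrt n))⁻¹ * D.h (s / Real.sqrt n)) ^ k)‖ ≤ M := by
  obtain ⟨M, hM, h⟩ := D.lam_inv s
  refine ⟨Real.exp M * Real.exp (D.K * s ^ 2), by positivity, ?_⟩
  filter_upwards [h, Filter.eventually_gt_atTop 0] with n h hn i
  have hn' : (n : ℝ) ≠ 0 := by positivity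
  have h1 := D.renew_h (s / Real.sqrt n) n i
  rw [← Real.exp_nat_mul, sq_th, show (n : ℝ) * (D.K * (s ^ 2 / n)) = D.K * s ^ 2 by field_simp] at h1
  refine le_trans ?_ (mul_le_mul_of_nonneg_left h1 (Real.exp_pos M).le)
  rw [Finset.mul_sum]
  refine Finset.sum_le_sum fun k hk => ?_
  rw [coeff_Cpow, norm_mul, norm_pow]
  gcongr
  exact h.2.2 k (by simp at hk; omega)

theorem ug_lim : ∃ ω : ℝ, 0 < ω ∧ ∀ s, Filter.Tendsto (fun n : ℕ => ∑ k ∈ Finset.range (n + 1), coeff n ((C (D.L (s / Real.sqrt n))⁻¹ * D.h (s / Real.sqrt n)) ^ k)) Filter.atTop (nhds (ω : ℂ)) := by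
  obtain ⟨W, hW, hWe, hW0⟩ := D.W_ex
  obtain ⟨ω, hω⟩ : ∃ ω, ω = ∑' j, coeff j W := ⟨_, rfl⟩
  have hWf : W = (1 - X) * cp D.f (fun _ => 1) := by
    rw [hWe, mul_assoc, cp_one D.f_0, mul_one]
  have hu : ∀ n, coeff n (cp D.f fun _ => 1) = ∑ j ∈ Finset.range (n + 1), coeff j W := by
    intro n
    induction n with
    | zero => rw [hWf]; simp [sub_mul]
    | succ n ih =>
      rw [Finset.sum_range_succ, ← ih]
      conv_rhs => rw [hWf]
      rw [sub_mul, one_mul, map_sub, coeff_succ_X_mul]; ring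
  have hlim : Filter.Tendsto (fun n => coeff n (cp D.f fun _ => 1)) Filter.atTop (nhds ω) := by
    simp_rw [hu, hω]
    exact (hW.sum0.of_norm.hasSum.tendsto_sum_nat).comp (Filter.tendsto_add_atTop_nat 1)
  have hω0 : 0 ≤ ω := ge_of_tendsto' hlim fun n => by
    rw [cp_coeff D.f_0 _ n (n + 1) (by omega)]
    exact Finset.sum_nonneg fun k _ => by rw [one_mul]; exact D.f_nn.pow k n
  refine ⟨ω, lt_of_le_of_ne hω0 (by rw [hω]; exact hW0.symm), fun s => ?_⟩
  obtain ⟨φ, hφ⟩ : ∃ φ : ℝ →+* ℂ, φ = Complex.ofRealHom := ⟨_, rfl⟩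
  have hφc : ∀ x, φ x = (x : ℂ) := fun x => by rw [hφ]; rfl
  have hlimC : Filter.Tendsto (fun n => coeff n (map φ (cp D.f fun _ => 1))) Filter.atTop (nhds (ω : ℂ)) := by
    simp_rw [coeff_map, hφc]
    exact (Complex.continuous_ofReal.tendsto _).comp hlim
  rw [← sub_zero (ω : ℂ)]
  obtain ⟨M, hM, hMs⟩ := D.Msum s
  obtain ⟨M', hM', hMi⟩ := D.lam_inv s
  have hV := D.V_nn
  have hq := D.q_pos
  have hq1 : 0 < 1 - D.q := by have := D.q_lt; linarith
  have hl := (th_lim s).abs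
  rw [abs_zero] at hl
  obtain ⟨Ws, hWs⟩ : ∃ Ws, Ws = ∑' j, ‖coeff j (map φ W)‖ := ⟨_, rfl⟩
  have hWsum : Summable fun j => ‖coeff j (map φ W)‖ := by
    simp_rw [coeff_map, hφc, Complex.norm_real]; exact hW.sum0
  have hWs0 : 0 ≤ Ws := by rw [hWs]; exact tsum_nonneg fun _ => norm_nonneg _
  have hsmall : Filter.Tendsto (fun n : ℕ => ((1 + M') * (3 * |s / Real.sqrt n|) + M' / n) * D.V / (1 - D.q) * (1 - D.q)⁻¹ * (Ws * M)) Filter.atTop (nhds 0) := by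
    have h1 : Filter.Tendsto (fun n : ℕ => M' / (n : ℝ)) Filter.atTop (nhds 0) := tendsto_const_nhds.div_atTop tendsto_natCast_atTop_atTop
    have := ((((((hl.const_mul 3).const_mul (1 + M')).add h1).mul_const D.V).div_const (1 - D.q)).mul_const (1 - D.q)⁻¹).mul_const (Ws * M)
    simpa using this
  have hdiff : Filter.Tendsto (fun n : ℕ => coeff n (map φ (cp D.f fun _ => 1)) - ∑ k ∈ Finset.range (n + 1), coeff n ((C (D.L (s / Real.sqrt n))⁻¹ * D.h (s / Real.sqrt n)) ^ k)) Filter.atTop (nhds 0) := by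
    rw [tendsto_zero_iff_norm_tendsto_zero]
    refine squeeze_zero' (Filter.Eventually.of_forall fun n => norm_nonneg _) ?_ hsmall
    filter_upwards [hMs, hMi, hl.eventually_lt_const (u := 1) one_pos, Filter.eventually_gt_atTop 0] with n hMs hMi hθ hn
    obtain ⟨θ, hθe⟩ : ∃ θ, θ = s / Real.sqrt n := ⟨_, rfl⟩
    rw [← hθe] at hMs hMi hθ ⊢
    obtain ⟨l, hle⟩ : ∃ l, l = (D.L θ)⁻¹ := ⟨_, rfl⟩
    rw [← hle] at hMs hMi ⊢
    obtain ⟨g, hg⟩ : ∃ g, g = C l * D.h θ := ⟨_, rfl⟩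
    rw [← hg] at hMs ⊢
    obtain ⟨F, hF⟩ : ∃ F, F = map φ D.f := ⟨_, rfl⟩
    have hFc : ∀ j, coeff j F = coeff j D.f := fun j => by rw [hF, coeff_map, hφc]
    have hn1 : (1:ℝ) ≤ n := by exact_mod_cast hn
    have hl1 : ‖l‖ ≤ 1 + M' := by
      have h9 := norm_sub_norm_le l 1
      rw [norm_one] at h9
      have := hMi.2.1
      have : M' / n ≤ M' := div_le_self hM' hn1
      linarith
    have hgb : ∀ j, ‖coeff j (g - F)‖ ≤ ((1 + M') * (3 * |θ|) + M' / n) * D.V * D.q ^ j := by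
      intro j
      have h1 : coeff j (g - F) = l * (coeff j (D.h θ) - coeff j D.f) + (l - 1) * coeff j D.f := by
        rw [map_sub, hg, coeff_C_mul, hFc]; ring
      have hv := D.v_nn j
      have h2 : ‖coeff j (D.h θ) - coeff j D.f‖ ≤ 3 * |θ| * D.v j := by
        have a := D.h_v θ j
        have hθ0 := abs_nonneg θ
        have b2 : |θ| ^ 2 ≤ |θ| := pow_le_of_le_one hθ0 hθ.le (by norm_num)
        have b3 : |θ| ^ 3 ≤ |θ| := pow_le_of_le_one hθ0 hθ.le (by norm_num)
        calc _ = ‖(coeff j (D.h θ) - (coeff j D.f + θ * coeff j D.f1 * Complex.I - θ ^ 2 * coeff j D.f2)) + (θ * coeff j D.f1 * Complex.I - θ ^ 2 * coeff j D.f2)‖ := by congr 1; ring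
          _ ≤ |θ| ^ 3 * D.v j + (|θ| * |coeff j D.f1| + |θ| ^ 2 * |coeff j D.f2|) := by
            refine (norm_add_le _ _).trans (add_le_add a ((norm_sub_le _ _).trans (le_of_eq ?_)))
            simp [← Complex.ofReal_pow]
          _ ≤ |θ| * D.v j + (|θ| * D.v j + |θ| * D.v j) := by
            gcongr
            · exact D.f1_v j
            · exact D.f2_v j
          _ = _ := by ring
      rw [h1]
      calc _ ≤ ‖l‖ * ‖coeff j (D.h θ) - coeff j D.f‖ + ‖l - 1‖ * |coeff j D.f| := by
            refine (norm_add_le _ _).trans (le_of_eq ?_)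
            simp
        _ ≤ (1 + M') * (3 * |θ| * D.v j) + M' / n * D.v j := by
            gcongr
            · exact hMi.2.1
            · exact D.f_v j
        _ = ((1 + M') * (3 * |θ|) + M' / n) * D.v j := by ring
        _ ≤ ((1 + M') * (3 * |θ|) + M' / n) * (D.V * D.q ^ j) := by gcongr; exact D.v_le j
        _ = _ := by ring
    have hgs : HasSum (fun j => coeff j (g - F)) 0 := by
      have h1 := ((D.h_hasSum θ).mul_left l).sub (Complex.hasSum_ofReal.2 D.f_sum)
      rw [hle, inv_mul_cancel₀ hMi.1] at h1
      simp only [Complex.ofReal_one, sub_self] at h1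
      refine h1.congr_fun fun j => ?_
      rw [map_sub, hg, coeff_C_mul, hFc, hle]
    obtain ⟨E, hE, hEb⟩ := div_one_sub (g - F) _ D.q hq D.q_lt hgb hgs
    obtain ⟨c, hc⟩ : ∃ c, c = ((1 + M') * (3 * |θ|) + M' / n) * D.V / (1 - D.q) := ⟨_, rfl⟩
    rw [← hc] at hEb ⊢
    have hgeo := (hasSum_geometric_of_lt_one hq.le D.q_lt).mul_left c
    have hEs : Summable fun j => ‖coeff j E‖ := Summable.of_nonneg_of_le (fun _ => norm_nonneg _) hEb hgeo.summable
    have hEt : ∑' j, ‖coeff j E‖ ≤ c * (1 - D.q)⁻¹ := by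
      rw [← hgeo.tsum_eq]; exact hEs.tsum_le_tsum hEb hgeo.summable
    have hg0 : coeff 0 g = 0 := by rw [hg, coeff_C_mul, D.h_0, mul_zero]
    have hF0 : coeff 0 F = 0 := by rw [hFc, D.f_0]; simp
    have hUF : (1 - F) * map φ (cp D.f fun _ => 1) = 1 := by
      have := congrArg (map φ) (cp_one D.f_0)
      rw [map_mul, map_sub, map_one, ← hF] at this
      exact this
    have hUg := cp_one hg0
    have hWF : map φ W = (1 - X) * map φ (cp D.f fun _ => 1) := by
      rw [hWf, map_mul, map_sub, map_one, map_X]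
    have key : map φ (cp D.f fun _ => 1) - cp g (fun _ => 1) = -(E * (map φ W * cp g fun _ => 1)) := by
      obtain ⟨a, ha⟩ : ∃ a, a = map φ (cp D.f fun _ => 1) := ⟨_, rfl⟩
      obtain ⟨b, hb⟩ : ∃ b, b = cp g (fun _ => 1) := ⟨_, rfl⟩
      rw [← ha] at hUF hWF ⊢
      rw [← hb] at hUg ⊢
      rw [hWF]
      linear_combination (-a) * hUg + b * hUF + (-a * b) * hE
    have hcoef : ∑ k ∈ Finset.range (n + 1), coeff n (g ^ k) = coeff n (cp g fun _ => 1) := by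
      rw [cp_coeff hg0 _ n (n + 1) (by omega)]; simp
    rw [hcoef, ← map_sub, key, map_neg, norm_neg]
    have hUb : ∀ i ≤ n, ‖coeff i (cp g fun _ => 1)‖ ≤ M := by
      intro i hi
      rw [cp_coeff hg0 _ i (n + 1) (by omega)]
      refine (norm_sum_le _ _).trans ?_
      simpa using hMs i
    have h2 := bd_mul hWsum n M hM hUb
    rw [← hWs] at h2
    refine (bd_mul hEs n _ (by positivity) h2 n le_rfl).trans ?_
    gcongr
  have := hlimC.sub hdiff
  simpa using this

theorem main_lim : ∃ κ : ℝ, 0 < κ ∧ ∀ s : ℝ, Filter.Tendsto (fun n : ℕ => ((n * Real.sqrt n : ℝ) : ℂ) * ∑ k ∈ Finset.range (n + 1), (cc k : ℂ) * coeff n (D.h (s / Real.sqrt n) ^ k)) Filter.atTop (nhds ((κ * Real.exp (-(D.s2 * s ^ 2 / 2)) : ℝ) : ℂ)) := by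
  obtain ⟨ω, hω, hlim⟩ := D.ug_lim
  refine ⟨D.c0 * ω, mul_pos D.c0_pos hω, fun s => ?_⟩
  obtain ⟨φ, hφ⟩ : ∃ φ : ℝ, φ = D.c0 * Real.exp (-(D.s2 * s ^ 2 / 2)) := ⟨_, rfl⟩
  have hφ0 : 0 ≤ φ := by rw [hφ]; exact mul_nonneg D.c0_pos.le (Real.exp_pos _).le
  have h1 := (hlim s).const_mul (φ : ℂ)
  obtain ⟨M, hM, hMs⟩ := D.Msum s
  obtain ⟨M', hM', hMi⟩ := D.lam_inv s
  have hK := D.hK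
  suffices hd : Filter.Tendsto (fun n : ℕ => ((n * Real.sqrt n : ℝ) : ℂ) * ∑ k ∈ Finset.range (n + 1), (cc k : ℂ) * coeff n (D.h (s / Real.sqrt n) ^ k) - (φ : ℂ) * ∑ k ∈ Finset.range (n + 1), coeff n ((C (D.L (s / Real.sqrt n))⁻¹ * D.h (s / Real.sqrt n)) ^ k)) Filter.atTop (nhds 0) by
    have := hd.add h1
    simp only [sub_add_cancel, zero_add] at this
    rw [← Complex.ofReal_mul, hφ] at this
    convert this using 3
    ring
  rw [Metric.tendsto_nhds]
  intro ε hε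
  obtain ⟨δ, hδ, hδM⟩ : ∃ δ, 0 < δ ∧ δ * M ≤ ε / 2 := ⟨ε / (2 * (M + 1)), by positivity, by
    rw [div_mul_eq_mul_div, div_le_div_iff₀ (by positivity) (by norm_num)]; nlinarith⟩
  obtain ⟨e, he, he1, hwin⟩ := D.window s δ hδ
  rw [← hφ] at hwin
  obtain ⟨η, hη, hη1, hch⟩ := D.chern_eta he he1
  obtain ⟨B, hB⟩ : ∃ B, B = (Real.exp (D.K * s ^ 2) + φ * Real.exp M' * Real.exp (D.K * s ^ 2)) := ⟨_, rfl⟩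
  have hB0 : 0 ≤ B := by rw [hB]; positivity
  have hsm : Filter.Tendsto (fun n : ℕ => B * (((n : ℝ) + 1) ^ 3 * η ^ n)) Filter.atTop (nhds 0) := by
    have := (summ_cube hη hη1).tendsto_atTop_zero.const_mul B
    simpa using this
  filter_upwards [hMs, hMi, hwin, hsm.eventually_lt_const (u := ε / 2) (by positivity), Filter.eventually_gt_atTop 0] with n hMs hMi hwin hsm hn
  have hn' : (n : ℝ) ≠ 0 := by positivity
  have hn1 : (1:ℝ) ≤ n := by exact_mod_cast hn
  have hexp : ∀ k ≤ n, Real.exp (D.K * (s / Real.sqrt n) ^ 2) ^ k ≤ Real.exp (D.K * s ^ 2) := by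
    intro k hk
    rw [← Real.exp_nat_mul, sq_th]
    refine Real.exp_le_exp.2 ?_
    calc (k : ℝ) * (D.K * (s ^ 2 / n)) ≤ n * (D.K * (s ^ 2 / n)) := by gcongr
      _ = _ := by field_simp
  obtain ⟨θ, hθe⟩ : ∃ θ, θ = s / Real.sqrt n := ⟨_, rfl⟩
  rw [← hθe] at hMs hMi hwin hexp ⊢
  rw [dist_zero_right, Finset.mul_sum, Finset.mul_sum, ← Finset.sum_sub_distrib]
  have hsq : Real.sqrt n ≤ n := by rw [Real.sqrt_le_left (by positivity)]; nlinarith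
  have hterm : ∀ k ∈ Finset.range (n + 1), ‖((n * Real.sqrt n : ℝ) : ℂ) * ((cc k : ℂ) * coeff n (D.h θ ^ k)) - φ * coeff n ((C (D.L θ)⁻¹ * D.h θ) ^ k)‖ ≤
      δ * ‖coeff n ((C (D.L θ)⁻¹ * D.h θ) ^ k)‖ + B * (((n : ℝ) + 1) ^ 2 * η ^ n) := by
    intro k hk
    have hk' : k ≤ n := by simp at hk; omega
    by_cases hw : |(n : ℝ) - k * D.m| < e * n
    · have h2 := hwin k hw
      have h3 : coeff n (D.h θ ^ k) = D.L θ ^ k * coeff n ((C (D.L θ)⁻¹ * D.h θ) ^ k) := by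
        rw [coeff_Cpow, ← mul_assoc, ← mul_pow, mul_inv_cancel₀ hMi.1, one_pow, one_mul]
      have h4 : ((n * Real.sqrt n : ℝ) : ℂ) * ((cc k : ℂ) * coeff n (D.h θ ^ k)) - φ * coeff n ((C (D.L θ)⁻¹ * D.h θ) ^ k) =
          (((n * Real.sqrt n * cc k : ℝ) : ℂ) * D.L θ ^ k - φ) * coeff n ((C (D.L θ)⁻¹ * D.h θ) ^ k) := by
        rw [h3]; push_cast; ring
      rw [h4, norm_mul]
      have : 0 ≤ B * (((n : ℝ) + 1) ^ 2 * η ^ n) := by positivity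
      have := mul_le_mul_of_nonneg_right h2.le (norm_nonneg (coeff n ((C (D.L θ)⁻¹ * D.h θ) ^ k)))
      linarith
    · push Not at hw
      have h2 := D.chern_h (hch n k hw) θ
      have h3 : ‖coeff n (D.h θ ^ k)‖ ≤ η ^ n * Real.exp (D.K * s ^ 2) := h2.trans (by gcongr; exact hexp k hk')
      have hc1 : cc k ≤ 1 := by
        rcases Nat.eq_zero_or_pos k with h0 | h0
        · rw [h0]; simp [cc, TF.tc]
        · refine (cc_le k (by omega)).trans ?_
          have : (1:ℝ) ≤ k := by exact_mod_cast h0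
          rw [div_le_one (by positivity)]
          exact one_le_mul_of_one_le_of_one_le this (Real.one_le_sqrt.2 this)
      have hc0 := cc_nonneg k
      have h5 : 0 ≤ δ * ‖coeff n ((C (D.L θ)⁻¹ * D.h θ) ^ k)‖ := by positivity
      have hL := hMi.2.2 k hk'
      have hnn : (n : ℝ) * Real.sqrt n ≤ (n + 1) ^ 2 := by nlinarith
      have h1n : (1:ℝ) ≤ (n + 1) ^ 2 := by nlinarith
      calc _ ≤ (n * Real.sqrt n) * (cc k * ‖coeff n (D.h θ ^ k)‖) + φ * (‖(D.L θ)⁻¹‖ ^ k * ‖coeff n (D.h θ ^ k)‖) := by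
            refine (norm_sub_le _ _).trans (le_of_eq ?_)
            rw [coeff_Cpow, norm_mul, norm_mul, norm_mul, norm_mul, Complex.norm_real, Complex.norm_real, Complex.norm_real, norm_pow, Real.norm_of_nonneg hc0, Real.norm_of_nonneg hφ0,
              Real.norm_of_nonneg (by positivity : (0:ℝ) ≤ n * Real.sqrt n)]
        _ ≤ (n + 1) ^ 2 * (1 * (η ^ n * Real.exp (D.K * s ^ 2))) + φ * (Real.exp M' * (η ^ n * Real.exp (D.K * s ^ 2))) * (n + 1) ^ 2 := by
            refine add_le_add (by gcongr) ?_
            refine (le_mul_of_one_le_right (by positivity) h1n).trans ?_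
            gcongr
        _ = B * (((n : ℝ) + 1) ^ 2 * η ^ n) := by rw [hB]; ring
        _ ≤ _ := by linarith
  calc _ ≤ ∑ k ∈ Finset.range (n + 1), (δ * ‖coeff n ((C (D.L θ)⁻¹ * D.h θ) ^ k)‖ + B * (((n : ℝ) + 1) ^ 2 * η ^ n)) := norm_sum_le_of_le _ hterm
    _ = δ * ∑ k ∈ Finset.range (n + 1), ‖coeff n ((C (D.L θ)⁻¹ * D.h θ) ^ k)‖ + B * (((n : ℝ) + 1) ^ 3 * η ^ n) := by
        rw [Finset.sum_add_distrib, ← Finset.mul_sum, Finset.sum_const, Finset.card_range, nsmul_eq_mul]; push_cast; ring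
    _ < ε := by
        have := mul_le_mul_of_nonneg_left (hMs n) hδ.le
        linarith

end Ren
end PSys

namespace PSys
open PowerSeries
open scoped ENNReal
variable {𝒯 : Type} (S : PSys 𝒯)

noncomputable def p (n : ℕ) : ℝ := ((S.lvl n).card : ℝ)
noncomputable def av (n : ℕ) : ℝ := (∑ T ∈ S.lvl n, S.F T) / S.p n
noncomputable def vr (n : ℕ) : ℝ := (∑ T ∈ S.lvl n, (S.F T - S.av n) ^ 2) / S.p n

theorem lvl_succ (n : ℕ) : (S.lvl (n + 1)).Nonempty := by
  induction n with
  | zero => exact ⟨S.e.symm 0, by rw [S.mem_lvl, S.sz_eq]; simp⟩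
  | succ n ih =>
    obtain ⟨T, hT⟩ := ih
    refine ⟨S.e.symm (Finsupp.single T 1), ?_⟩
    rw [S.mem_lvl] at hT ⊢
    rw [S.sz_eq]; simp [hT]; omega

theorem p_pos {n : ℕ} (hn : 1 ≤ n) : 0 < S.p n := by
  obtain ⟨k, rfl⟩ : ∃ k, n = k + 1 := ⟨n - 1, by omega⟩
  unfold p
  exact_mod_cast Finset.card_pos.2 (S.lvl_succ k)

theorem sum_sub (n : ℕ) (hn : 1 ≤ n) (c : ℝ) : ∑ T ∈ S.lvl n, (S.F T - c) = S.p n * (S.av n - c) := by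
  have := (S.p_pos hn).ne'
  rw [Finset.sum_sub_distrib, Finset.sum_const, nsmul_eq_mul, av, mul_sub, mul_div_cancel₀ _ this]; rfl

theorem sum_sq (n : ℕ) (hn : 1 ≤ n) (c : ℝ) : ∑ T ∈ S.lvl n, (S.F T - c) ^ 2 = S.p n * (S.vr n + (S.av n - c) ^ 2) := by
  have hp := (S.p_pos hn).ne'
  have h1 : ∀ T, (S.F T - c) ^ 2 = (S.F T - S.av n) ^ 2 + 2 * (S.av n - c) * (S.F T - S.av n) + (S.av n - c) ^ 2 := fun T => by ring
  simp_rw [h1]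
  rw [Finset.sum_add_distrib, Finset.sum_add_distrib, ← Finset.mul_sum, S.sum_sub n hn, Finset.sum_const, nsmul_eq_mul, vr, mul_add, mul_div_cancel₀ _ hp, sub_self, mul_zero, mul_zero, add_zero]
  rfl

theorem asym : ∃ ρ μ σ C : ℝ, 0 < ρ ∧ 0 ≤ C ∧ HasSum (fun n => S.p n * ρ ^ n) 1 ∧
    (∀ a : ℕ, Filter.Tendsto (fun n => S.p n / S.p (n + a)) Filter.atTop (nhds (ρ ^ a))) ∧
    (∀ n : ℕ, 1 ≤ n → |S.av n - μ * n| ≤ C) ∧ (∀ n : ℕ, 1 ≤ n → |S.vr n - σ * n| ≤ C) ∧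
    ∀ s : ℝ, Filter.Tendsto (fun n : ℕ => (∑ T ∈ S.lvl n, Complex.exp ((s / Real.sqrt n * (S.F T - μ * n) : ℝ) * Complex.I)) / (S.p n : ℂ)) Filter.atTop (nhds ((Real.exp (-(σ * s ^ 2 / 2)) : ℝ) : ℂ)) := by
  obtain ⟨ρ, μ, D, h0, h1, hs, I0, I1, I2, Iθ⟩ := S.ren_exists
  obtain ⟨κ, hκ, hlim⟩ := D.main_lim
  have hl0 : Filter.Tendsto (fun n : ℕ => (n * Real.sqrt n) * (S.p n * ρ ^ n)) Filter.atTop (nhds κ) := by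
    have := hlim 0
    have h2 := (Complex.continuous_re.tendsto _).comp this
    simp only [zero_div] at h2
    have e : ((κ * Real.exp (-(D.s2 * 0 ^ 2 / 2)) : ℝ) : ℂ).re = κ := by simp
    rw [e] at h2
    refine h2.congr fun n => ?_
    simp only [Function.comp_apply, Complex.re_ofReal_mul]
    congr 1
    unfold p
    rw [I0 n, Complex.re_sum]
    refine Finset.sum_congr rfl fun k _ => ?_
    rw [D.h_zero_pow, ← Complex.ofReal_mul, Complex.ofReal_re]
  obtain ⟨c, hc, hlow⟩ : ∃ c, 0 < c ∧ ∀ n : ℕ, 1 ≤ n → c * ww n ≤ S.p n * ρ ^ n := by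
    obtain ⟨N, hN⟩ := Filter.eventually_atTop.1 (hl0.eventually_const_lt (u := κ / 2) (by linarith))
    have hfin : ∃ c, 0 < c ∧ ∀ n ∈ Finset.Icc 1 N, c ≤ S.p n * ρ ^ n := by
      rcases (Finset.Icc 1 N).eq_empty_or_nonempty with he | he
      · exact ⟨1, one_pos, by simp [he]⟩
      · obtain ⟨x, hx, hm⟩ := Finset.exists_min_image (Finset.Icc 1 N) (fun n => S.p n * ρ ^ n) he
        exact ⟨_, mul_pos (S.p_pos (Finset.mem_Icc.1 hx).1) (pow_pos h0 x), hm⟩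
    obtain ⟨c, hc, hm⟩ := hfin
    refine ⟨min c (κ / 2), by positivity, fun n hn => ?_⟩
    have hn1 : (1:ℝ) ≤ n := by exact_mod_cast hn
    have hw0 := ww_pos n
    by_cases h : n ≤ N
    · have hw : ww n ≤ 1 := by
        unfold ww
        rw [div_le_one (by positivity)]
        exact one_le_mul_of_one_le_of_one_le (by linarith) (Real.one_le_sqrt.2 (by linarith))
      calc _ ≤ c * 1 := by gcongr; exact min_le_left _ _
        _ ≤ _ := by rw [mul_one]; exact hm n (by simp; omega)
    · have h2 := hN n (by omega)
      have hsq : 0 < n * Real.sqrt n := by positivity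
      have hw : ww n ≤ 1 / (n * Real.sqrt n) := by
        unfold ww; gcongr <;> linarith
      calc _ ≤ κ / 2 * (1 / (n * Real.sqrt n)) := by gcongr; exact min_le_right _ _
        _ ≤ _ := by
          rw [mul_one_div, div_le_iff₀ hsq]; linarith
  obtain ⟨C1, hC1⟩ := D.mom1
  obtain ⟨C2, hC2⟩ := D.mom2
  have hC1n : 0 ≤ C1 := nonneg_of_mul_nonneg_left ((abs_nonneg _).trans (hC1 0)) (ww_pos 0)
  have hC2n : 0 ≤ C2 := nonneg_of_mul_nonneg_left ((abs_nonneg _).trans (hC2 0)) (ww_pos 0)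
  have hav : ∀ n : ℕ, 1 ≤ n → |S.av n - μ * n| ≤ C1 / c := by
    intro n hn
    have h2 := hC1 n
    have hp := S.p_pos hn
    have hρ := pow_pos h0 n
    rw [← I1 n, S.sum_sub n hn, abs_mul, abs_mul, abs_of_pos hρ, abs_of_pos hp] at h2
    rw [le_div_iff₀ hc]
    have h3 := mul_le_mul_of_nonneg_left (hlow n hn) (abs_nonneg (S.av n - μ * n))
    have hw := ww_pos n
    refine le_of_mul_le_mul_right (a := ww n) ?_ hw
    linarith
  have hvr : ∀ n : ℕ, 1 ≤ n → |(S.vr n + (S.av n - μ * n) ^ 2) - D.s2 * n| ≤ 2 * C2 / c := by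
    intro n hn
    have h2 := hC2 n
    have hp := S.p_pos hn
    have hρ := pow_pos h0 n
    rw [← I2 n, ← I0 n, ← Finset.sum_div, S.sum_sq n hn] at h2
    have e : ρ ^ n * (S.p n * (S.vr n + (S.av n - μ * n) ^ 2) / 2) - D.s2 / 2 * n * ((S.lvl n).card * ρ ^ n) = (S.p n * ρ ^ n) * (((S.vr n + (S.av n - μ * n) ^ 2) - D.s2 * n) / 2) := by
      change _ - D.s2 / 2 * n * (S.p n * ρ ^ n) = _
      ring
    rw [e, abs_mul, abs_of_pos (mul_pos hp hρ), abs_div, abs_of_pos (by norm_num : (0:ℝ) < 2)] at h2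
    rw [le_div_iff₀ hc]
    have h3 := mul_le_mul_of_nonneg_left (hlow n hn) (abs_nonneg ((S.vr n + (S.av n - μ * n) ^ 2) - D.s2 * n))
    refine le_of_mul_le_mul_right (a := ww n) ?_ (ww_pos n)
    linarith
  refine ⟨ρ, μ, D.s2, C1 / c + 2 * C2 / c + (C1 / c) ^ 2, h0, by positivity, hs, fun a => ?_, fun n hn => ?_, fun n hn => ?_, fun s => ?_⟩
  · have h2 := hl0.div (hl0.comp (Filter.tendsto_add_atTop_nat a)) hκ.ne'
    have hr : Filter.Tendsto (fun n : ℕ => ((n + a : ℕ) : ℝ) / n) Filter.atTop (nhds 1) := by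
      have : Filter.Tendsto (fun n : ℕ => 1 + (a : ℝ) / n) Filter.atTop (nhds (1 + 0)) := tendsto_const_nhds.add (tendsto_const_nhds.div_atTop tendsto_natCast_atTop_atTop)
      rw [add_zero] at this
      refine this.congr' ?_
      filter_upwards [Filter.eventually_gt_atTop 0] with n hn
      have : (n : ℝ) ≠ 0 := by positivity
      push_cast; field_simp
    have h3 := ((h2.mul (hr.mul hr.sqrt)).mul_const (ρ ^ a))
    rw [div_self hκ.ne', Real.sqrt_one, mul_one, mul_one, one_mul] at h3
    refine h3.congr' ?_
    filter_upwards [Filter.eventually_gt_atTop 0] with n hn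
    have hn' : (0:ℝ) < n := by positivity
    have hn2 : (0:ℝ) < ((n + a : ℕ) : ℝ) := by positivity
    have hp1 := S.p_pos (n := n) (by omega)
    have hp2 := S.p_pos (n := n + a) (by omega)
    simp only [Function.comp_apply, Pi.div_apply]
    rw [Real.sqrt_div hn2.le]
    have q1 : 0 < Real.sqrt n := by positivity
    have q2 : 0 < Real.sqrt ((n + a : ℕ) : ℝ) := by positivity
    rw [pow_add]
    field_simp
  · have := hav n hn
    have : 0 ≤ 2 * C2 / c + (C1 / c) ^ 2 := by positivity
    linarith
  · have h2 := hvr n hn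
    have h3 := hav n hn
    have h4 : (S.av n - μ * n) ^ 2 ≤ (C1 / c) ^ 2 := by
      rw [← sq_abs (S.av n - μ * n)]; gcongr
    have h5 := sq_nonneg (S.av n - μ * n)
    have h6 : 0 ≤ C1 / c := by positivity
    rw [abs_le] at h2 ⊢
    constructor <;> linarith
  · have h2 := (hlim s).div ((Complex.continuous_ofReal.tendsto _).comp hl0) (by exact_mod_cast hκ.ne')
    rw [← Complex.ofReal_div, mul_div_cancel_left₀ _ hκ.ne'] at h2
    refine h2.congr' ?_
    filter_upwards [Filter.eventually_gt_atTop 0] with n hn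
    have hn' : (0:ℝ) < n := by positivity
    have hp1 := S.p_pos (n := n) (by omega)
    simp only [Function.comp_apply, Pi.div_apply]
    rw [← Iθ]
    have q1 : ((n * Real.sqrt n : ℝ) : ℂ) ≠ 0 := by exact_mod_cast (by positivity : (0:ℝ) < n * Real.sqrt n).ne'
    have q2 : ((ρ ^ n : ℝ) : ℂ) ≠ 0 := by exact_mod_cast (pow_pos h0 n).ne'
    have q3 : (S.p n : ℂ) ≠ 0 := by exact_mod_cast hp1.ne'
    rw [Complex.ofReal_mul (n * Real.sqrt n) (S.p n * ρ ^ n), Complex.ofReal_mul (S.p n)]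
    field_simp
    exact Finset.sum_congr rfl fun x _ => by rw [mul_comm]

end PSys

namespace PSys
open PowerSeries
open scoped ENNReal
variable {𝒯 : Type} (S : PSys 𝒯)

noncomputable def join (R B : 𝒯) : 𝒯 := S.e.symm (S.e R + Finsupp.single B 1)

theorem sz_join (R B : 𝒯) : S.sz (S.join R B) = S.sz R + S.sz B := by
  rw [S.sz_eq (S.join R B), S.sz_eq R, join, Equiv.apply_symm_apply, Finsupp.sum_add_index' (by simp) (by intros; ring)]
  simp; ring

theorem F_join (R B : 𝒯) (h : S.e R B = 0) : S.F (S.join R B) = S.F R + S.F B := by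
  rw [S.F_eq (S.join R B), S.F_eq R, join, Equiv.apply_symm_apply, Finsupp.sum_add_index_of_disjoint]
  · simp
  · rw [Finset.disjoint_left]
    intro t ht ht'
    have := Finsupp.support_single_subset ht'
    simp at this
    subst this
    simp [h] at ht

theorem e_zero {R B : 𝒯} (h : S.sz R ≤ S.sz B) : S.e R B = 0 := by
  by_contra hh
  have := S.sz_lt' hh
  omega

theorem vr_nonneg (n : ℕ) : 0 ≤ S.vr n := by
  unfold vr p; positivity

theorem vr_ge (A n : ℕ) (h : 2 * A < n) :
    ∑ a ∈ Finset.range (A + 1), S.p a * S.p (n - a) / S.p n * (S.vr a + S.vr (n - a)) ≤ S.vr n := by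
  have hp := S.p_pos (n := n) (by omega)
  have key : ∑ a ∈ Finset.range (A + 1), S.p a * S.p (n - a) * (S.vr a + S.vr (n - a))
      ≤ ∑ T ∈ S.lvl n, (S.F T - S.av n) ^ 2 := by
    calc _ ≤ ∑ a ∈ Finset.range (A + 1), ∑ R ∈ S.lvl a, ∑ B ∈ S.lvl (n - S.sz R), (S.F (S.join R B) - S.av n) ^ 2 := by
          refine Finset.sum_le_sum fun a ha => ?_
          have ha' : a ≤ A := by simpa [Nat.lt_succ_iff] using ha
          have e1 : ∀ R ∈ S.lvl a, ∑ B ∈ S.lvl (n - S.sz R), (S.F (S.join R B) - S.av n) ^ 2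
              = S.p (n - a) * S.vr (n - a) + S.p (n - a) * (S.F R - (S.av n - S.av (n - a))) ^ 2 := by
            intro R hR
            have hR' := (S.mem_lvl _ _).1 hR
            rw [hR']
            have : ∀ B ∈ S.lvl (n - a), (S.F (S.join R B) - S.av n) ^ 2 = (S.F B - (S.av n - S.F R)) ^ 2 := by
              intro B hB
              have hB' := (S.mem_lvl _ _).1 hB
              rw [S.F_join R B (S.e_zero (by omega))]; ring
            rw [Finset.sum_congr rfl this, S.sum_sq _ (by omega)]; ring
          rw [Finset.sum_congr rfl e1, Finset.sum_add_distrib, Finset.sum_const, nsmul_eq_mul, ← Finset.mul_sum]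
          change _ ≤ S.p a * _ + _
          rcases Nat.eq_zero_or_pos a with h0 | h0
          · have : S.p a = 0 := by
              subst h0
              unfold p
              rw [Nat.cast_eq_zero, Finset.card_eq_zero, Finset.eq_empty_iff_forall_notMem]
              intro T hT
              have := S.sz_pos T
              have := (S.mem_lvl _ _).1 hT
              omega
            rw [this]
            have : 0 ≤ S.p (n - a) := by unfold p; positivity
            have := Finset.sum_nonneg (fun R (_ : R ∈ S.lvl a) => sq_nonneg (S.F R - (S.av n - S.av (n - a))))
            simp; positivity
          · rw [S.sum_sq a h0]
            have := S.p_pos h0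
            have := S.p_pos (n := n - a) (by omega)
            have : 0 ≤ S.p (n - a) * (S.p a * (S.av a - (S.av n - S.av (n - a))) ^ 2) := by positivity
            nlinarith
      _ = ∑ x ∈ (S.upto A).sigma (fun R => S.lvl (n - S.sz R)), (S.F (S.join x.1 x.2) - S.av n) ^ 2 := by
          rw [Finset.sum_sigma, S.sum_upto]
      _ = ∑ T ∈ ((S.upto A).sigma (fun R => S.lvl (n - S.sz R))).image (fun x => S.join x.1 x.2), (S.F T - S.av n) ^ 2 := by
          rw [Finset.sum_image]
          rintro ⟨R, B⟩ hx ⟨R', B'⟩ hx' hh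
          simp only [Finset.mem_coe, Finset.mem_sigma, S.mem_upto, S.mem_lvl] at hx hx'
          have h1 : S.e R + Finsupp.single B 1 = S.e R' + Finsupp.single B' 1 := S.e.symm.injective hh
          have h2 := DFunLike.congr_fun h1 B'
          simp only [Finsupp.add_apply, Finsupp.single_eq_same, S.e_zero (R := R) (B := B') (by omega)] at h2
          have hB : B = B' := by
            by_contra hne
            rw [Finsupp.single_eq_of_ne' hne] at h2
            omega
          subst hB
          have := S.e.injective (add_right_cancel h1)
          subst this
          rfl
      _ ≤ _ := by
          refine Finset.sum_le_sum_of_subset_of_nonneg ?_ fun _ _ _ => sq_nonneg _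
          intro T hT
          rw [Finset.mem_image] at hT
          obtain ⟨⟨R, B⟩, hx, rfl⟩ := hT
          simp only [Finset.mem_sigma, S.mem_upto, S.mem_lvl] at hx
          rw [S.mem_lvl, S.sz_join]; dsimp only; omega
  rw [vr, le_div_iff₀ hp, Finset.sum_mul]
  refine le_trans (le_of_eq (Finset.sum_congr rfl fun a _ => ?_)) key
  field_simp

theorem vr_three : 0 < S.vr 3 := by
  obtain ⟨L, hL⟩ : ∃ L, L = S.e.symm 0 := ⟨_, rfl⟩
  have sL : S.sz L = 1 := by rw [S.sz_eq, hL]; simp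
  have fL : S.F L = 0 := by rw [S.F_eq, hL]; simp
  obtain ⟨M, hM⟩ : ∃ M, M = S.e.symm (Finsupp.single L 1) := ⟨_, rfl⟩
  have sM : S.sz M = 2 := by rw [S.sz_eq, hM]; simp [sL]
  have fM : S.F M = 0 := by rw [S.F_eq, hM]; simp [fL]
  obtain ⟨P, hP⟩ : ∃ P, P = S.e.symm (Finsupp.single M 1) := ⟨_, rfl⟩
  have sP : S.sz P = 3 := by rw [S.sz_eq, hP]; simp [sM]
  have fP : S.F P = 0 := by rw [S.F_eq, hP]; simp [fM]
  obtain ⟨Q, hQ⟩ : ∃ Q, Q = S.e.symm (Finsupp.single L 2) := ⟨_, rfl⟩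
  have sQ : S.sz Q = 3 := by rw [S.sz_eq, hQ]; simp [sL]
  have fQ : S.F Q = Real.log 2 := by rw [S.F_eq, hQ]; simp [fL]
  have hl : 0 < Real.log 2 := Real.log_pos (by norm_num)
  refine div_pos ?_ (S.p_pos (by norm_num))
  by_contra hh
  have h0 := le_antisymm (not_lt.1 hh) (Finset.sum_nonneg fun T _ => sq_nonneg (S.F T - S.av 3))
  have h1 := (Finset.sum_eq_zero_iff_of_nonneg fun T _ => sq_nonneg (S.F T - S.av 3)).1 h0
  have hp := h1 P ((S.mem_lvl _ _).2 sP)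
  have hq := h1 Q ((S.mem_lvl _ _).2 sQ)
  rw [sq_eq_zero_iff] at hp hq
  linarith

theorem sigma_pos {ρ σ C : ℝ} (hρ : 0 < ρ) (hs : HasSum (fun n => S.p n * ρ ^ n) 1)
    (hr : ∀ a : ℕ, Filter.Tendsto (fun n => S.p n / S.p (n + a)) Filter.atTop (nhds (ρ ^ a)))
    (hv : ∀ n : ℕ, 1 ≤ n → |S.vr n - σ * n| ≤ C) : 0 < σ := by
  by_contra hσ
  push Not at hσ
  have hC : ∀ n : ℕ, 1 ≤ n → S.vr n ≤ C := by
    intro n hn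
    have := (abs_le.1 (hv n hn)).2
    nlinarith [mul_nonneg (neg_nonneg.2 hσ) (Nat.cast_nonneg (α := ℝ) n)]
  obtain ⟨r, hrd⟩ : ∃ r, r = S.p 3 * ρ ^ 3 * S.vr 3 := ⟨_, rfl⟩
  have hr0 : 0 < r := by
    have := S.vr_three
    have := S.p_pos (n := 3) (by norm_num)
    rw [hrd]; positivity
  have hC0 : 0 ≤ C := (S.vr_nonneg 1).trans (hC 1 le_rfl)
  have hpn : ∀ n, 0 ≤ S.p n := fun n => by unfold p; positivity
  obtain ⟨A, hA3, hA⟩ : ∃ A : ℕ, 3 ≤ A ∧ C * (1 - ∑ a ∈ Finset.range (A + 1), S.p a * ρ ^ a) < r / 4 := by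
    have h1 := (hs.tendsto_sum_nat.comp (Filter.tendsto_add_atTop_nat 1)).const_sub 1 |>.const_mul C
    rw [sub_self, mul_zero] at h1
    obtain ⟨A, h2, h3⟩ := ((h1.eventually_lt_const (u := r / 4) (by positivity)).and (Filter.eventually_ge_atTop 3)).exists
    exact ⟨A, h3, h2⟩
  obtain ⟨Q, hQ⟩ : ∃ Q, Q = ∑ a ∈ Finset.range (A + 1), S.p a * ρ ^ a := ⟨_, rfl⟩
  rw [← hQ] at hA
  have hQ1 : Q ≤ 1 := by
    rw [hQ]; exact sum_le_hasSum _ (fun a _ => mul_nonneg (hpn a) (by positivity)) hs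
  have hlim : ∀ a : ℕ, Filter.Tendsto (fun n => S.p (n - a) / S.p n) Filter.atTop (nhds (ρ ^ a)) := by
    intro a
    rw [← Filter.tendsto_add_atTop_iff_nat a]
    simpa using hr a
  have ind : ∀ j : ℕ, ∀ᶠ n in Filter.atTop, j * (r / 4) ≤ S.vr n := by
    intro j
    induction j with
    | zero => exact Filter.Eventually.of_forall fun n => by simpa using S.vr_nonneg n
    | succ j ih =>
      have hjC : j * (r / 4) ≤ C := by
        obtain ⟨n, h1, h2⟩ := (ih.and (Filter.eventually_ge_atTop 1)).exists
        exact h1.trans (hC n h2)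
      have hT : Filter.Tendsto (fun n => ∑ a ∈ Finset.range (A + 1), S.p a * (S.p (n - a) / S.p n) * (S.vr a + j * (r / 4))) Filter.atTop
          (nhds (∑ a ∈ Finset.range (A + 1), S.p a * ρ ^ a * (S.vr a + j * (r / 4)))) :=
        tendsto_finsetSum _ fun a _ => ((hlim a).const_mul _).mul_const _
      have hbig : ((j + 1 : ℕ) : ℝ) * (r / 4) < ∑ a ∈ Finset.range (A + 1), S.p a * ρ ^ a * (S.vr a + j * (r / 4)) := by
        simp_rw [mul_add]
        rw [Finset.sum_add_distrib, ← Finset.sum_mul, ← hQ]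
        have : r ≤ ∑ a ∈ Finset.range (A + 1), S.p a * ρ ^ a * S.vr a := by
          rw [hrd]
          exact Finset.single_le_sum (f := fun a => S.p a * ρ ^ a * S.vr a) (fun a _ => mul_nonneg (mul_nonneg (hpn a) (by positivity)) (S.vr_nonneg a)) (by simp; omega)
        push_cast
        nlinarith [mul_le_mul_of_nonneg_right hjC (sub_nonneg.2 hQ1)]
      have hsh : ∀ a ∈ Finset.range (A + 1), ∀ᶠ n in Filter.atTop, j * (r / 4) ≤ S.vr (n - a) := fun a _ =>
        (Filter.tendsto_sub_atTop_nat a).eventually ih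
      filter_upwards [hT.eventually_const_lt hbig, (Finset.eventually_all _).2 hsh, Filter.eventually_gt_atTop (2 * A)] with n h1 h2 h3
      refine h1.le.trans (le_trans (Finset.sum_le_sum fun a ha => ?_) (S.vr_ge A n h3))
      have := hpn a; have := hpn n; have := hpn (n - a)
      rw [← mul_div_assoc]
      exact mul_le_mul_of_nonneg_left (by linarith [h2 a ha]) (by positivity)
  obtain ⟨j, hj⟩ := exists_nat_gt (C / (r / 4))
  obtain ⟨n, h1, h2⟩ := ((ind j).and (Filter.eventually_ge_atTop 1)).exists
  rw [div_lt_iff₀ (by positivity)] at hj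
  linarith [hC n h2]

end PSys

namespace PSys
variable {𝒯 : Type} (S : PSys 𝒯)

theorem stir (n : ℕ) (hn : 1 ≤ n) :
    |Real.log (n.factorial : ℝ) - ((n : ℝ) * Real.log n - n + (1 / 2) * Real.log n)| ≤ 3 := by
  obtain ⟨m, rfl⟩ : ∃ m, n = m + 1 := ⟨n - 1, by omega⟩
  have h1 := Stirling.log_stirlingSeq_bounded_by_constant m
  have h2 : Real.log (Stirling.stirlingSeq (m + 1)) ≤ Real.log (Stirling.stirlingSeq 1) :=
    Stirling.log_stirlingSeq'_antitone (Nat.zero_le m)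
  rw [Stirling.stirlingSeq_one, Real.log_div (by positivity) (by positivity), Real.log_exp, Real.log_sqrt (by norm_num)] at h2
  rw [Stirling.log_stirlingSeq_formula] at h1 h2
  have e : ((m + 1 : ℕ) : ℝ) ≠ 0 := by positivity
  rw [Real.log_mul (by norm_num) e, Real.log_div e (by positivity), Real.log_exp] at h1 h2
  have l1 : 0 < Real.log 2 := Real.log_pos (by norm_num)
  have l2 : Real.log 2 ≤ 1 := by linarith [Real.log_le_sub_one_of_pos (show (0:ℝ) < 2 by norm_num)]
  rw [abs_le]
  constructor <;> linarith

theorem clt {μ σ C : ℝ} (hσ : 0 < σ) (hav : ∀ n : ℕ, 1 ≤ n → |S.av n - μ * n| ≤ C)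
    (hl : ∀ s : ℝ, Filter.Tendsto (fun n : ℕ => (∑ T ∈ S.lvl n, Complex.exp ((s / Real.sqrt n * (S.F T - μ * n) : ℝ) * Complex.I)) / (S.p n : ℂ))
      Filter.atTop (nhds ((Real.exp (-(σ * s ^ 2 / 2)) : ℝ) : ℂ))) (f : BoundedContinuousFunction ℝ ℝ) :
    Filter.Tendsto (fun n : ℕ => (∑ T ∈ S.lvl n, f (-(S.F T - S.av n) / Real.sqrt n)) / S.p n) Filter.atTop
      (nhds (∫ x, f x ∂(gaussianReal 0 σ.toNNReal))) := by
  obtain ⟨ν, hν⟩ : ∃ ν : ℕ → Measure ℝ, ν = fun n => ∑ T ∈ S.lvl (n + 1), (ENNReal.ofReal (S.p (n + 1))⁻¹) •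
      Measure.dirac (-(S.F T - S.av (n + 1)) / Real.sqrt (n + 1 : ℕ)) := ⟨_, rfl⟩
  have hpr : ∀ n, IsProbabilityMeasure (ν n) := by
    intro n
    have hp := S.p_pos (n := n + 1) (by omega)
    constructor
    rw [hν]
    simp only [Measure.coe_finset_sum, Measure.coe_smul, Finset.sum_apply, Pi.smul_apply, measure_univ, smul_eq_mul, mul_one, Finset.sum_const, nsmul_eq_mul]
    rw [← ENNReal.ofReal_natCast, ← ENNReal.ofReal_mul (by positivity)]
    change ENNReal.ofReal (S.p (n + 1) * _) = 1
    rw [mul_inv_cancel₀ hp.ne', ENNReal.ofReal_one]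
  have hint : ∀ {E : Type} [NormedAddCommGroup E] [NormedSpace ℝ E] [CompleteSpace E] (g : ℝ → E) (n : ℕ),
      ∫ x, g x ∂(ν n) = ∑ T ∈ S.lvl (n + 1), (S.p (n + 1))⁻¹ • g (-(S.F T - S.av (n + 1)) / Real.sqrt (n + 1 : ℕ)) := by
    intro E _ _ _ g n
    have hp := S.p_pos (n := n + 1) (by omega)
    rw [hν]
    simp only
    rw [integral_finsetSum_measure]
    · refine Finset.sum_congr rfl fun T _ => ?_
      rw [integral_smul_measure, integral_dirac, ENNReal.toReal_ofReal (by positivity)]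
    · intro T _
      exact (integrable_dirac (by simp)).smul_measure ENNReal.ofReal_ne_top
  have hch : Filter.Tendsto (β := ProbabilityMeasure ℝ) (fun n => ⟨ν n, hpr n⟩) Filter.atTop (nhds ⟨gaussianReal 0 σ.toNNReal, inferInstance⟩) := by
    refine ProbabilityMeasure.tendsto_of_tendsto_charFun fun t => ?_
    simp only [ProbabilityMeasure.coe_mk]
    rw [charFun_gaussianReal]
    have h1 : Filter.Tendsto (fun n : ℕ => t * (S.av n - μ * n) / Real.sqrt n) Filter.atTop (nhds 0) := by
      have hs : Filter.Tendsto (fun n : ℕ => |t| * C / Real.sqrt n) Filter.atTop (nhds 0) :=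
        Filter.Tendsto.div_atTop tendsto_const_nhds (Real.tendsto_sqrt_atTop.comp tendsto_natCast_atTop_atTop)
      refine squeeze_zero_norm' ?_ hs
      filter_upwards [Filter.eventually_ge_atTop 1] with n hn
      rw [Real.norm_eq_abs, abs_div, abs_mul, abs_of_nonneg (Real.sqrt_nonneg _)]
      gcongr
      exact hav n hn
    have h2 : Filter.Tendsto (fun n : ℕ => Complex.exp ((t * (S.av n - μ * n) / Real.sqrt n : ℝ) * Complex.I)) Filter.atTop (nhds 1) := by
      have : Continuous fun x : ℝ => Complex.exp ((x : ℂ) * Complex.I) := by fun_prop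
      have h := (this.tendsto 0).comp h1
      simp only [Complex.ofReal_zero, zero_mul, Complex.exp_zero] at h
      exact h
    have h3 := (h2.mul (hl (-t))).comp (Filter.tendsto_add_atTop_nat 1)
    have e1 : (1 : ℂ) * ((Real.exp (-(σ * (-t) ^ 2 / 2)) : ℝ) : ℂ) = Complex.exp (t * (0 : ℝ) * Complex.I - (σ.toNNReal : ℝ) * t ^ 2 / 2) := by
      rw [Real.coe_toNNReal _ hσ.le]; push_cast; simp
    rw [e1] at h3
    refine h3.congr fun n => ?_
    rw [charFun_apply_real, hint]
    simp only [Function.comp_apply]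
    rw [mul_div_assoc', Finset.mul_sum, Finset.sum_div]
    refine Finset.sum_congr rfl fun T _ => ?_
    rw [← Complex.exp_add, Complex.real_smul, Complex.ofReal_inv, div_eq_inv_mul]
    congr 2
    push_cast
    ring
  replace hch := ProbabilityMeasure.tendsto_iff_forall_integral_tendsto.1 hch
  rw [← Filter.tendsto_add_atTop_iff_nat 1]
  refine (hch f).congr fun n => ?_
  simp only [ProbabilityMeasure.coe_mk]
  rw [hint, Finset.sum_div]
  exact Finset.sum_congr rfl fun T _ => by rw [smul_eq_mul, inv_mul_eq_div]

end PSys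

/-- Let `logL n` be the logarithm of the number of labelings
`L = n!/|Aut T|` of an isomorphism class of rooted labeled trees on `n`
vertices (a quantity depending only on the class, i.e. on the corresponding
Pólya tree).  Under the uniform distribution on isomorphism classes of size
`n`, the mean of `logL n` is `n·log n - (μ+1)n + (1/2)·log n + O(1)`, the
variance is `σ²n + O(1)`, and the standardized variable converges in
distribution to `N(0, σ²)`. -/
theorem log_number_of_labelings_polya_clt
    (logL : ∀ n : ℕ, Polya n → ℝ)
    (hlogL : ∀ (n : ℕ) (T : RTree n),
      logL n (Quot.mk _ T) = Real.log ((n.factorial : ℝ) / (T.autCard : ℝ))) :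
    ∃ (μ : ℝ) (σ2 : NNReal) (C : ℝ), 0 < σ2 ∧ 0 < C ∧
      (∀ n : ℕ, 1 ≤ n →
        |(∑ q : Polya n, logL n q) / (Nat.card (Polya n) : ℝ) -
            ((n : ℝ) * Real.log n - (μ + 1) * n + (1 / 2) * Real.log n)| ≤ C ∧
        |(∑ q : Polya n,
            (logL n q - (∑ q' : Polya n, logL n q') / (Nat.card (Polya n) : ℝ)) ^ 2) /
              (Nat.card (Polya n) : ℝ) - (σ2 : ℝ) * n| ≤ C) ∧
      ∀ f : BoundedContinuousFunction ℝ ℝ,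
        Filter.Tendsto
          (fun n : ℕ =>
            (∑ q : Polya n,
                f ((logL n q - (∑ q' : Polya n, logL n q') / (Nat.card (Polya n) : ℝ)) /
                  Real.sqrt n)) /
              (Nat.card (Polya n) : ℝ))
          Filter.atTop (nhds (∫ x, f x ∂(gaussianReal 0 σ2))) := by
  obtain ⟨ρ, μ, σ, C, hρ, hC, hs, hr, hav, hvr, hl⟩ := PF.sys.asym
  have hσ := PF.sys.sigma_pos hρ hs hr hvr
  have hcard : ∀ n, (Nat.card (Polya n) : ℝ) = PF.sys.p n := fun n => by
    rw [← PF.sys_card n]; rfl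
  have hmean : ∀ n : ℕ, 1 ≤ n → (∑ q : Polya n, logL n q) / (Nat.card (Polya n) : ℝ) = Real.log n.factorial - PF.sys.av n := by
    intro n hn
    have hp := (PF.sys.p_pos hn).ne'
    rw [hcard, PF.sys_sum logL hlogL n (fun x => x)]
    have := PF.sys.sum_sub n hn (Real.log n.factorial)
    have h2 : ∑ T ∈ PF.sys.lvl n, (Real.log n.factorial - PF.sys.F T) = - ∑ T ∈ PF.sys.lvl n, (PF.sys.F T - Real.log n.factorial) := by
      rw [← Finset.sum_neg_distrib]; exact Finset.sum_congr rfl fun T _ => by ring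
    rw [h2, this]; field_simp; ring
  refine ⟨μ, σ.toNNReal, C + 3, by simpa using hσ, by linarith, fun n hn => ⟨?_, ?_⟩, fun f => ?_⟩
  · rw [hmean n hn]
    have h1 := abs_le.1 (PSys.stir n hn)
    have h2 := abs_le.1 (hav n hn)
    rw [abs_le]
    constructor <;> linarith [h1.1, h1.2, h2.1, h2.2]
  · rw [hmean n hn, hcard, PF.sys_sum logL hlogL n (fun x => (x - (Real.log n.factorial - PF.sys.av n)) ^ 2), Real.coe_toNNReal _ hσ.le]
    have h1 := hvr n hn
    have h2 : ∑ T ∈ PF.sys.lvl n, (Real.log n.factorial - PF.sys.F T - (Real.log n.factorial - PF.sys.av n)) ^ 2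
        = ∑ T ∈ PF.sys.lvl n, (PF.sys.F T - PF.sys.av n) ^ 2 := Finset.sum_congr rfl fun T _ => by ring
    rw [h2]
    exact h1.trans (by linarith)
  · refine (PF.sys.clt hσ hav hl f).congr' ?_
    filter_upwards [Filter.eventually_ge_atTop 1] with n hn
    rw [hmean n hn, hcard, PF.sys_sum logL hlogL n (fun x => f ((x - (Real.log n.factorial - PF.sys.av n)) / Real.sqrt n))]
    congr 1
    refine Finset.sum_congr rfl fun T _ => ?_
    congr 2
    ring
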